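/- Let G be a minor-minimal enemy. Then there exists no 4-separation (A,B) of G such that |A − B| ≥ 2 and |B − A| ≥ 2. -/

import Mathlib

open SimpleGraph

/-- `K7vee` is the graph obtained from `K 7` by deleting two edges with a common end. -/
def K7vee : SimpleGraph (Fin 7) :=
  (completeGraph (Fin 7)).deleteEdges {s(0, 1), s(0, 2)}

/-- `K6vee` is the graph obtained from `K 6` by deleting two edges with a common end. -/
def K6vee : SimpleGraph (Fin 6) :=
  (completeGraph (Fin 6)).deleteEdges {s(0, 1), s(0, 2)}

/-- The complete multipartite graph with four parts of size two. -/
def K2222 : SimpleGraph (Fin 4 × Fin 2) :=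
  SimpleGraph.comap Prod.fst (completeGraph (Fin 4))

/-- `H` is a minor of `G`: there is a model of `H` in `G`, i.e. a family of pairwise disjoint
nonempty connected branch sets, one for each vertex of `H`, with edges of `G` between branch
sets corresponding to adjacent vertices of `H`. -/
def IsMinor {W V : Type} (H : SimpleGraph W) (G : SimpleGraph V) : Prop :=
  ∃ bag : W → Set V,
    (∀ w, (G.induce (bag w)).Connected) ∧
    (∀ w w', w ≠ w' → Disjoint (bag w) (bag w')) ∧
    (∀ w w', H.Adj w w' → ∃ u ∈ bag w, ∃ v ∈ bag w', G.Adj u v)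

/-- A graph is `k`-connected if it has more than `k` vertices and stays connected after
removing any set of fewer than `k` vertices. -/
def IsKConnected {V : Type} [Fintype V] (k : ℕ) (G : SimpleGraph V) : Prop :=
  k < Fintype.card V ∧ ∀ S : Set V, S.ncard < k → (G.induce (Sᶜ : Set V)).Connected

/-- A separation of `G`: `A ∪ B = V(G)` and no edge joins `A - B` to `B - A`. -/
def IsSeparation {V : Type} (G : SimpleGraph V) (A B : Set V) : Prop :=
  A ∪ B = Set.univ ∧ ∀ ⦃u v : V⦄, G.Adj u v → ¬(u ∈ A \ B ∧ v ∈ B \ A)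

/-- `(G, Z)` is internally `k`-connected: every separation `(A,B)` of `G` with `Z ⊆ A`
and `B - A ≠ ∅` has order at least `k`. -/
def InternallyConnected {V : Type} (G : SimpleGraph V) (Z : Set V) (k : ℕ) : Prop :=
  ∀ A B : Set V, IsSeparation G A B → Z ⊆ A → (B \ A).Nonempty →
    k ≤ (A ∩ B).ncard

/-- A `Z`-rooted `K₄`-model in `G`. -/
def HasRootedK4Model {V : Type} (G : SimpleGraph V) (Z : Set V) : Prop :=
  ∃ B : Fin 4 → Set V,
    (∀ i, (G.induce (B i)).Connected) ∧
    (∀ i j, i ≠ j → Disjoint (B i) (B j)) ∧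
    (∀ i, ∃! z : V, z ∈ Z ∧ z ∈ B i) ∧
    (∀ z ∈ Z, ∃ i, z ∈ B i) ∧
    (∀ i j, i ≠ j → ∃ u ∈ B i, ∃ v ∈ B j, G.Adj u v)

/-- A `Z`-rooted `K*₄,₂`-model in `G`. -/
def HasRootedK42starModel {V : Type} (G : SimpleGraph V) (Z : Set V) : Prop :=
  ∃ (B : Fin 4 → Set V) (C : Fin 2 → Set V),
    (∀ i, (G.induce (B i)).Connected) ∧
    (∀ j, (G.induce (C j)).Connected) ∧
    (∀ i j, i ≠ j → Disjoint (B i) (B j)) ∧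
    (∀ i j, i ≠ j → Disjoint (C i) (C j)) ∧
    (∀ i j, Disjoint (B i) (C j)) ∧
    (∀ i, ∃! z : V, z ∈ Z ∧ z ∈ B i) ∧
    (∀ z ∈ Z, ∃ i, z ∈ B i) ∧
    (∀ i j, ∃ u ∈ B i, ∃ v ∈ C j, G.Adj u v) ∧
    (∃ u ∈ C 0, ∃ v ∈ C 1, G.Adj u v)

/-- An enemy: a `4`-connected graph with `|E(G)| ≥ 4|V(G)| - 8`, with no `K7vee`-minor,
not isomorphic to `K_{2,2,2,2}`. -/
def Enemy {V : Type} [Fintype V] (G : SimpleGraph V) : Prop :=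
  IsKConnected 4 G ∧
    4 * (Fintype.card V : ℤ) - 8 ≤ (G.edgeSet.ncard : ℤ) ∧
    ¬ IsMinor K7vee G ∧
    IsEmpty (G ≃g K2222)

/-- A minor-minimal enemy: an enemy, no minor of which, other than itself, is an enemy. -/
def MinorMinimalEnemy {V : Type} [Fintype V] (G : SimpleGraph V) : Prop :=
  Enemy G ∧ ∀ (W : Type) [Fintype W] (H : SimpleGraph W),
    IsMinor H G → Enemy H → Nonempty (H ≃g G)

/-- The simple graph obtained from `G` by contracting the edge `uv`
(`v` is merged into `u`). -/
def contractEdge {V : Type} (G : SimpleGraph V) (u v : V) :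
    SimpleGraph {x : V // x ≠ v} :=
  SimpleGraph.fromRel (fun x y => G.Adj ↑x ↑y ∨ ((x : V) = u ∧ G.Adj v ↑y))

/-- A graph is `7`-contraction-critical if its chromatic number is `7` and
every minor of it, other than itself, has chromatic number less than `7`. -/
def ContractionCritical7 {V : Type} [Fintype V] (G : SimpleGraph V) : Prop :=
  G.chromaticNumber = 7 ∧
    ∀ (W : Type) [Fintype W] (H : SimpleGraph W),
      IsMinor H G → IsEmpty (H ≃g G) → H.chromaticNumber < 7

section Connectivity

variable {V : Type} {G G' : SimpleGraph V}

/-- Some edge of `G` joins `A` to `B`. -/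
def Touch (G : SimpleGraph V) (A B : Set V) : Prop := ∃ a ∈ A, ∃ b ∈ B, G.Adj a b

/-- `A` is nonempty and every partition of `A` into two nonempty parts is crossed by an edge. -/
def Conn (G : SimpleGraph V) (A : Set V) : Prop :=
  A.Nonempty ∧ ∀ T : Set V, (∃ a ∈ A, a ∈ T) → (∃ b ∈ A, b ∉ T) →
    ∃ a ∈ A, a ∈ T ∧ ∃ b ∈ A, b ∉ T ∧ G.Adj a b

theorem Touch.symm {A B : Set V} (h : Touch G A B) : Touch G B A := by
  obtain ⟨a, ha, b, hb, hab⟩ := h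
  exact ⟨b, hb, a, ha, hab.symm⟩

theorem Touch.mono {A B A' B' : Set V} (h : Touch G A B) (hA : A ⊆ A') (hB : B ⊆ B') :
    Touch G A' B' := by
  obtain ⟨a, ha, b, hb, hab⟩ := h
  exact ⟨a, hA ha, b, hB hb, hab⟩

theorem conn_singleton (G : SimpleGraph V) (v : V) : Conn G {v} :=
  ⟨⟨v, rfl⟩, by rintro T ⟨a, rfl, ha⟩ ⟨b, rfl, hb⟩; exact absurd ha hb⟩

theorem Conn.mono {A : Set V} (h : Conn G A)
    (hle : ∀ a ∈ A, ∀ b ∈ A, G.Adj a b → G'.Adj a b) : Conn G' A := by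
  refine ⟨h.1, fun T h1 h2 => ?_⟩
  obtain ⟨a, ha, haT, b, hb, hbT, hab⟩ := h.2 T h1 h2
  exact ⟨a, ha, haT, b, hb, hbT, hle a ha b hb hab⟩

/-- The union of connected sets indexed by a connected set is connected. -/
theorem Conn.biUnion {W : Type} {H : SimpleGraph W} {A : Set W} (h : Conn H A) {φ : W → Set V}
    (hφ : ∀ v ∈ A, Conn G (φ v))
    (hadj : ∀ v ∈ A, ∀ w ∈ A, H.Adj v w → Touch G (φ v) (φ w)) :
    Conn G (⋃ v ∈ A, φ v) := by
  refine ⟨?_, fun T h1 h2 => ?_⟩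
  · obtain ⟨v, hv⟩ := h.1
    obtain ⟨x, hx⟩ := (hφ v hv).1
    exact ⟨x, Set.mem_biUnion hv hx⟩
  · by_contra hcon
    have key : ∀ v ∈ A, ∀ x ∈ φ v, ∀ y ∈ φ v, x ∈ T → y ∈ T := by
      intro v hv x hx y hy hxT
      by_contra hyT
      obtain ⟨a, ha, haT, b, hb, hbT, hab⟩ := (hφ v hv).2 T ⟨x, hx, hxT⟩ ⟨y, hy, hyT⟩
      exact hcon ⟨a, Set.mem_biUnion hv ha, haT, b, Set.mem_biUnion hv hb, hbT, hab⟩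
    obtain ⟨a, ha, haT⟩ := h1
    obtain ⟨b, hb, hbT⟩ := h2
    simp only [Set.mem_iUnion, exists_prop] at ha hb
    obtain ⟨v, hv, hav⟩ := ha
    obtain ⟨w, hw, hbw⟩ := hb
    obtain ⟨p, hp, ⟨x, hx, hxT⟩, q, hq, hqT, hpq⟩ :=
      h.2 {v | ∃ x ∈ φ v, x ∈ T} ⟨v, hv, a, hav, haT⟩
        ⟨w, hw, fun ⟨x, hx, hxT⟩ => hbT (key w hw x hx b hbw hxT)⟩
    obtain ⟨c, hc, d, hd, hcd⟩ := hadj p hp q hq hpq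
    exact hcon ⟨c, Set.mem_biUnion hp hc, key p hp x hx c hc hxT, d, Set.mem_biUnion hq hd,
      fun hdT => hqT ⟨d, hd, hdT⟩, hcd⟩

theorem Conn.union {A B : Set V} (hA : Conn G A) (hB : Conn G B) (h : Touch G A B) :
    Conn G (A ∪ B) := by
  have h2 : Conn (⊤ : SimpleGraph Bool) Set.univ := by
    refine ⟨⟨true, trivial⟩, ?_⟩
    rintro T ⟨a, -, ha⟩ ⟨b, -, hb⟩
    exact ⟨a, trivial, ha, b, trivial, hb, fun hab => hb (hab ▸ ha)⟩
  have h3 := h2.biUnion (G := G) (φ := fun i => cond i A B) (by simp [hA, hB]) (by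
    intro v _ w _ hvw
    cases v <;> cases w <;> simp_all [h.symm])
  convert h3 using 1
  ext x
  simp [or_comm]

theorem Conn.insert {A : Set V} {v : V} (hA : Conn G A) (h : ∃ a ∈ A, G.Adj v a) :
    Conn G (insert v A) := by
  obtain ⟨a, ha, hva⟩ := h
  exact (conn_singleton G v).union hA ⟨v, rfl, a, ha, hva⟩

theorem Conn.union_of_inter {A B : Set V} (hA : Conn G A) (hB : Conn G B)
    (h : (A ∩ B).Nonempty) : Conn G (A ∪ B) := by
  obtain ⟨c, hcA, hcB⟩ := h
  refine ⟨⟨c, Or.inl hcA⟩, fun T h1 h2 => ?_⟩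
  by_contra hcon
  have hA' : ∀ x ∈ A, ∀ y ∈ A, x ∈ T → y ∈ T := fun x hx y hy hxT => by
    by_contra hyT
    obtain ⟨a, ha, haT, b, hb, hbT, hab⟩ := hA.2 T ⟨x, hx, hxT⟩ ⟨y, hy, hyT⟩
    exact hcon ⟨a, Or.inl ha, haT, b, Or.inl hb, hbT, hab⟩
  have hB' : ∀ x ∈ B, ∀ y ∈ B, x ∈ T → y ∈ T := fun x hx y hy hxT => by
    by_contra hyT
    obtain ⟨a, ha, haT, b, hb, hbT, hab⟩ := hB.2 T ⟨x, hx, hxT⟩ ⟨y, hy, hyT⟩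
    exact hcon ⟨a, Or.inr ha, haT, b, Or.inr hb, hbT, hab⟩
  obtain ⟨a, ha, haT⟩ := h1
  obtain ⟨b, hb, hbT⟩ := h2
  have hcT : c ∈ T := ha.elim (fun ha => hA' a ha c hcA haT) (fun ha => hB' a ha c hcB haT)
  exact hb.elim (fun hb => hbT (hA' c hcA b hb hcT)) (fun hb => hbT (hB' c hcB b hb hcT))

theorem Touch.biUnion {W : Type} {H : SimpleGraph W} {A B : Set W} (h : Touch H A B)
    {φ ψ : W → Set V} (hadj : ∀ v ∈ A, ∀ w ∈ B, H.Adj v w → Touch G (φ v) (ψ w)) :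
    Touch G (⋃ v ∈ A, φ v) (⋃ w ∈ B, ψ w) := by
  obtain ⟨a, ha, b, hb, hab⟩ := h
  exact (hadj a ha b hb hab).mono (Set.subset_biUnion_of_mem (u := φ) ha)
    (Set.subset_biUnion_of_mem (u := ψ) hb)

theorem induce_connected_iff_conn (A : Set V) : (G.induce A).Connected ↔ Conn G A := by
  constructor
  · intro h
    refine ⟨Set.nonempty_coe_sort.mp h.nonempty, ?_⟩
    rintro T ⟨a, ha, haT⟩ ⟨b, hb, hbT⟩
    obtain ⟨p⟩ := h.preconnected ⟨a, ha⟩ ⟨b, hb⟩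
    obtain ⟨d, -, h1, h2⟩ := p.exists_boundary_dart {x | (x : V) ∈ T} haT hbT
    exact ⟨d.fst, d.fst.2, h1, d.snd, d.snd.2, h2, d.adj⟩
  · intro h
    have : Nonempty A := h.1.to_subtype
    refine ⟨fun x y => ?_⟩
    by_contra hxy
    obtain ⟨a, ha, ⟨ha', har⟩, b, hb, hbT, hab⟩ :=
      h.2 {v | ∃ hv : v ∈ A, (G.induce A).Reachable x ⟨v, hv⟩} ⟨x, x.2, x.2, .rfl⟩
        ⟨y, y.2, fun ⟨_, hr⟩ => hxy hr⟩
    refine hbT ⟨hb, har.trans (SimpleGraph.Adj.reachable ?_)⟩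
    exact hab

end Connectivity

theorem IsMinor.trans {U W V : Type} {K : SimpleGraph U} {H : SimpleGraph W} {G : SimpleGraph V}
    (h1 : IsMinor K H) (h2 : IsMinor H G) : IsMinor K G := by
  obtain ⟨b, hb, hbd, hba⟩ := h1
  obtain ⟨c, hc, hcd, hca⟩ := h2
  simp only [induce_connected_iff_conn] at hb hc
  refine ⟨fun u => ⋃ w ∈ b u, c w, fun u => ?_, fun u u' huu => ?_, fun u u' huu => ?_⟩
  · rw [induce_connected_iff_conn]
    exact (hb u).biUnion (fun v _ => hc v) (fun v _ w _ hvw => hca v w hvw)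
  · rw [Set.disjoint_left]
    intro x hx hx'
    simp only [Set.mem_iUnion, exists_prop] at hx hx'
    obtain ⟨w, hw, hxw⟩ := hx
    obtain ⟨w', hw', hxw'⟩ := hx'
    have hne : w ≠ w' := by
      rintro rfl
      exact Set.disjoint_left.mp (hbd u u' huu) hw hw'
    exact Set.disjoint_left.mp (hcd w w' hne) hxw hxw'
  · obtain ⟨w, hw, w', hw', hadj⟩ := hba u u' huu
    obtain ⟨x, hx, y, hy, hxy⟩ := hca w w' hadj
    exact ⟨x, Set.mem_biUnion hw hx, y, Set.mem_biUnion hw' hy, hxy⟩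

section Linkage

open Finset
open scoped Classical

variable {V : Type} [Fintype V] {G : SimpleGraph V}

/-- The set of vertices outside `S` with a neighbour in `S`. -/
noncomputable def nb (G : SimpleGraph V) (S : Finset V) : Finset V :=
  {v | v ∉ S ∧ ∃ s ∈ S, G.Adj s v}

theorem mem_nb {S : Finset V} {v : V} : v ∈ nb G S ↔ v ∉ S ∧ ∃ s ∈ S, G.Adj s v := by
  simp [nb]

/-- Disjoint connected sets `b y`, one for each neighbour `y` of `T`, contained in `T \ S` apart
from `y`, each containing exactly one neighbour `τ y` of `S`. -/
structure Linkage (G : SimpleGraph V) (S T : Finset V) (b : V → Set V) (τ : V → V) : Prop where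
  conn : ∀ y ∈ nb G T, Conn G (b y)
  root : ∀ y ∈ nb G T, y ∈ b y
  sub : ∀ y ∈ nb G T, ∀ v ∈ b y, (v ∈ T ∧ v ∉ S) ∨ v = y
  foot : ∀ y ∈ nb G T, τ y ∈ b y
  foot_mem : ∀ y ∈ nb G T, τ y ∈ nb G S
  foot_unique : ∀ y ∈ nb G T, ∀ v ∈ b y, v ∈ nb G S → v = τ y
  disj : ∀ y ∈ nb G T, ∀ z ∈ nb G T, y ≠ z → Disjoint (b y) (b z)

/-- A form of Menger's theorem. -/
theorem exists_linkage : ∀ (n : ℕ) (G : SimpleGraph V) (S T : Finset V), #(T \ S) = n → S ⊆ T →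
    (∀ R, S ⊆ R → R ⊆ T → #(nb G T) ≤ #(nb G R)) → ∃ b τ, Linkage G S T b τ := by
  intro n
  induction n using Nat.strong_induction_on with
  | _ n ih =>
  intro G S T hn hST hmin
  by_cases hsub : nb G T ⊆ nb G S
  · refine ⟨fun y => {y}, id, fun y _ => conn_singleton G y, fun _ _ => rfl, fun _ _ v hv => Or.inr hv,
      fun _ _ => rfl, fun y hy => hsub hy, fun _ _ v hv _ => hv, fun y _ z _ hyz => by simpa using hyz⟩
  obtain ⟨y, hyT, hyS⟩ := not_subset.mp hsub
  by_cases hR : ∃ R, S ⊂ R ∧ R ⊂ T ∧ #(nb G R) = #(nb G T)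
  · obtain ⟨R, hSR, hRT, hcard⟩ := hR
    obtain ⟨b₁, τ₁, h₁⟩ := ih #(R \ S) (hn ▸ card_lt_card (by
      obtain ⟨x, hx, hxR⟩ := exists_of_ssubset hRT
      refine ⟨sdiff_subset_sdiff hRT.1 le_rfl, fun h => ?_⟩
      exact hxR (mem_sdiff.mp (h (mem_sdiff.mpr ⟨hx, fun hxS => hxR (hSR.1 hxS)⟩))).1)) G S R rfl
      hSR.1 (fun R' h h' => hcard ▸ hmin R' h (h'.trans hRT.1))
    obtain ⟨b₂, τ₂, h₂⟩ := ih #(T \ R) (hn ▸ card_lt_card (by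
      obtain ⟨x, hx, hxS⟩ := exists_of_ssubset hSR
      refine ⟨sdiff_subset_sdiff le_rfl hSR.1, fun h => ?_⟩
      exact (mem_sdiff.mp (h (mem_sdiff.mpr ⟨hRT.1 hx, hxS⟩))).2 hx)) G R T rfl
      hRT.1 (fun R' h h' => hmin R' (hSR.1.trans h) h')
    have hout : ∀ z ∈ nb G T, ∀ v ∈ b₂ z, v ∉ R := by
      intro z hz v hv hvR
      rcases h₂.sub z hz v hv with h | rfl
      · exact h.2 hvR
      · exact (mem_nb.mp hz).1 (hRT.1 hvR)
    have hcross : ∀ z ∈ nb G T, ∀ z' ∈ nb G T, z ≠ z' → Disjoint (b₂ z) (b₁ (τ₂ z')) := by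
      intro z hz z' hz' hne
      rw [Set.disjoint_left]
      intro v hv hv'
      rcases h₁.sub _ (h₂.foot_mem z' hz') v hv' with h | rfl
      · exact hout z hz v hv h.1
      · exact Set.disjoint_left.mp (h₂.disj z hz z' hz' hne) hv (h₂.foot z' hz')
    refine ⟨fun z => b₂ z ∪ b₁ (τ₂ z), fun z => τ₁ (τ₂ z), fun z hz => ?_, fun z hz => ?_,
      fun z hz v hv => ?_, fun z hz => ?_, fun z hz => ?_, fun z hz v hv hvS => ?_,
      fun z hz z' hz' hne => ?_⟩
    · exact (h₂.conn z hz).union_of_inter (h₁.conn _ (h₂.foot_mem z hz))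
        ⟨τ₂ z, h₂.foot z hz, h₁.root _ (h₂.foot_mem z hz)⟩
    · exact Or.inl (h₂.root z hz)
    · rcases hv with hv | hv
      · exact (h₂.sub z hz v hv).imp_left fun h => ⟨h.1, fun hS => h.2 (hSR.1 hS)⟩
      · rcases h₁.sub _ (h₂.foot_mem z hz) v hv with h | rfl
        · exact Or.inl ⟨hRT.1 h.1, h.2⟩
        · exact (h₂.sub z hz _ (h₂.foot z hz)).imp_left fun h => ⟨h.1, fun hS => h.2 (hSR.1 hS)⟩
    · exact Or.inr (h₁.foot _ (h₂.foot_mem z hz))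
    · exact h₁.foot_mem _ (h₂.foot_mem z hz)
    · have hv1 : v ∈ b₁ (τ₂ z) := by
        rcases hv with hv | hv
        · obtain ⟨-, s, hs, hsv⟩ := mem_nb.mp hvS
          have : v = τ₂ z := h₂.foot_unique z hz v hv (mem_nb.mpr ⟨hout z hz v hv, s, hSR.1 hs, hsv⟩)
          exact this ▸ h₁.root _ (this ▸ h₂.foot_mem z hz)
        · exact hv
      exact h₁.foot_unique _ (h₂.foot_mem z hz) v hv1 hvS
    · have hττ : τ₂ z ≠ τ₂ z' := fun h =>
        Set.disjoint_left.mp (h₂.disj z hz z' hz' hne) (h₂.foot z hz) (h ▸ h₂.foot z' hz')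
      rw [Set.disjoint_union_left, Set.disjoint_union_right, Set.disjoint_union_right]
      exact ⟨⟨h₂.disj z hz z' hz' hne, hcross z hz z' hz' hne⟩,
        (hcross z' hz' z hz hne.symm).symm,
        h₁.disj _ (h₂.foot_mem z hz) _ (h₂.foot_mem z' hz') hττ⟩
  · push Not at hR
    obtain ⟨hyT', t, ht, hty⟩ := mem_nb.mp hyT
    have htS : t ∉ S := fun h => hyS (mem_nb.mpr ⟨fun h => hyT' (hST h), t, h, hty⟩)
    let G₁ : SimpleGraph V :=
      { Adj := fun a b => G.Adj a b ∧ a ≠ y ∧ b ≠ y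
        symm := ⟨fun a b h => ⟨h.1.symm, h.2.2, h.2.1⟩⟩
        loopless := ⟨fun a h => G.loopless.irrefl a h.1⟩ }
    have hST1 : S ⊆ T.erase t := fun x hx => mem_erase.mpr ⟨fun h => htS (h ▸ hx), hST hx⟩
    have hlow : ∀ R, R ⊆ T.erase t → (nb G R).erase y ⊆ nb G₁ R := by
      intro R hR v hv
      obtain ⟨hvy, hv⟩ := mem_erase.mp hv
      obtain ⟨hvR, s, hs, hsv⟩ := mem_nb.mp hv
      exact mem_nb.mpr ⟨hvR, s, hs, hsv, fun h => hyT' (mem_of_mem_erase (hR (h ▸ hs))), hvy⟩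
    have hnS : nb G₁ S = nb G S := by
      apply subset_antisymm
      · intro v hv
        obtain ⟨hvR, s, hs, hsv⟩ := mem_nb.mp hv
        exact mem_nb.mpr ⟨hvR, s, hs, hsv.1⟩
      · simpa [hyS] using hlow S hST1
    have hge : ∀ R, S ⊆ R → R ⊆ T.erase t → #(nb G T) ≤ #(nb G₁ R) := by
      intro R hSR hRT
      by_cases hRS : R = S
      · rw [hRS, hnS]; exact hmin S le_rfl hST
      · have hRT' : R ⊂ T := lt_of_le_of_lt hRT (erase_ssubset ht)
        have h1 := hR R (lt_of_le_of_ne hSR (Ne.symm hRS)) hRT'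
        have h2 := hmin R hSR hRT'.1
        have h3 := card_le_card (hlow R hRT)
        have h4 := pred_card_le_card_erase (s := nb G R) (a := y)
        omega
    have hup : nb G₁ (T.erase t) ⊆ insert t ((nb G T).erase y) := by
      intro v hv
      obtain ⟨hvT, s, hs, hsv⟩ := mem_nb.mp hv
      by_cases hvt : v = t
      · simp [hvt]
      · refine mem_insert_of_mem (mem_erase.mpr ⟨hsv.2.2, mem_nb.mpr ⟨fun h => ?_, s,
          mem_of_mem_erase hs, hsv.1⟩⟩)
        exact hvT (mem_erase.mpr ⟨hvt, h⟩)
    have hupc : #(insert t ((nb G T).erase y)) ≤ #(nb G T) := by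
      refine (card_insert_le _ _).trans ?_
      rw [card_erase_add_one hyT]
    have heq := eq_of_subset_of_card_le hup (hupc.trans (hge _ hST1 le_rfl))
    obtain ⟨b, τ, hb⟩ := ih #(T.erase t \ S) (hn ▸ card_lt_card (by
      refine ⟨sdiff_subset_sdiff (erase_subset _ _) le_rfl, fun h => ?_⟩
      exact notMem_erase t T (mem_sdiff.mp (h (mem_sdiff.mpr ⟨ht, htS⟩))).1)) G₁ S (T.erase t) rfl
      hST1 (fun R h h' => (card_le_card hup).trans (hupc.trans (hge R h h')))
    have hmt : t ∈ nb G₁ (T.erase t) := by simp [heq]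
    have hm : ∀ z ∈ nb G T, z ≠ y → z ∈ nb G₁ (T.erase t) := fun z hz hzy => by simp [heq, hz, hzy]
    let σ : V → V := fun z => if z = y then t else z
    have hσ : ∀ z ∈ nb G T, σ z ∈ nb G₁ (T.erase t) := by
      intro z hz
      by_cases hzy : z = y
      · simpa [σ, hzy] using hmt
      · simpa [σ, hzy] using hm z hz hzy
    have hσinj : ∀ z ∈ nb G T, ∀ z' ∈ nb G T, z ≠ z' → σ z ≠ σ z' := by
      intro z hz z' hz' hne h
      have h1 : z ≠ t := fun h => (mem_nb.mp hz).1 (h ▸ ht)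
      have h2 : z' ≠ t := fun h => (mem_nb.mp hz').1 (h ▸ ht)
      simp only [σ] at h
      split_ifs at h with h3 h4 h4
      · exact hne (h3.trans h4.symm)
      · exact h2 h.symm
      · exact h1 h
      · exact hne h
    have hsub' : ∀ z ∈ nb G T, ∀ v ∈ b (σ z), (v ∈ T ∧ v ∉ S) ∨ v = z := by
      intro z hz v hv
      rcases hb.sub _ (hσ z hz) v hv with h | h
      · exact Or.inl ⟨mem_of_mem_erase h.1, h.2⟩
      · by_cases hzy : z = y
        · simp only [σ, hzy, if_true] at h
          exact Or.inl (h ▸ ⟨ht, htS⟩)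
        · simp only [σ, hzy, if_false] at h
          exact Or.inr h
    have hy' : ∀ z ∈ nb G T, z ≠ y → y ∉ b (σ z) := by
      intro z hz hzy h
      rcases hsub' z hz y h with h | h
      · exact hyT' h.1
      · exact hzy h.symm
    have hc : ∀ z ∈ nb G T, Conn G (b (σ z)) := fun z hz =>
      (hb.conn _ (hσ z hz)).mono fun _ _ _ _ h => h.1
    have hd : ∀ z ∈ nb G T, ∀ z' ∈ nb G T, z ≠ z' → Disjoint (b (σ z)) (b (σ z')) :=
      fun z hz z' hz' hne => hb.disj _ (hσ z hz) _ (hσ z' hz') (hσinj z hz z' hz' hne)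
    refine ⟨fun z => if z = y then insert y (b (σ z)) else b (σ z), fun z => τ (σ z),
      fun z hz => ?_, fun z hz => ?_, fun z hz v hv => ?_, fun z hz => ?_, fun z hz => ?_,
      fun z hz v hv hvS => ?_, fun z hz z' hz' hne => ?_⟩
    · by_cases hzy : z = y
      · simp only [hzy, if_true]
        exact (hc y hyT).insert ⟨t, by simpa [σ] using hb.root t hmt, hty.symm⟩
      · simpa only [hzy, if_false] using hc z hz
    · by_cases hzy : z = y
      · simp [hzy]
      · simpa [σ, hzy] using hb.root z (hm z hz hzy)
    · by_cases hzy : z = y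
      · subst hzy
        simp only [if_true] at hv
        rcases hv with hv | hv
        · exact Or.inr hv
        · exact hsub' z hz v hv
      · simp only [hzy, if_false] at hv
        exact hsub' z hz v hv
    · by_cases hzy : z = y
      · simp only [hzy, if_true]
        exact Or.inr (hb.foot _ (hσ y hyT))
      · simpa only [hzy, if_false] using hb.foot _ (hσ z hz)
    · exact hnS ▸ hb.foot_mem _ (hσ z hz)
    · refine hb.foot_unique _ (hσ z hz) v ?_ (hnS ▸ hvS)
      by_cases hzy : z = y
      · subst hzy
        simp only [if_true] at hv
        rcases hv with hv | hv
        · exact absurd (hv ▸ hvS) hyS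
        · exact hv
      · simpa only [hzy, if_false] using hv
    · have := hd z hz z' hz' hne
      by_cases hzy : z = y
      · subst hzy
        simp only [if_true, hne.symm, if_false]
        exact Set.disjoint_insert_left.mpr ⟨hy' z' hz' hne.symm, this⟩
      · simp only [hzy, if_false]
        by_cases hzy' : z' = y
        · subst hzy'
          simp only [if_true]
          exact Set.disjoint_insert_right.mpr ⟨hy' z hz hne, this⟩
        · simpa only [hzy', if_false] using this

end Linkage

section RootedModels

open Finset
open scoped Classical

variable {V : Type} [Fintype V] {G G' : SimpleGraph V}

/-- Disjoint connected bags, one for each neighbour `y` of `S`, inside `S` apart from `y`. -/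
structure RootModel (G : SimpleGraph V) (S : Finset V) (B : V → Set V) : Prop where
  conn : ∀ y ∈ nb G S, Conn G (B y)
  root : ∀ y ∈ nb G S, y ∈ B y
  sub : ∀ y ∈ nb G S, ∀ v ∈ B y, v ∈ S ∨ v = y
  disj : ∀ y ∈ nb G S, ∀ z ∈ nb G S, y ≠ z → Disjoint (B y) (B z)

/-- Bags rooted at the neighbours of `S` together with two adjacent bags inside `S`, each of
which touches every rooted bag. -/
structure KModel (G : SimpleGraph V) (S : Finset V) (B : V → Set V) (C₀ C₁ : Set V) : Prop
    extends RootModel G S B where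
  sub₀ : ∀ v ∈ C₀, v ∈ S
  sub₁ : ∀ v ∈ C₁, v ∈ S
  conn₀ : Conn G C₀
  conn₁ : Conn G C₁
  disj₀₁ : Disjoint C₀ C₁
  disj₀ : ∀ y ∈ nb G S, Disjoint C₀ (B y)
  disj₁ : ∀ y ∈ nb G S, Disjoint C₁ (B y)
  touch₀ : ∀ y ∈ nb G S, Touch G C₀ (B y)
  touch₁ : ∀ y ∈ nb G S, Touch G C₁ (B y)
  touch₀₁ : Touch G C₀ C₁

def HasK (G : SimpleGraph V) (S : Finset V) : Prop := ∃ B C₀ C₁, KModel G S B C₀ C₁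

theorem HasK.lift {S S' : Finset V} (h : HasK G' S') (φ ψ : V → Set V) (τ : V → V)
    (φconn : ∀ v ∈ S', Conn G (φ v)) (φsub : ∀ v ∈ S', ∀ x ∈ φ v, x ∈ S)
    (φdisj : ∀ v ∈ S', ∀ w ∈ S', v ≠ w → Disjoint (φ v) (φ w))
    (ψconn : ∀ y ∈ nb G S, Conn G (ψ y)) (ψroot : ∀ y ∈ nb G S, y ∈ ψ y)
    (ψsub : ∀ y ∈ nb G S, ∀ x ∈ ψ y, x ∈ S ∨ x = y)
    (ψdisj : ∀ y ∈ nb G S, ∀ z ∈ nb G S, y ≠ z → Disjoint (ψ y) (ψ z))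
    (φψdisj : ∀ v ∈ S', ∀ y ∈ nb G S, Disjoint (φ v) (ψ y))
    (φtouch : ∀ v ∈ S', ∀ w ∈ S', G'.Adj v w → Touch G (φ v) (φ w))
    (φψtouch : ∀ v ∈ S', ∀ y ∈ nb G S, G'.Adj v (τ y) → Touch G (φ v) (ψ y))
    (hτ : ∀ y ∈ nb G S, τ y ∈ nb G' S')
    (τinj : ∀ y ∈ nb G S, ∀ z ∈ nb G S, y ≠ z → τ y ≠ τ z) : HasK G S := by
  obtain ⟨B, C₀, C₁, hB⟩ := h
  let Φ : V → V → Set V := fun y v => if v = τ y then ψ y else φ v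
  have hτS : ∀ y ∈ nb G S, τ y ∉ S' := fun y hy => (mem_nb.mp (hτ y hy)).1
  have hΦS : ∀ y ∈ nb G S, ∀ v ∈ S', Φ y v = φ v := fun y hy v hv =>
    if_neg fun (h : v = τ y) => hτS y hy (h ▸ hv)
  have hΦτ : ∀ y, Φ y (τ y) = ψ y := fun y => if_pos rfl
  have hsub : ∀ y ∈ nb G S, ∀ v ∈ B (τ y), v ∈ S' ∨ v = τ y := fun y hy => hB.sub _ (hτ y hy)
  have hdisjφ : ∀ y ∈ nb G S, ∀ v ∈ B (τ y), ∀ w ∈ S', v ≠ w → Disjoint (φ w) (Φ y v) := by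
    intro y hy v hv w hw hne
    rcases hsub y hy v hv with hvS | rfl
    · rw [hΦS y hy v hvS]; exact φdisj w hw v hvS hne.symm
    · rw [hΦτ]; exact φψdisj w hw y hy
  have hCdisj : ∀ C : Set V, (∀ v ∈ C, v ∈ S') → ∀ y ∈ nb G S, Disjoint C (B (τ y)) →
      Disjoint (⋃ v ∈ C, φ v) (⋃ v ∈ B (τ y), Φ y v) := by
    intro C hC y hy hd
    simp only [Set.disjoint_iUnion_left, Set.disjoint_iUnion_right]
    exact fun w hw v hv => hdisjφ y hy w hw v (hC v hv)
      fun h => Set.disjoint_left.mp hd hv (h ▸ hw)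
  have hCtouch : ∀ C : Set V, (∀ v ∈ C, v ∈ S') → ∀ y ∈ nb G S, Touch G' C (B (τ y)) →
      Touch G (⋃ v ∈ C, φ v) (⋃ v ∈ B (τ y), Φ y v) := by
    intro C hC y hy ht
    refine ht.biUnion fun v hv w hw hvw => ?_
    rcases hsub y hy w hw with hwS | rfl
    · rw [hΦS y hy w hwS]; exact φtouch v (hC v hv) w hwS hvw
    · rw [hΦτ]; exact φψtouch v (hC v hv) y hy hvw
  have hCconn : ∀ C : Set V, (∀ v ∈ C, v ∈ S') → Conn G' C → Conn G (⋃ v ∈ C, φ v) :=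
    fun C hC hc => hc.biUnion (fun v hv => φconn v (hC v hv))
      fun v hv w hw h => φtouch v (hC v hv) w (hC w hw) h
  have hCsub : ∀ C : Set V, (∀ v ∈ C, v ∈ S') → ∀ x ∈ ⋃ v ∈ C, φ v, x ∈ S := by
    intro C hC x hx
    simp only [Set.mem_iUnion, exists_prop] at hx
    obtain ⟨v, hv, hx⟩ := hx
    exact φsub v (hC v hv) x hx
  refine ⟨fun y => ⋃ v ∈ B (τ y), Φ y v, ⋃ v ∈ C₀, φ v, ⋃ v ∈ C₁, φ v,
    ⟨fun y hy => ?_, fun y hy => ?_, fun y hy x hx => ?_, fun y hy z hz hne => ?_⟩,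
    hCsub _ hB.sub₀, hCsub _ hB.sub₁, hCconn _ hB.sub₀ hB.conn₀, hCconn _ hB.sub₁ hB.conn₁, ?_,
    fun y hy => hCdisj _ hB.sub₀ y hy (hB.disj₀ _ (hτ y hy)),
    fun y hy => hCdisj _ hB.sub₁ y hy (hB.disj₁ _ (hτ y hy)),
    fun y hy => hCtouch _ hB.sub₀ y hy (hB.touch₀ _ (hτ y hy)),
    fun y hy => hCtouch _ hB.sub₁ y hy (hB.touch₁ _ (hτ y hy)),
    hB.touch₀₁.biUnion fun v hv w hw => φtouch v (hB.sub₀ v hv) w (hB.sub₁ w hw)⟩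
  · refine (hB.conn _ (hτ y hy)).biUnion (fun v hv => ?_) (fun v hv w hw hvw => ?_)
    · rcases hsub y hy v hv with hvS | rfl
      · rw [hΦS y hy v hvS]; exact φconn v hvS
      · rw [hΦτ]; exact ψconn y hy
    · rcases hsub y hy v hv with hvS | rfl <;> rcases hsub y hy w hw with hwS | rfl
      · rw [hΦS y hy v hvS, hΦS y hy w hwS]; exact φtouch v hvS w hwS hvw
      · rw [hΦS y hy v hvS, hΦτ]; exact φψtouch v hvS y hy hvw
      · rw [hΦS y hy w hwS, hΦτ]; exact (φψtouch w hwS y hy hvw.symm).symm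
      · exact absurd hvw (G'.loopless.irrefl _)
  · exact Set.mem_biUnion (hB.root _ (hτ y hy)) (by rw [hΦτ]; exact ψroot y hy)
  · simp only [Set.mem_iUnion, exists_prop] at hx
    obtain ⟨v, hv, hx⟩ := hx
    rcases hsub y hy v hv with hvS | rfl
    · rw [hΦS y hy v hvS] at hx; exact Or.inl (φsub v hvS x hx)
    · rw [hΦτ] at hx; exact ψsub y hy x hx
  · simp only [Set.disjoint_iUnion_left, Set.disjoint_iUnion_right]
    intro w hw v hv
    have hvw : v ≠ w := fun h =>
      Set.disjoint_left.mp (hB.disj _ (hτ y hy) _ (hτ z hz) (τinj y hy z hz hne)) hv (h ▸ hw)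
    rcases hsub y hy v hv with hvS | rfl
    · rw [hΦS y hy v hvS]; exact hdisjφ z hz w hw v hvS hvw.symm
    · rcases hsub z hz w hw with hwS | rfl
      · rw [hΦS z hz w hwS]; exact (hdisjφ y hy _ hv w hwS hvw).symm
      · rw [hΦτ, hΦτ]; exact ψdisj y hy z hz hne
  · simp only [Set.disjoint_iUnion_left, Set.disjoint_iUnion_right]
    intro w hw v hv
    exact φdisj v (hB.sub₀ v hv) w (hB.sub₁ w hw) fun h =>
      Set.disjoint_left.mp hB.disj₀₁ hv (h ▸ hw)

theorem HasK.lift_same {S S' : Finset V} (h : HasK G' S') (hSS : S' ⊆ S)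
    (hnb : nb G S ⊆ nb G' S') (E : V → Set V) (Q : V → Prop) (hQ : ∀ v ∈ S', Q v)
    (hQ' : ∀ y ∈ nb G S, Q y) (hconn : ∀ v, Q v → Conn G (E v)) (hself : ∀ v, Q v → v ∈ E v)
    (hsub : ∀ v, Q v → ∀ x ∈ E v, x ∈ S ∨ x = v)
    (hdisj : ∀ v w, Q v → Q w → v ≠ w → Disjoint (E v) (E w))
    (htouch : ∀ v w, Q v → Q w → G'.Adj v w → Touch G (E v) (E w)) : HasK G S := by
  refine h.lift E E id (fun v hv => hconn v (hQ v hv)) (fun v hv x hx => ?_)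
    (fun v hv w hw => hdisj v w (hQ v hv) (hQ w hw)) (fun y hy => hconn y (hQ' y hy))
    (fun y hy => hself y (hQ' y hy)) (fun y hy => hsub y (hQ' y hy))
    (fun y hy z hz => hdisj y z (hQ' y hy) (hQ' z hz))
    (fun v hv y hy => hdisj v y (hQ v hv) (hQ' y hy) ?_)
    (fun v hv w hw => htouch v w (hQ v hv) (hQ w hw))
    (fun v hv y hy => htouch v y (hQ v hv) (hQ' y hy))
    (fun y hy => hnb hy) (fun y _ z _ h => h)
  · rcases hsub v (hQ v hv) x hx with h | rfl
    · exact h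
    · exact hSS hv
  · rintro rfl
    exact (mem_nb.mp hy).1 (hSS hv)

theorem HasK.extend {S T : Finset V} (h : HasK G S) (hST : S ⊆ T)
    (hmin : ∀ R, S ⊆ R → R ⊆ T → #(nb G T) ≤ #(nb G R)) : HasK G T := by
  obtain ⟨b, τ, hb⟩ := exists_linkage _ G S T rfl hST hmin
  refine h.lift (fun v => {v}) b τ (fun v _ => conn_singleton G v)
    (fun v hv x hx => hST (Set.mem_singleton_iff.mp hx ▸ hv)) (fun v _ w _ h => by simpa using h)
    hb.conn hb.root (fun y hy x hx => (hb.sub y hy x hx).imp_left And.left) hb.disj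
    (fun v hv y hy => ?_) (fun v _ w _ h => ⟨v, rfl, w, rfl, h⟩)
    (fun v _ y hy h => ⟨v, rfl, τ y, hb.foot y hy, h⟩) hb.foot_mem (fun y hy z hz hne h => ?_)
  · rw [Set.disjoint_singleton_left]
    intro h
    rcases hb.sub y hy v h with h | rfl
    · exact h.2 hv
    · exact (mem_nb.mp hy).1 (hST hv)
  · exact Set.disjoint_left.mp (hb.disj y hy z hz hne) (hb.foot y hy) (h ▸ hb.foot z hz)

theorem KModel.exists_two_star {S : Finset V} {B : V → Set V} {C₀ C₁ : Set V}
    (h : KModel G S B C₀ C₁) {a b : V} (ha : a ∈ nb G S) (hb : b ∈ nb G S) (hab : a ≠ b) :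
    ∃ D, RootModel G S D ∧ ∀ y ∈ nb G S, ∀ z ∈ nb G S, y ≠ z →
      (y = a ∨ y = b ∨ z = a ∨ z = b) → Touch G (D y) (D z) := by
  have hd : Disjoint C₁ C₀ := h.disj₀₁.symm
  let D : V → Set V := fun y => if y = a then C₀ ∪ B y else if y = b then C₁ ∪ B y else B y
  have hBD : ∀ y, B y ⊆ D y := by
    intro y
    simp only [D]
    split_ifs <;> simp
  have h0 : C₀ ⊆ D a := by simp [D]
  have h1 : C₁ ⊆ D b := by simp [D, hab.symm]
  refine ⟨D, ⟨fun y hy => ?_, fun y hy => hBD y (h.root y hy), fun y hy v hv => ?_,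
    fun y hy z hz hne => ?_⟩, ?_⟩
  · simp only [D]
    split_ifs
    · exact h.conn₀.union (h.conn y hy) (h.touch₀ y hy)
    · exact h.conn₁.union (h.conn y hy) (h.touch₁ y hy)
    · exact h.conn y hy
  · simp only [D] at hv
    split_ifs at hv
    · exact hv.elim (fun h' => Or.inl (h.sub₀ v h')) (h.sub y hy v)
    · exact hv.elim (fun h' => Or.inl (h.sub₁ v h')) (h.sub y hy v)
    · exact h.sub y hy v hv
  · have e := h.disj y hy z hz hne
    have e1 := h.disj₀ y hy
    have e2 := h.disj₀ z hz
    have e3 := h.disj₁ y hy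
    have e4 := h.disj₁ z hz
    have e5 := h.disj₀₁
    simp only [D]
    split_ifs <;> simp_all [Set.disjoint_union_right, disjoint_comm]
  · have hA : ∀ z ∈ nb G S, Touch G (D a) (D z) := fun z hz => (h.touch₀ z hz).mono h0 (hBD z)
    have hB : ∀ z ∈ nb G S, Touch G (D b) (D z) := fun z hz => (h.touch₁ z hz).mono h1 (hBD z)
    rintro y hy z hz - (rfl | rfl | rfl | rfl)
    · exact hA z hz
    · exact hB z hz
    · exact (hA y hy).symm
    · exact (hB y hy).symm

theorem KModel.exists_clique {S : Finset V} {B : V → Set V} {C₀ C₁ : Set V}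
    (h : KModel G S B C₀ C₁) (hc : #(nb G S) ≤ 3) :
    ∃ D, RootModel G S D ∧ ∀ y ∈ nb G S, ∀ z ∈ nb G S, y ≠ z → Touch G (D y) (D z) := by
  by_cases h1 : 1 < #(nb G S)
  · obtain ⟨a, ha, b, hb, hab⟩ := one_lt_card.mp h1
    obtain ⟨D, hD, ht⟩ := h.exists_two_star ha hb hab
    refine ⟨D, hD, fun y hy z hz hyz => ht y hy z hz hyz ?_⟩
    by_contra! hcon
    have : #({a, b, y, z} : Finset V) ≤ #(nb G S) := card_le_card (by
      intro x hx
      simp only [mem_insert, mem_singleton] at hx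
      rcases hx with rfl | rfl | rfl | rfl <;> assumption)
    rw [card_insert_of_notMem (by simp [hab, hcon.1.symm, hcon.2.2.1.symm]),
      card_insert_of_notMem (by simp [hcon.2.1.symm, hcon.2.2.2.symm]),
      card_pair hyz] at this
    omega
  · exact ⟨B, h.toRootModel, fun y hy z hz hyz => absurd (one_lt_card.mpr ⟨y, hy, z, hz, hyz⟩) h1⟩

end RootedModels

section Massed

open Finset
open scoped Classical

variable {V : Type} [Fintype V] {G G' : SimpleGraph V}

/-- The ordered pairs of adjacent vertices at least one of which is in `S`. -/
noncomputable def darts (G : SimpleGraph V) (S : Finset V) : Finset (V × V) :=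
  {p | G.Adj p.1 p.2 ∧ (p.1 ∈ S ∨ p.2 ∈ S)}

theorem mem_darts {S : Finset V} {p : V × V} :
    p ∈ darts G S ↔ G.Adj p.1 p.2 ∧ (p.1 ∈ S ∨ p.2 ∈ S) := by
  simp [darts]

/-- More than `4 |S|` edges meet `S`, while at most `4 |T|` edges meet any subset `T` with fewer
neighbours than `S`. -/
def Massed (G : SimpleGraph V) (S : Finset V) : Prop :=
  8 * #S < #(darts G S) ∧ ∀ T ⊆ S, #(nb G T) < #(nb G S) → #(darts G T) ≤ 8 * #T

theorem exists_massed {S : Finset V} (h : 8 * #S < #(darts G S)) :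
    ∃ T ⊆ S, Massed G T ∧ #(nb G T) ≤ #(nb G S) := by
  obtain ⟨T, hT, hmin⟩ := exists_min_image (S.powerset.filter fun T => 8 * #T < #(darts G T))
    (fun T => #(nb G T)) ⟨S, by simpa using h⟩
  simp only [mem_filter, mem_powerset] at hT hmin
  refine ⟨T, hT.1, ⟨hT.2, fun R hR hlt => ?_⟩, hmin S ⟨le_rfl, h⟩⟩
  by_contra! hcon
  have := hmin R ⟨hR.trans hT.1, hcon⟩
  omega

theorem HasK.nonempty {S : Finset V} (h : HasK G S) : S.Nonempty := by
  obtain ⟨B, C₀, C₁, hB⟩ := h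
  obtain ⟨x, hx⟩ := hB.conn₀.1
  exact ⟨x, hB.sub₀ x hx⟩

/-- Delete `T` and make the set `Y` complete. -/
def cliq (G : SimpleGraph V) (T Y : Finset V) : SimpleGraph V where
  Adj a b := a ∉ T ∧ b ∉ T ∧ a ≠ b ∧ (G.Adj a b ∨ (a ∈ Y ∧ b ∈ Y))
  symm := ⟨fun _ _ h => ⟨h.2.1, h.1, h.2.2.1.symm, h.2.2.2.imp (fun h => h.symm) And.symm⟩⟩
  loopless := ⟨fun _ h => h.2.2.1 rfl⟩

theorem HasK.of_cliq {S T : Finset V} (hT : HasK G T) (hc : #(nb G T) ≤ 3)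
    (h : HasK (cliq G T (nb G T)) S) (hST : Disjoint S T)
    (hnb : nb G (S ∪ T) ⊆ nb (cliq G T (nb G T)) S) : HasK G (S ∪ T) := by
  obtain ⟨B, C₀, C₁, hB⟩ := hT
  obtain ⟨D, hD, ht⟩ := hB.exists_clique hc
  let E : V → Set V := fun v => if v ∈ nb G T then D v else {v}
  have hself : ∀ v, v ∈ E v := by
    intro v
    simp only [E]
    split_ifs with h
    · exact hD.root v h
    · rfl
  have hsub : ∀ v, ∀ x ∈ E v, x ∈ T ∨ x = v := by
    intro v x hx
    simp only [E] at hx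
    split_ifs at hx with h
    · exact hD.sub v h x hx
    · exact Or.inr hx
  refine h.lift_same subset_union_left hnb E (fun v => v ∉ T)
    (fun v hv => Finset.disjoint_left.mp hST hv)
    (fun y hy hyT => (mem_nb.mp hy).1 (mem_union_right _ hyT)) (fun v _ => ?_)
    (fun v _ => hself v)
    (fun v _ x hx => (hsub v x hx).imp_left (mem_union_right _)) (fun v w hv hw hne => ?_)
    (fun v w hv hw hvw => ?_)
  · simp only [E]
    split_ifs with h
    · exact hD.conn v h
    · exact conn_singleton G v
  · by_cases h1 : v ∈ nb G T
    · by_cases h2 : w ∈ nb G T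
      · simpa [E, h1, h2] using hD.disj v h1 w h2 hne
      · have h3 : E w = {w} := if_neg h2
        rw [h3, Set.disjoint_singleton_right]
        exact fun h => (hsub v w h).elim hw fun h => hne h.symm
    · have h3 : E v = {v} := if_neg h1
      rw [h3, Set.disjoint_singleton_left]
      exact fun h => (hsub w v h).elim hv hne
  · rcases hvw.2.2.2 with h' | h'
    · exact ⟨v, hself v, w, hself w, h'⟩
    · simpa [E, h'.1, h'.2] using ht v h'.1 w h'.2 hvw.2.2.1

theorem HasK.extend_massed {S T : Finset V} (hS : Massed G S) (hk : #(nb G S) ≤ 4)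
    (ih : ∀ (G' : SimpleGraph V) (S' : Finset V), #S' < #S → Massed G' S' → #(nb G' S') ≤ 4 →
      HasK G' S')
    (hTS : T ⊂ S) (hTk : #(nb G T) ≤ #(nb G S)) (hT : HasK G T) : HasK G S := by
  obtain ⟨T, hT', hmax⟩ := exists_max_image
    (S.powerset.filter fun T => T ≠ S ∧ #(nb G T) ≤ #(nb G S) ∧ HasK G T) card
    ⟨T, by simp only [mem_filter, mem_powerset]; exact ⟨hTS.1, hTS.ne, hTk, hT⟩⟩
  simp only [mem_filter, mem_powerset] at hT' hmax
  clear hTS hTk hT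
  obtain ⟨hTS, hTne, hTk, hT⟩ := hT'
  by_cases hall : ∀ R, T ⊆ R → R ⊆ S → #(nb G S) ≤ #(nb G R)
  · exact hT.extend hTS hall
  push Not at hall
  obtain ⟨R₀, hTR₀, hR₀S, hR₀⟩ := hall
  obtain ⟨R, hR, hRmin⟩ := exists_min_image (S.powerset.filter fun R => T ⊆ R)
    (fun R => #(nb G R)) ⟨R₀, by simp [hTR₀, hR₀S]⟩
  simp only [mem_filter, mem_powerset] at hR hRmin
  have hRk := (hRmin R₀ ⟨hR₀S, hTR₀⟩).trans_lt hR₀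
  have hRK := hT.extend hR.2 fun R' h h' => hRmin R' ⟨h'.trans hR.1, h⟩
  have hRT : T = R := eq_of_subset_of_card_le hR.2
    (hmax R ⟨hR.1, fun h => by rw [h] at hRk; omega, hRk.le, hRK⟩)
  subst hRT
  clear hR hRmin hR₀ hTR₀ hR₀S hRK
  have hdT := hS.2 T hTS hRk
  have hTpos : 0 < #T := hT.nonempty.card_pos
  set G' := cliq G T (nb G T) with hG'
  have hcardS : #(S \ T) + #T = #S := card_sdiff_add_card_eq_card hTS
  have hnbu : ∀ U, Disjoint U T → (U ∩ nb G T).Nonempty → nb G (U ∪ T) = nb G' U := by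
    intro U hUT hUY
    obtain ⟨y, hy⟩ := hUY
    obtain ⟨hyU, hyY⟩ := mem_inter.mp hy
    ext v
    simp only [mem_nb, mem_union, not_or]
    constructor
    · rintro ⟨⟨hvU, hvT⟩, s, hs | hs, hsv⟩
      · exact ⟨hvU, s, hs, Finset.disjoint_left.mp hUT hs, hvT, hsv.ne, Or.inl hsv⟩
      · exact ⟨hvU, y, hyU, Finset.disjoint_left.mp hUT hyU, hvT, fun h => hvU (h ▸ hyU),
          Or.inr ⟨hyY, mem_nb.mpr ⟨hvT, s, hs, hsv⟩⟩⟩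
    · rintro ⟨hvU, s, hs, hsT, hvT, hne, h | h⟩
      · exact ⟨⟨hvU, hvT⟩, s, Or.inl hs, h⟩
      · obtain ⟨-, t, ht, htv⟩ := mem_nb.mp h.2
        exact ⟨⟨hvU, hvT⟩, t, Or.inr ht, htv⟩
  have hM2 : ∀ U ⊆ S \ T, #(nb G' U) < #(nb G S) → #(darts G' U) ≤ 8 * #U := by
    intro U₀ hU₀ hlt
    by_contra! hcon
    obtain ⟨U, hU, hUM, hUle⟩ := exists_massed hcon
    have hUS := hU.trans hU₀
    have hUT : Disjoint U T := disjoint_of_subset_left hUS sdiff_disjoint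
    have hUc := card_le_card hUS
    by_cases hUY : (U ∩ nb G T).Nonempty
    · have hUK := ih G' U (by omega) hUM (by omega)
      have hnn := hUK.nonempty.card_pos
      have heq := hnbu U hUT hUY
      have hUTK := hT.of_cliq (by omega) hUK hUT heq.le
      have h1 := hmax (U ∪ T) ⟨union_subset (hUS.trans sdiff_subset) hTS, fun h => by
        rw [← heq, h] at hUle; omega, by rw [heq]; omega, hUTK⟩
      rw [card_union_of_disjoint hUT] at h1
      omega
    · rw [not_nonempty_iff_eq_empty, ← disjoint_iff_inter_eq_empty, Finset.disjoint_left] at hUY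
      have h1 : nb G U ⊆ nb G' U := by
        intro v hv
        obtain ⟨hvU, s, hs, hsv⟩ := mem_nb.mp hv
        have hsT := Finset.disjoint_left.mp hUT hs
        exact mem_nb.mpr ⟨hvU, s, hs, hsT, fun hvT => hUY hs (mem_nb.mpr ⟨hsT, v, hvT, hsv.symm⟩),
          hsv.ne, Or.inl hsv⟩
      have h2 : darts G' U ⊆ darts G U := by
        rintro ⟨a, b⟩ hp
        obtain ⟨⟨haT, hbT, hne, h⟩, hU'⟩ := mem_darts.mp hp
        refine mem_darts.mpr ⟨h.resolve_right fun h' => ?_, hU'⟩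
        exact hU'.elim (fun h'' => hUY h'' h'.1) (fun h'' => hUY h'' h'.2)
      have h3 := hS.2 U (hUS.trans sdiff_subset) (by have := card_le_card h1; omega)
      have h4 := card_le_card h2
      have h5 := hUM.1
      omega
  have hd : #(darts G S) ≤ #(darts G' (S \ T)) + #(darts G T) := by
    refine (card_le_card ?_).trans (card_union_le _ _)
    rintro ⟨a, b⟩ hp
    obtain ⟨hab, hS'⟩ := mem_darts.mp hp
    simp only [mem_union, mem_darts, mem_sdiff]
    by_cases ha : a ∈ T
    · exact Or.inr ⟨hab, Or.inl ha⟩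
    by_cases hb : b ∈ T
    · exact Or.inr ⟨hab, Or.inr hb⟩
    exact Or.inl ⟨⟨ha, hb, hab.ne, Or.inl hab⟩, hS'.imp (⟨·, ha⟩) (⟨·, hb⟩)⟩
  have hS1 := hS.1
  have hge : #(nb G S) ≤ #(nb G' (S \ T)) := by
    by_contra! hlt
    have := hM2 _ le_rfl hlt
    omega
  have hsub : nb G' (S \ T) ⊆ nb G S := by
    intro v hv
    obtain ⟨hvU, s, hs, hsT, hvT, hne, h⟩ := mem_nb.mp hv
    have hvS : v ∉ S := fun h => hvU (mem_sdiff.mpr ⟨h, hvT⟩)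
    rcases h with h | h
    · exact mem_nb.mpr ⟨hvS, s, (mem_sdiff.mp hs).1, h⟩
    · obtain ⟨-, t, ht, htv⟩ := mem_nb.mp h.2
      exact mem_nb.mpr ⟨hvS, t, hTS ht, htv⟩
  have heq := eq_of_subset_of_card_le hsub hge
  have hK := ih G' (S \ T) (by omega) ⟨by omega, fun U hU hlt => hM2 U hU (heq ▸ hlt)⟩
    (by rw [heq]; exact hk)
  have := hT.of_cliq (by omega) hK sdiff_disjoint (by
    rw [sdiff_union_of_subset hTS]; exact heq.ge)
  rwa [sdiff_union_of_subset hTS] at this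

end Massed

section Contraction

open Finset
open scoped Classical

variable {V : Type} [Fintype V] {G G' : SimpleGraph V}

/-- Contract the edge `u v` onto `v`, leaving `u` isolated. -/
def contr (G : SimpleGraph V) (u v : V) : SimpleGraph V where
  Adj a b := a ≠ b ∧ a ≠ u ∧ b ≠ u ∧ (G.Adj a b ∨ (a = v ∧ G.Adj u b) ∨ (b = v ∧ G.Adj u a))
  symm := ⟨fun _ _ h => ⟨h.1.symm, h.2.2.1, h.2.1, h.2.2.2.imp (fun h => h.symm) Or.symm⟩⟩
  loopless := ⟨fun _ h => h.1 rfl⟩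

theorem HasK.of_contr {S T : Finset V} {u v : V} (huv : G.Adj u v) (hu : u ∈ S)
    (h : HasK (contr G u v) T) (hT : T ⊆ S.erase u) (hnb : nb G S ⊆ nb (contr G u v) T) :
    HasK G S := by
  let E : V → Set V := fun w => if w = v then {u, v} else {w}
  have hself : ∀ w, w ∈ E w := by
    intro w
    by_cases h : w = v <;> simp [E, h]
  have hsub : ∀ w, ∀ x ∈ E w, x = u ∨ x = w := by
    intro w x hx
    by_cases h : w = v
    · simpa [E, h] using hx
    · exact Or.inr (by simpa [E, h] using hx)
  refine h.lift_same (hT.trans (erase_subset _ _)) hnb E (fun v => v ≠ u)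
    (fun v hv => ne_of_mem_erase (hT hv))
    (fun y hy (hyT : y = u) => (mem_nb.mp hy).1 (hyT ▸ hu)) (fun w _ => ?_)
    (fun v _ => hself v)
    (fun v _ x hx => (hsub v x hx).imp_left (fun (h : x = u) => h ▸ hu)) (fun a b ha hb hne => ?_)
    (fun a b ha hb hab => ?_)
  · by_cases h : w = v
    · simpa [E, h] using (conn_singleton G v).insert ⟨v, rfl, huv⟩
    · simpa [E, h] using conn_singleton G w
  · rw [Set.disjoint_left]
    intro x hx hx'
    rcases hsub a x hx with rfl | rfl
    · have h1 : a = v := by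
        by_contra h1
        simp [E, h1, ha.symm] at hx
      have h2 : b = v := by
        by_contra h2
        simp [E, h2, hb.symm] at hx'
      exact hne (h1.trans h2.symm)
    · exact (hsub b x hx').elim ha hne
  · rcases hab.2.2.2 with h' | ⟨rfl, h'⟩ | ⟨rfl, h'⟩
    · exact ⟨a, hself a, b, hself b, h'⟩
    · exact ⟨u, by simp [E], b, hself b, h'⟩
    · exact ⟨a, hself a, u, by simp [E], h'.symm⟩

theorem card_darts_le_contr {S : Finset V} {u v : V} (hu : u ∈ S) (huv : G.Adj u v) :
    #(darts G S) ≤ #(darts (contr G u v) (S.erase u)) + 2 +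
      2 * #{w | G.Adj u w ∧ w ≠ v ∧ (G.Adj v w ∨ (v ∉ S ∧ w ∉ S))} := by
  set bad : Finset V := {w | G.Adj u w ∧ w ≠ v ∧ (G.Adj v w ∨ (v ∉ S ∧ w ∉ S))} with hbad
  set R : Finset (V × V) := (insert v bad).image (fun w => (u, w)) ∪
    (insert v bad).image (fun w => (w, u)) with hR
  have hRc : #R ≤ 2 + 2 * #bad := by
    have h1 := card_union_le ((insert v bad).image (fun w => (u, w)))
      ((insert v bad).image (fun w => (w, u)))
    have h2 := card_image_le (s := insert v bad) (f := fun w => (u, w))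
    have h3 := card_image_le (s := insert v bad) (f := fun w => (w, u))
    have h4 := card_insert_le v bad
    rw [hR]
    omega
  have hX : #(darts G S \ R) ≤ #(darts (contr G u v) (S.erase u)) := by
    let f : V → V := fun a => if a = u then v else a
    have key : ∀ w, G.Adj u w → w ∉ insert v bad → w ≠ v ∧ ¬ G.Adj v w ∧ (v ∈ S ∨ w ∈ S) := by
      intro w hw h
      simp only [mem_insert, not_or, hbad, mem_filter, mem_univ, true_and, not_and] at h
      exact ⟨h.1, (h.2 hw h.1).1, by by_contra! h'; exact (h.2 hw h.1).2 h'.1 h'.2⟩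
    have hvu := huv.ne.symm
    have hmem : ∀ a b, (a, b) ∈ darts G S \ R → (G.Adj a b ∧ (a ∈ S ∨ b ∈ S)) ∧
        (a = u → b ≠ u ∧ b ≠ v ∧ ¬ G.Adj v b ∧ (v ∈ S ∨ b ∈ S)) ∧
        (b = u → a ≠ u ∧ a ≠ v ∧ ¬ G.Adj v a ∧ (v ∈ S ∨ a ∈ S)) := by
      intro a b hp
      obtain ⟨hp, hpR⟩ := mem_sdiff.mp hp
      have hp' := mem_darts.mp hp
      refine ⟨hp', ?_, ?_⟩
      · rintro rfl
        have h := hp'.1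
        refine ⟨h.ne.symm, key b h fun hb => hpR ?_⟩
        exact mem_union_left _ (mem_image_of_mem _ hb)
      · rintro rfl
        have h := hp'.1
        refine ⟨h.ne, key a h.symm fun hb => hpR ?_⟩
        exact mem_union_right _ (mem_image_of_mem (fun w => (w, b)) hb)
    refine card_le_card_of_injOn (fun p => (f p.1, f p.2)) ?_ ?_
    · rintro ⟨a, b⟩ hp
      obtain ⟨⟨hab, hS⟩, h1, h2⟩ := hmem a b hp
      refine mem_coe.mpr (mem_darts.mpr ?_)
      simp only [f, contr, mem_erase]
      by_cases ha : a = u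
      · subst ha
        obtain ⟨hb, hbv, hvb, hS'⟩ := h1 rfl
        simp only [if_true, hb, if_false]
        exact ⟨⟨hbv.symm, hvu, hb, Or.inr (Or.inl ⟨trivial, hab⟩)⟩, hS'.imp (⟨hvu, ·⟩) (⟨hb, ·⟩)⟩
      · by_cases hb : b = u
        · subst hb
          obtain ⟨-, hbv, hvb, hS'⟩ := h2 rfl
          simp only [if_true, ha, if_false]
          exact ⟨⟨hbv, ha, hvu, Or.inr (Or.inr ⟨trivial, hab.symm⟩)⟩, hS'.symm.imp (⟨ha, ·⟩) (⟨hvu, ·⟩)⟩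
        · simp only [ha, hb, if_false]
          exact ⟨⟨hab.ne, ha, hb, Or.inl hab⟩, hS.imp (⟨ha, ·⟩) (⟨hb, ·⟩)⟩
    · rintro ⟨a, b⟩ hp ⟨c, d⟩ hq hpq
      obtain ⟨⟨hab, -⟩, h1, h2⟩ := hmem a b hp
      obtain ⟨⟨hcd, -⟩, h3, h4⟩ := hmem c d hq
      simp only [f, Prod.mk.injEq] at hpq ⊢
      have := hab.symm
      have := hcd.symm
      grind
  have := le_card_sdiff R (darts G S)
  omega

theorem HasK.of_no_rigid_aux {S : Finset V} (hk : #(nb G S) ≤ 4)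
    (ih : ∀ (G' : SimpleGraph V) (S' : Finset V),
      (#S' < #S ∨ #S' = #S ∧ #(darts G' S') < #(darts G S)) → Massed G' S' → #(nb G' S') ≤ 4 →
      HasK G' S')
    (hno : ∀ T, T ⊂ S → #(nb G T) ≤ #(nb G S) → ¬ HasK G T) :
    ∀ T, T ⊂ S → #(nb G T) ≤ #(nb G S) → #(darts G T) ≤ 8 * #T := by
  intro T₀ hT₀ hle
  by_contra! hcon
  obtain ⟨T, hT, hM, hTle⟩ := exists_massed hcon
  have hTS := lt_of_le_of_lt hT hT₀
  exact hno T hTS (hTle.trans hle) (ih G T (Or.inl (card_lt_card hTS)) hM (by omega))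

theorem HasK.or_bad {S : Finset V} (hS : Massed G S) (hk : #(nb G S) ≤ 4)
    (ih : ∀ (G' : SimpleGraph V) (S' : Finset V),
      (#S' < #S ∨ #S' = #S ∧ #(darts G' S') < #(darts G S)) → Massed G' S' → #(nb G' S') ≤ 4 →
      HasK G' S')
    (hno : ∀ T, T ⊂ S → #(nb G T) ≤ #(nb G S) → ¬ HasK G T) {u v : V} (hu : u ∈ S)
    (huv : G.Adj u v)
    (hbad : #{w | G.Adj u w ∧ w ≠ v ∧ (G.Adj v w ∨ (v ∉ S ∧ w ∉ S))} ≤ 3) : HasK G S := by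
  have hB0 := HasK.of_no_rigid_aux hk ih hno
  have hd := card_darts_le_contr hu huv
  set G' := contr G u v with hG'
  have hS1 := hS.1
  have hcard := card_erase_add_one hu
  have hM1 : 8 * #(S.erase u) < #(darts G' (S.erase u)) := by omega
  have hsub : nb G' (S.erase u) ⊆ nb G S := by
    intro w hw
    obtain ⟨hwS, s, hs, hne, hsu, hwu, h⟩ := mem_nb.mp hw
    have hwS : w ∉ S := fun h => hwS (mem_erase.mpr ⟨hwu, h⟩)
    have hs := mem_of_mem_erase hs
    rcases h with h | ⟨rfl, h⟩ | ⟨rfl, h⟩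
    · exact mem_nb.mpr ⟨hwS, s, hs, h⟩
    · exact mem_nb.mpr ⟨hwS, u, hu, h⟩
    · exact mem_nb.mpr ⟨hwS, u, hu, huv⟩
  have hM2 : ∀ T ⊆ S.erase u, #(nb G' T) < #(nb G S) → #(darts G' T) ≤ 8 * #T := by
    intro T₀ hT₀ hlt
    by_contra! hcon
    obtain ⟨T, hT, hTM, hTle⟩ := exists_massed hcon
    have hTS := hT.trans hT₀
    have huT : u ∉ T := fun h => notMem_erase u S (hTS h)
    have hTc := card_le_card hTS
    by_cases hvT : v ∈ T
    · have hTK := ih G' T (Or.inl (by omega)) hTM (by omega)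
      have h1 : nb G (insert u T) ⊆ nb G' T := by
        intro w hw
        obtain ⟨hwT, s, hs, hsw⟩ := mem_nb.mp hw
        simp only [mem_insert, not_or] at hwT
        rcases mem_insert.mp hs with rfl | hs
        · exact mem_nb.mpr ⟨hwT.2, v, hvT, fun h => hwT.2 (h ▸ hvT), huv.ne.symm, hwT.1,
            Or.inr (Or.inl ⟨rfl, hsw⟩)⟩
        · exact mem_nb.mpr ⟨hwT.2, s, hs, hsw.ne, fun h => huT (h ▸ hs), hwT.1, Or.inl hsw⟩
      have h2 := HasK.of_contr huv (mem_insert_self u T) hTK (by rw [erase_insert huT]) h1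
      have h3 : insert u T ⊆ S := insert_subset hu (hTS.trans (erase_subset _ _))
      have h4 := card_le_card h1
      refine hno _ (lt_of_le_of_ne h3 fun h => ?_) (by omega) h2
      rw [h] at h4
      omega
    · have h1 : nb G T ⊆ insert u (nb G' T) := by
        intro w hw
        obtain ⟨hwT, s, hs, hsw⟩ := mem_nb.mp hw
        by_cases hwu : w = u
        · exact hwu ▸ mem_insert_self _ _
        · exact mem_insert_of_mem (mem_nb.mpr ⟨hwT, s, hs, hsw.ne, fun h => huT (h ▸ hs), hwu,
            Or.inl hsw⟩)
      have h2 : #(darts G' T) ≤ #(darts G T) := by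
        let f : V × V → V × V := fun p => if G.Adj p.1 p.2 then p else
          (if p.1 = v then u else p.1, if p.2 = v then u else p.2)
        have hvu := huv.ne.symm
        refine card_le_card_of_injOn f ?_ ?_
        · rintro ⟨a, b⟩ hp
          obtain ⟨hp, hpT⟩ := mem_darts.mp hp
          refine mem_coe.mpr (mem_darts.mpr ?_)
          simp only [hG', contr, f] at hp hpT ⊢
          have h5 := huv.symm
          by_cases hab : G.Adj a b
          · simp only [hab, if_true]; exact ⟨trivial, hpT⟩
          · simp only [hab, if_false]
            obtain ⟨hne, hau, hbu, h | ⟨rfl, h⟩ | ⟨rfl, h⟩⟩ := hp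
            · exact absurd h hab
            · simp only [if_true, hne.symm, if_false]
              exact ⟨h, Or.inr (hpT.resolve_left hvT)⟩
            · simp only [if_true, hne, if_false]
              exact ⟨h.symm, Or.inl (hpT.resolve_right hvT)⟩
        · rintro ⟨a, b⟩ hp ⟨c, d⟩ hq hpq
          have hp := (mem_darts.mp hp).1
          have hq := (mem_darts.mp hq).1
          simp only [hG', contr] at hp hq
          simp only [f] at hpq
          grind
      have h3 := card_le_card h1
      have h4 := card_insert_le u (nb G' T)
      have h5 := hB0 T (lt_of_le_of_lt hTS (erase_ssubset hu)) (by omega)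
      have h6 := hTM.1
      omega
  have hge : #(nb G S) ≤ #(nb G' (S.erase u)) := by
    by_contra! hlt
    have := hM2 _ le_rfl hlt
    omega
  have heq := eq_of_subset_of_card_le hsub hge
  exact HasK.of_contr huv hu (ih G' _ (Or.inl (by omega))
    ⟨hM1, fun T hT hlt => hM2 T hT (heq ▸ hlt)⟩ (heq ▸ hk)) le_rfl heq.ge

end Contraction

section MassedTheorem

open Finset
open scoped Classical

variable {V : Type} [Fintype V] {G G' : SimpleGraph V}

/-- Delete the edge `x y`. -/
def delEdge (G : SimpleGraph V) (x y : V) : SimpleGraph V where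
  Adj a b := G.Adj a b ∧ ¬ (a = x ∧ b = y) ∧ ¬ (a = y ∧ b = x)
  symm := ⟨fun _ _ h => ⟨h.1.symm, fun h' => h.2.2 h'.symm, fun h' => h.2.1 h'.symm⟩⟩
  loopless := ⟨fun _ h => h.1.ne rfl⟩

theorem HasK.or_card_darts_le {S : Finset V} (hk : #(nb G S) ≤ 4)
    (ih : ∀ (G' : SimpleGraph V) (S' : Finset V),
      (#S' < #S ∨ #S' = #S ∧ #(darts G' S') < #(darts G S)) → Massed G' S' → #(nb G' S') ≤ 4 →
      HasK G' S')
    (hno : ∀ T, T ⊂ S → #(nb G T) ≤ #(nb G S) → ¬ HasK G T) :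
    HasK G S ∨ #(darts G S) ≤ 8 * #S + 2 := by
  by_contra! hcon
  obtain ⟨hnK, hbig⟩ := hcon
  have hB0 := HasK.of_no_rigid_aux hk ih hno
  have hedge : ∃ x ∈ S, ∃ y ∈ S, G.Adj x y := by
    by_contra! hcon
    have h1 : darts G S ⊆ S ×ˢ nb G S ∪ nb G S ×ˢ S := by
      rintro ⟨a, b⟩ hp
      obtain ⟨hab, h⟩ := mem_darts.mp hp
      simp only [mem_union, mem_product, mem_nb]
      rcases h with h | h
      · exact Or.inl ⟨h, fun hb => hcon a h b hb hab, a, h, hab⟩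
      · exact Or.inr ⟨⟨fun ha => hcon a ha b h hab, b, h, hab.symm⟩, h⟩
    have h2 := (card_le_card h1).trans (card_union_le _ _)
    rw [card_product, card_product] at h2
    have h3 := Nat.mul_le_mul_left #S hk
    have h4 := Nat.mul_le_mul_right #S hk
    omega
  obtain ⟨x, hx, y, hy, hxy⟩ := hedge
  set G' := delEdge G x y with hG'
  have hle : ∀ T, darts G' T ⊆ darts G T := by
    intro T p hp
    exact mem_darts.mpr ⟨(mem_darts.mp hp).1.1, (mem_darts.mp hp).2⟩
  have hd : #(darts G S) ≤ #(darts G' S) + 2 := by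
    have h1 : darts G S ⊆ darts G' S ∪ {(x, y), (y, x)} := by
      rintro ⟨a, b⟩ hp
      obtain ⟨hab, h⟩ := mem_darts.mp hp
      simp only [mem_union, mem_darts, hG', delEdge, mem_insert, mem_singleton, Prod.mk.injEq]
      tauto
    exact (card_le_card h1).trans ((card_union_le _ _).trans (by have := card_le_two (a := (x, y)) (b := (y, x)); omega))
  have hd' : #(darts G' S) < #(darts G S) := by
    refine card_lt_card ⟨hle S, fun h => ?_⟩
    have := mem_darts.mp (h (mem_darts.mpr ⟨hxy, Or.inl hx⟩ : (x, y) ∈ darts G S))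
    exact this.1.2.1 ⟨rfl, rfl⟩
  have hnb : nb G' S = nb G S := by
    ext v
    simp only [mem_nb]
    refine and_congr_right fun hv => exists_congr fun s => and_congr_right fun hs => ⟨fun h => h.1, fun h => ⟨h, ?_, ?_⟩⟩
    · rintro ⟨rfl, rfl⟩; exact hv hy
    · rintro ⟨rfl, rfl⟩; exact hv hx
  have hM : Massed G' S := by
    refine ⟨by omega, fun T hT hlt => (card_le_card (hle T)).trans (hB0 T ?_ ?_)⟩
    · exact lt_of_le_of_ne hT fun h => by rw [h] at hlt; omega
    · have h1 : ∃ z, nb G T ⊆ insert z (nb G' T) := by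
        refine ⟨if x ∈ T then y else x, fun v hv => ?_⟩
        obtain ⟨hv, s, hs, hsv⟩ := mem_nb.mp hv
        rw [mem_insert, or_iff_not_imp_left]
        intro hne
        refine mem_nb.mpr ⟨hv, s, hs, hsv, ?_, ?_⟩
        · rintro ⟨rfl, rfl⟩
          exact hne (by simp [hs])
        · rintro ⟨rfl, rfl⟩
          exact hne (by simp [hv])
      obtain ⟨z, hz⟩ := h1
      have h2 := card_le_card hz
      have h3 := card_insert_le z (nb G' T)
      rw [hnb] at hlt
      omega
  refine hnK ((ih G' S (Or.inr ⟨rfl, hd'⟩) hM (hnb ▸ hk)).lift_same le_rfl hnb.ge (fun v => {v})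
    (fun _ => True) (fun _ _ => trivial) (fun _ _ => trivial) (fun v _ => conn_singleton G v)
    (fun _ _ => rfl) (fun v _ x hx => Or.inr hx) (fun v w _ _ h => by simpa using h)
    (fun v w _ _ h => ⟨v, rfl, w, rfl, h.1⟩))

theorem card_darts_eq (G : SimpleGraph V) (S : Finset V) :
    #(darts G S) = ∑ u ∈ S, (#{w | G.Adj u w} + #{w | G.Adj u w ∧ w ∉ S}) := by
  have h1 : darts G S = (S.biUnion fun u => ({w | G.Adj u w} : Finset V).image fun w => (u, w)) ∪
      (S.biUnion fun u => ({w | G.Adj u w ∧ w ∉ S} : Finset V).image fun w => (w, u)) := by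
    ext ⟨a, b⟩
    simp only [mem_darts, mem_union, mem_biUnion, mem_image, mem_filter, mem_univ, true_and,
      Prod.mk.injEq]
    constructor
    · rintro ⟨hab, h⟩
      by_cases ha : a ∈ S
      · exact Or.inl ⟨a, ha, b, hab, rfl, rfl⟩
      · exact Or.inr ⟨b, h.resolve_left ha, a, ⟨hab.symm, ha⟩, rfl, rfl⟩
    · rintro (⟨u, hu, w, hw, rfl, rfl⟩ | ⟨u, hu, w, hw, rfl, rfl⟩)
      · exact ⟨hw, Or.inl hu⟩
      · exact ⟨hw.1.symm, Or.inr hu⟩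
  rw [h1, card_union_of_disjoint, card_biUnion, card_biUnion, sum_add_distrib]
  · congr 1 <;> refine sum_congr rfl fun u _ => card_image_of_injective _ fun x y h => ?_
    · exact (Prod.mk.inj h).2
    · exact (Prod.mk.inj h).1
  · intro u _ v _ huv
    simp only [Function.onFun, Finset.disjoint_left, mem_image, not_exists, not_and]
    rintro p ⟨w, -, rfl⟩ w' - h
    exact huv (Prod.mk.inj h).2.symm
  · intro u _ v _ huv
    simp only [Function.onFun, Finset.disjoint_left, mem_image, not_exists, not_and]
    rintro p ⟨w, -, rfl⟩ w' - h
    exact huv (Prod.mk.inj h).1.symm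
  · rw [Finset.disjoint_left]
    simp only [mem_biUnion, mem_image, mem_filter, mem_univ, true_and, not_exists, not_and]
    rintro p ⟨u, hu, w, hw, rfl⟩ v hv w' hw' h
    exact hw'.2 ((Prod.mk.inj h).1 ▸ hu)

theorem HasK.of_star {R : Finset V} {u : V} {b : V → Set V} {τ : V → V} (huR : u ∈ R)
    (hb : Linkage G {u} R b τ) (A : Finset V) (hAu : ∀ x ∈ A, G.Adj u x)
    (hAτ : ∀ y ∈ nb G R, τ y ∉ A) (hAR : A ⊆ R) (hne : A.Nonempty) (h4 : #A ≤ 4)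
    (hx : ∀ x ∈ A, #{w ∈ A | w ≠ x ∧ ¬ G.Adj x w} + #{w ∈ (nb G R).image τ | ¬ G.Adj x w} < #A)
    (hp : ∀ y ∈ nb G R, ∃ w ∈ A, G.Adj (τ y) w) : HasK G R := by
  have hmem : ∀ x, x ∈ nb G {u} ↔ G.Adj u x := by
    intro x
    simp only [mem_nb, mem_singleton, exists_eq_left]
    exact ⟨fun h => h.2, fun h => ⟨h.ne.symm, h⟩⟩
  have hbu : ∀ y ∈ nb G R, u ∉ b y := by
    intro y hy h
    rcases hb.sub y hy u h with h | rfl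
    · exact h.2 (mem_singleton_self u)
    · exact (mem_nb.mp hy).1 huR
  have huA : u ∉ A := fun h => (hAu u h).ne rfl
  have hbA : ∀ y ∈ nb G R, ∀ x ∈ A, x ∉ b y := by
    intro y hy x hxA h
    exact hAτ y hy (hb.foot_unique y hy x h ((hmem x).mpr (hAu x hxA)) ▸ hxA)
  have hτu : ∀ y ∈ nb G R, G.Adj u (τ y) := fun y hy => (hmem _).mp (hb.foot_mem y hy)
  have hroot : RootModel G R b :=
    ⟨hb.conn, hb.root, fun y hy v hv => (hb.sub y hy v hv).imp_left And.left, hb.disj⟩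
  have main : ∀ C : Finset V, C ⊆ A → Conn G (C : Set V) →
      (∀ y ∈ nb G R, ∃ w ∈ C, G.Adj (τ y) w) → HasK G R := by
    intro C hCA hC ht
    obtain ⟨c, hc⟩ := hC.1
    refine ⟨b, {u}, C, hroot, fun v hv => Set.mem_singleton_iff.mp hv ▸ huR,
      fun v hv => hAR (hCA hv), conn_singleton G u, hC, ?_, fun y hy => ?_, fun y hy => ?_,
      fun y hy => ⟨u, rfl, τ y, hb.foot y hy, hτu y hy⟩, fun y hy => ?_,
      ⟨u, rfl, c, hc, hAu c (hCA hc)⟩⟩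
    · rw [Set.disjoint_singleton_left]
      exact fun h => huA (hCA h)
    · rw [Set.disjoint_singleton_left]
      exact hbu y hy
    · rw [Set.disjoint_left]
      exact fun x hx => hbA y hy x (hCA hx)
    · obtain ⟨w, hw, hτw⟩ := ht y hy
      exact ⟨w, hw, τ y, hb.foot y hy, hτw.symm⟩
  by_cases hconn : Conn G (A : Set V)
  · exact main A le_rfl hconn hp
  by_cases hiso : ∃ x ∈ A, ∀ w ∈ A, ¬ G.Adj x w
  · obtain ⟨x, hxA, hiso⟩ := hiso
    refine main {x} (by simpa using hxA) (by simpa using conn_singleton G x) fun y hy => ⟨x, by simp, ?_⟩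
    have h1 := hx x hxA
    have h2 : ({w ∈ A | w ≠ x ∧ ¬ G.Adj x w} : Finset V) = A.erase x := by
      ext w
      simp only [mem_filter, mem_erase]
      exact ⟨fun h => ⟨h.2.1, h.1⟩, fun h => ⟨h.2, h.1, hiso w h.2⟩⟩
    rw [h2, card_erase_of_mem hxA] at h1
    have h3 : #{w ∈ (nb G R).image τ | ¬ G.Adj x w} = 0 := by
      have := hne.card_pos
      omega
    rw [card_eq_zero, filter_eq_empty_iff] at h3
    exact (not_not.mp (h3 (mem_image_of_mem τ hy))).symm
  push Not at hiso
  have hsplit : ∃ T : Set V, (∃ a ∈ A, a ∈ T) ∧ (∃ b ∈ A, b ∉ T) ∧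
      ∀ a ∈ A, a ∈ T → ∀ b ∈ A, b ∉ T → ¬ G.Adj a b := by
    by_contra! hcon
    refine hconn ⟨by simpa using hne, fun T h1 h2 => ?_⟩
    obtain ⟨a, ha, haT, b, hb, hbT, hab⟩ := hcon T (by simpa using h1) (by simpa using h2)
    exact ⟨a, ha, haT, b, hb, hbT, hab⟩
  obtain ⟨T, ⟨x, hxA, hxT⟩, ⟨z, hzA, hzT⟩, hno⟩ := hsplit
  obtain ⟨y, hyA, hxy⟩ := hiso x hxA
  obtain ⟨w, hwA, hzw⟩ := hiso z hzA
  have hyT : y ∈ T := by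
    by_contra h
    exact hno x hxA hxT y hyA h hxy
  have hwT : w ∉ T := fun h => hno w hwA h z hzA hzT hzw.symm
  have hA : #A = 4 ∧ ∀ v ∈ A, v = x ∨ v = y ∨ v = z ∨ v = w := by
    have h1 : ({x, y, z, w} : Finset V) ⊆ A := by
      intro v hv
      simp only [mem_insert, mem_singleton] at hv
      rcases hv with rfl | rfl | rfl | rfl <;> assumption
    have h2 : #({x, y, z, w} : Finset V) = 4 := by
      have n1 : x ≠ z := fun h => hzT (h ▸ hxT)
      have n2 : x ≠ w := fun h => hwT (h ▸ hxT)
      have n3 : y ≠ z := fun h => hzT (h ▸ hyT)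
      have n4 : y ≠ w := fun h => hwT (h ▸ hyT)
      rw [card_insert_of_notMem (by simp [hxy.ne, n1, n2]), card_insert_of_notMem (by simp [n3, n4]),
        card_pair hzw.ne]
    have h3 := eq_of_subset_of_card_le h1 (by omega)
    refine ⟨by rw [← h3, h2], fun v hv => ?_⟩
    rw [← h3] at hv
    simpa using hv
  have hmiss : ∀ c ∈ A, c ∈ T → #{w ∈ (nb G R).image τ | ¬ G.Adj c w} ≤ 1 := by
    intro c hcA hcT
    have h1 := hx c hcA
    have h2 : ({z, w} : Finset V) ⊆ {w ∈ A | w ≠ c ∧ ¬ G.Adj c w} := by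
      intro v hv
      simp only [mem_insert, mem_singleton] at hv
      rw [mem_filter]
      rcases hv with rfl | rfl
      · exact ⟨hzA, fun h => hzT (h ▸ hcT), hno c hcA hcT v hzA hzT⟩
      · exact ⟨hwA, fun h => hwT (h ▸ hcT), hno c hcA hcT v hwA hwT⟩
    have h3 := card_le_card h2
    rw [card_pair hzw.ne] at h3
    omega
  by_cases hdom : ∀ v ∈ nb G R, G.Adj (τ v) x ∨ G.Adj (τ v) y
  · refine main {x, y} ?_ ?_ fun v hv => ?_
    · intro v hv
      simp only [mem_insert, mem_singleton] at hv
      rcases hv with rfl | rfl <;> assumption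
    · simpa using (conn_singleton G y).insert ⟨y, rfl, hxy⟩
    · simpa using hdom v hv
  push Not at hdom
  obtain ⟨p, hpR, hpx, hpy⟩ := hdom
  have hτinj : ∀ v ∈ nb G R, v ≠ p → τ v ≠ τ p := fun v hv hne h =>
    Set.disjoint_left.mp (hb.disj v hv p hpR hne) (hb.foot v hv) (h ▸ hb.foot p hpR)
  have hadj : ∀ c ∈ A, c ∈ T → ¬ G.Adj (τ p) c → ∀ v ∈ nb G R, v ≠ p → G.Adj c (τ v) := by
    intro c hcA hcT hpc v hv hvp
    by_contra hcon
    refine hτinj v hv hvp (card_le_one.mp (hmiss c hcA hcT) _ ?_ _ ?_)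
    · exact mem_filter.mpr ⟨mem_image_of_mem τ hv, hcon⟩
    · exact mem_filter.mpr ⟨mem_image_of_mem τ hpR, fun h => hpc h.symm⟩
  let D : V → Set V := fun v => if v = p then insert u (b v) else b v
  have hbD : ∀ v, b v ⊆ D v := by
    intro v
    simp only [D]
    split_ifs <;> simp
  have hDb : ∀ v, ∀ c ∈ D v, c = u ∨ c ∈ b v := by
    intro v c hc
    simp only [D] at hc
    split_ifs at hc
    · exact hc
    · exact Or.inr hc
  have htouch : ∀ c ∈ A, c ∈ T → ¬ G.Adj (τ p) c → ∀ v ∈ nb G R, Touch G {c} (D v) := by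
    intro c hcA hcT hpc v hv
    by_cases hvp : v = p
    · exact ⟨c, rfl, u, by simp [D, hvp], (hAu c hcA).symm⟩
    · exact ⟨c, rfl, τ v, hbD v (hb.foot v hv), hadj c hcA hcT hpc v hv hvp⟩
  have hdisj : ∀ c ∈ A, ∀ v ∈ nb G R, Disjoint {c} (D v) := by
    intro c hcA v hv
    rw [Set.disjoint_singleton_left]
    intro h
    rcases hDb v c h with rfl | h
    · exact huA hcA
    · exact hbA v hv c hcA h
  refine ⟨D, {x}, {y}, ⟨fun v hv => ?_, fun v hv => hbD v (hb.root v hv), fun v hv c hc => ?_,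
    fun v hv v' hv' hne => ?_⟩, fun v hv => Set.mem_singleton_iff.mp hv ▸ hAR hxA,
    fun v hv => Set.mem_singleton_iff.mp hv ▸ hAR hyA, conn_singleton G x, conn_singleton G y,
    by simpa using hxy.ne, hdisj x hxA, hdisj y hyA, htouch x hxA hxT hpx, htouch y hyA hyT hpy,
    ⟨x, rfl, y, rfl, hxy⟩⟩
  · simp only [D]
    split_ifs
    · exact (hb.conn v hv).insert ⟨τ v, hb.foot v hv, hτu v hv⟩
    · exact hb.conn v hv
  · rcases hDb v c hc with rfl | hc
    · exact Or.inl huR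
    · exact hroot.sub v hv c hc
  · have h1 := hb.disj v hv v' hv' hne
    have h2 := hbu v hv
    have h3 := hbu v' hv'
    simp only [D]
    split_ifs with h4 h5 h5
    · exact absurd (h4.trans h5.symm) hne
    · exact Set.disjoint_insert_left.mpr ⟨h3, h1⟩
    · exact Set.disjoint_insert_right.mpr ⟨h2, h1⟩
    · exact h1

end MassedTheorem

section MassedTheorem

open Finset
open scoped Classical

variable {V : Type} [Fintype V] {G G' : SimpleGraph V}

theorem HasK.of_massed_of_no_rigid {S : Finset V} (hS : Massed G S) (hk : #(nb G S) ≤ 4)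
    (ih : ∀ (G' : SimpleGraph V) (S' : Finset V),
      (#S' < #S ∨ #S' = #S ∧ #(darts G' S') < #(darts G S)) → Massed G' S' → #(nb G' S') ≤ 4 →
      HasK G' S')
    (hno : ∀ T, T ⊂ S → #(nb G T) ≤ #(nb G S) → ¬ HasK G T) : HasK G S := by
  by_contra hnK
  have hdd := (HasK.or_card_darts_le hk ih hno).resolve_left hnK
  have hbad : ∀ u ∈ S, ∀ v, G.Adj u v →
      4 ≤ #{w | G.Adj u w ∧ w ≠ v ∧ (G.Adj v w ∨ (v ∉ S ∧ w ∉ S))} := by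
    intro u hu v huv
    by_contra! h
    exact hnK (HasK.or_bad hS hk ih hno hu huv (by omega))
  have hS1 := hS.1
  have hsum := card_darts_eq G S
  have hO : ∀ u ∈ S, ({w | G.Adj u w ∧ w ∉ S} : Finset V) ⊆ nb G S := by
    intro u hu w hw
    simp only [mem_filter, mem_univ, true_and] at hw
    exact mem_nb.mpr ⟨hw.2, u, hu, hw.1⟩
  have hO4 : ∀ u ∈ S, #{w | G.Adj u w ∧ w ∉ S} ≤ 4 := fun u hu => (card_le_card (hO u hu)).trans hk
  have hm : 3 ≤ #S := by
    by_contra! hm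
    obtain h0 | h1 | h2 : #S = 0 ∨ #S = 1 ∨ #S = 2 := by omega
    · rw [card_eq_zero] at h0
      subst h0
      simp_all
    · obtain ⟨u, rfl⟩ := card_eq_one.mp h1
      rw [sum_singleton] at hsum
      have h2 := hO4 u (mem_singleton_self u)
      have h3 : #{w | G.Adj u w} ≤ #{w | G.Adj u w ∧ w ∉ ({u} : Finset V)} := card_le_card (by
        intro w hw
        simp only [mem_filter, mem_univ, true_and, mem_singleton] at hw ⊢
        exact ⟨hw, hw.ne.symm⟩)
      omega
    · obtain ⟨u, v, huv, rfl⟩ := card_eq_two.mp h2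
      rw [sum_pair huv] at hsum
      have h3 := hO4 u (by simp)
      have h4 := hO4 v (by simp)
      by_cases hadj : G.Adj u v
      · have h5 : #{w | G.Adj u w} ≤ #{w | G.Adj u w ∧ w ∉ ({u, v} : Finset V)} + 1 := by
          refine (card_le_card ?_).trans (card_insert_le v _)
          intro w hw
          simp only [mem_filter, mem_univ, true_and, mem_singleton, mem_insert, not_or] at hw ⊢
          by_cases hwv : w = v
          · exact Or.inl hwv
          · exact Or.inr ⟨hw, hw.ne.symm, hwv⟩
        have h6 : #{w | G.Adj v w} ≤ #{w | G.Adj v w ∧ w ∉ ({u, v} : Finset V)} + 1 := by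
          refine (card_le_card ?_).trans (card_insert_le u _)
          intro w hw
          simp only [mem_filter, mem_univ, true_and, mem_singleton, mem_insert, not_or] at hw ⊢
          by_cases hwv : w = u
          · exact Or.inl hwv
          · exact Or.inr ⟨hw, hwv, hw.ne.symm⟩
        have h7 := eq_of_subset_of_card_le (hO u (by simp)) (by omega)
        have h8 := eq_of_subset_of_card_le (hO v (by simp)) (by omega)
        have h9 : ∀ y ∈ nb G {u, v}, G.Adj u y := fun y hy => by
          rw [← h7] at hy
          exact (mem_filter.mp hy).2.1
        have h10 : ∀ y ∈ nb G {u, v}, G.Adj v y := fun y hy => by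
          rw [← h8] at hy
          exact (mem_filter.mp hy).2.1
        exact hnK ⟨fun y => {y}, {u}, {v}, ⟨fun y _ => conn_singleton G y, fun _ _ => rfl,
          fun _ _ v hv => Or.inr hv, fun y _ z _ h => by simpa using h⟩,
          by simp, by simp, conn_singleton G u, conn_singleton G v, by simpa using huv,
          fun y hy => by simpa using (h9 y hy).ne, fun y hy => by simpa using (h10 y hy).ne,
          fun y hy => ⟨u, rfl, y, rfl, h9 y hy⟩, fun y hy => ⟨v, rfl, y, rfl, h10 y hy⟩,
          ⟨u, rfl, v, rfl, hadj⟩⟩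
      · have h5 : #{w | G.Adj u w} ≤ #{w | G.Adj u w ∧ w ∉ ({u, v} : Finset V)} := by
          refine card_le_card fun w hw => ?_
          simp only [mem_filter, mem_univ, true_and, mem_singleton, mem_insert, not_or] at hw ⊢
          exact ⟨hw, hw.ne.symm, fun h => hadj (h ▸ hw)⟩
        have h6 : #{w | G.Adj v w} ≤ #{w | G.Adj v w ∧ w ∉ ({u, v} : Finset V)} := by
          refine card_le_card fun w hw => ?_
          simp only [mem_filter, mem_univ, true_and, mem_singleton, mem_insert, not_or] at hw ⊢
          exact ⟨hw, fun h => hadj (h ▸ hw.symm), hw.ne.symm⟩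
        omega
  have hu : ∃ u ∈ S, #{w | G.Adj u w} ≤ 8 := by
    by_contra! hcon
    have := card_nsmul_le_sum S (fun u => #{w | G.Adj u w} + #{w | G.Adj u w ∧ w ∉ S}) 9
      (fun u hu => by have := hcon u hu; omega)
    rw [smul_eq_mul, ← hsum] at this
    omega
  obtain ⟨u, hu, hu8⟩ := hu
  set N : Finset V := {w | G.Adj u w} with hN
  have hmN : ∀ w, w ∈ N ↔ G.Adj u w := fun w => by simp [hN]
  have hNne : ∃ v, G.Adj u v := by
    by_contra! hcon
    have h1 : nb G (S.erase u) ⊆ nb G S := by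
      intro v hv
      obtain ⟨hvS, s, hs, hsv⟩ := mem_nb.mp hv
      refine mem_nb.mpr ⟨fun h => hvS (mem_erase.mpr ⟨?_, h⟩), s, mem_of_mem_erase hs, hsv⟩
      rintro rfl
      exact hcon s hsv.symm
    have h2 : darts G S ⊆ darts G (S.erase u) := by
      rintro ⟨a, b⟩ hp
      obtain ⟨hab, h⟩ := mem_darts.mp hp
      refine mem_darts.mpr ⟨hab, h.imp (fun h => mem_erase.mpr ⟨?_, h⟩)
        (fun h => mem_erase.mpr ⟨?_, h⟩)⟩
      · rintro rfl; exact hcon _ hab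
      · rintro rfl; exact hcon _ hab.symm
    have h3 := HasK.of_no_rigid_aux hk ih hno _ (erase_ssubset hu) (card_le_card h1)
    have h4 := card_le_card h2
    have h5 := card_erase_lt_of_mem hu
    omega
  have hcount : ∀ v, G.Adj u v → ∀ X ⊆ N.erase v,
      Disjoint X ({w | G.Adj u w ∧ w ≠ v ∧ (G.Adj v w ∨ (v ∉ S ∧ w ∉ S))} : Finset V) → #X + 5 ≤ #N := by
    intro v huv X hX hd
    have h1 : X ∪ ({w | G.Adj u w ∧ w ≠ v ∧ (G.Adj v w ∨ (v ∉ S ∧ w ∉ S))} : Finset V) ⊆ N.erase v := by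
      refine union_subset hX fun w hw => ?_
      simp only [mem_filter, mem_univ, true_and] at hw
      exact mem_erase.mpr ⟨hw.2.1, (hmN w).mpr hw.1⟩
    have h2 := card_le_card h1
    rw [card_union_of_disjoint hd] at h2
    have h3 := card_erase_add_one ((hmN v).mpr huv)
    have h4 := hbad u hu v huv
    omega
  obtain ⟨v₀, hv₀⟩ := hNne
  have hN5 := hcount v₀ hv₀ ∅ (empty_subset _) (disjoint_empty_left _)
  obtain ⟨R, hR, hRmin⟩ := exists_min_image (S.powerset.filter fun R => u ∈ R)
    (fun R => #(nb G R)) ⟨S, by simpa using hu⟩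
  simp only [mem_filter, mem_powerset] at hR hRmin
  obtain ⟨hRS, huR⟩ := hR
  have hRk := hRmin S ⟨le_rfl, hu⟩
  obtain ⟨b, τ, hb⟩ := exists_linkage _ G {u} R rfl (by simpa using huR)
    fun R' h h' => hRmin R' ⟨h'.trans hRS, h (mem_singleton_self u)⟩
  have hmem : ∀ x, x ∈ nb G {u} ↔ G.Adj u x := by
    intro x
    simp only [mem_nb, mem_singleton, exists_eq_left]
    exact ⟨fun h => h.2, fun h => ⟨h.ne.symm, h⟩⟩
  have hPN : (nb G R).image τ ⊆ N := by
    intro x hx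
    obtain ⟨y, hy, rfl⟩ := mem_image.mp hx
    exact (hmN _).mpr ((hmem _).mp (hb.foot_mem y hy))
  obtain ⟨P, hPP, hPN', hP4⟩ := exists_subsuperset_card_eq hPN
    (card_image_le.trans (hRk.trans hk)) (by omega : 4 ≤ #N)
  have hAc : #(N \ P) + 4 = #N := by
    rw [← hP4]; exact card_sdiff_add_card_eq_card hPN'
  have hAN : ∀ x ∈ N \ P, G.Adj u x := fun x hx => (hmN x).mp (mem_sdiff.mp hx).1
  have hAR : N \ P ⊆ R := by
    intro x hx
    by_contra hxR
    have hux := hAN x hx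
    have hxn : x ∈ nb G R := mem_nb.mpr ⟨hxR, u, huR, hux⟩
    have := hb.foot_unique x hxn x (hb.root x hxn) ((hmem x).mpr hux)
    exact (mem_sdiff.mp hx).2 (hPP (this ▸ mem_image_of_mem τ hxn))
  have hRK : HasK G R := by
    refine HasK.of_star huR hb (N \ P) hAN (fun y hy h => ?_) hAR ?_ (by omega) (fun x hx => ?_)
      (fun y hy => ?_)
    · exact (mem_sdiff.mp h).2 (hPP (mem_image_of_mem τ hy))
    · rw [← card_pos]; omega
    · have hxS := hRS (hAR hx)
      have hxP := (mem_sdiff.mp hx).2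
      have h1 : Disjoint ({w ∈ N \ P | w ≠ x ∧ ¬ G.Adj x w} : Finset V)
          {w ∈ (nb G R).image τ | ¬ G.Adj x w} := by
        rw [Finset.disjoint_left]
        intro w hw hw'
        exact (mem_sdiff.mp (mem_filter.mp hw).1).2 (hPP (mem_filter.mp hw').1)
      rw [← card_union_of_disjoint h1]
      have := hcount x (hAN x hx) _ (union_subset (s := {w ∈ N \ P | w ≠ x ∧ ¬ G.Adj x w})
        (t := {w ∈ (nb G R).image τ | ¬ G.Adj x w}) ?_ ?_) ?_
      · omega
      · intro w hw
        obtain ⟨hw, hwx, -⟩ := mem_filter.mp hw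
        exact mem_erase.mpr ⟨hwx, (mem_sdiff.mp hw).1⟩
      · intro w hw
        obtain ⟨hw, -⟩ := mem_filter.mp hw
        exact mem_erase.mpr ⟨fun h => hxP (hPP (h ▸ hw)), hPN hw⟩
      · rw [Finset.disjoint_left]
        intro w hw hw'
        simp only [mem_filter, mem_univ, true_and, mem_union] at hw hw'
        rcases hw'.2.2 with h | h
        · exact hw.elim (fun h' => h'.2.2 h) (fun h' => h'.2 h)
        · exact h.1 hxS
    · by_contra! hcon
      have := hcount (τ y) ((hmem _).mp (hb.foot_mem y hy)) (N \ P) ?_ ?_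
      · omega
      · intro w hw
        exact mem_erase.mpr ⟨fun h => (mem_sdiff.mp hw).2 (hPP (h ▸ mem_image_of_mem τ hy)),
          (mem_sdiff.mp hw).1⟩
      · rw [Finset.disjoint_left]
        intro w hw hw'
        simp only [mem_filter, mem_univ, true_and] at hw'
        rcases hw'.2.2 with h | h
        · exact hcon w hw h
        · exact h.2 (hRS (hAR hw))
  by_cases hRS' : R = S
  · exact hnK (hRS' ▸ hRK)
  · exact hno R (lt_of_le_of_ne hRS hRS') hRk hRK

theorem Massed.hasK {S : Finset V} (hS : Massed G S) (hk : #(nb G S) ≤ 4) : HasK G S := by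
  have main : ∀ (n : ℕ) (G : SimpleGraph V) (S : Finset V),
      #S * (Fintype.card (V × V) + 1) + #(darts G S) = n → Massed G S → #(nb G S) ≤ 4 →
      HasK G S := by
    intro n
    induction n using Nat.strong_induction_on with
    | _ n ih =>
    intro G S hn hS hk
    have ih' : ∀ (G' : SimpleGraph V) (S' : Finset V),
        (#S' < #S ∨ #S' = #S ∧ #(darts G' S') < #(darts G S)) → Massed G' S' → #(nb G' S') ≤ 4 →
        HasK G' S' := by
      intro G' S' h
      refine ih _ ?_ G' S' rfl
      have h1 : #(darts G' S') ≤ Fintype.card (V × V) := card_le_univ _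
      rcases h with h | ⟨h, h'⟩
      · have := Nat.mul_le_mul_right (Fintype.card (V × V) + 1) (Nat.succ_le_of_lt h)
        rw [Nat.succ_mul] at this
        omega
      · rw [h]; omega
    by_contra hnK
    exact hnK (HasK.of_massed_of_no_rigid hS hk ih' fun T hT hle hTK =>
      hnK (HasK.extend_massed hS hk (fun G' S' h => ih' G' S' (Or.inl h)) hT hle hTK))
  exact main _ G S rfl hS hk

end MassedTheorem

section NearClique

open Finset
open scoped Classical

variable {V : Type} [Fintype V] {G G' : SimpleGraph V}

theorem exists_near_clique {S : Finset V} (hS : 2 ≤ #S) (h4 : #(nb G S) = 4)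
    (hT : ∀ T ⊆ S, T.Nonempty → 4 ≤ #(nb G T)) :
    ∃ B, ∃ b ∈ nb G S, ∃ c ∈ nb G S, b ≠ c ∧ RootModel G S B ∧
      ∀ p ∈ nb G S, ∀ q ∈ nb G S, p ≠ q → ¬ (p = b ∧ q = c) → ¬ (p = c ∧ q = b) →
        Touch G (B p) (B q) := by
  obtain ⟨w, hw⟩ : S.Nonempty := card_pos.mp (by omega)
  obtain ⟨b₀, τ, hb₀⟩ := exists_linkage _ G {w} S rfl (by simpa using hw)
    fun R h h' => h4 ▸ hT R h' ⟨w, h (mem_singleton_self w)⟩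
  have hZS : ∀ y ∈ nb G S, y ∉ S := fun y hy => (mem_nb.mp hy).1
  let good : Set (V → Set V) :=
    {B | RootModel G S B ∧ ∀ y ∈ nb G S, w ∉ B y ∧ Touch G {w} (B y)}
  have hgood : b₀ ∈ good := by
    refine ⟨⟨hb₀.conn, hb₀.root, fun y hy v hv => (hb₀.sub y hy v hv).imp_left And.left,
      hb₀.disj⟩, fun y hy => ⟨fun h => ?_, w, rfl, τ y, hb₀.foot y hy, ?_⟩⟩
    · rcases hb₀.sub y hy w h with h | rfl
      · exact h.2 (mem_singleton_self w)
      · exact hZS _ hy hw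
    · simpa using (mem_nb.mp (hb₀.foot_mem y hy)).2
  obtain ⟨B, -, ⟨hB, hBw⟩, hmax⟩ := good.toFinite.exists_le_maximal hgood
  have hcover : ∀ s ∈ S, s = w ∨ ∃ y ∈ nb G S, s ∈ B y := by
    by_contra! hcon
    obtain ⟨s, hs, hsw, hsB⟩ := hcon
    have h1 := hT {s ∈ S | s ≠ w ∧ ∀ y ∈ nb G S, s ∉ B y} (filter_subset _ _)
      ⟨s, mem_filter.mpr ⟨hs, hsw, hsB⟩⟩
    have h2 : nb G {s ∈ S | s ≠ w ∧ ∀ y ∈ nb G S, s ∉ B y} ⊆ {w} := by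
      intro v hv
      obtain ⟨hvL, l, hl, hlv⟩ := mem_nb.mp hv
      obtain ⟨hlS, hlw, hlB⟩ := mem_filter.mp hl
      by_contra hvw
      rw [mem_singleton] at hvw
      have h3 : ∃ y ∈ nb G S, v ∈ B y := by
        by_cases hvS : v ∈ S
        · by_contra! hcon
          exact hvL (mem_filter.mpr ⟨hvS, hvw, hcon⟩)
        · have hvn := mem_nb.mpr ⟨hvS, l, hlS, hlv⟩
          exact ⟨v, hvn, hB.root v hvn⟩
      obtain ⟨y, hy, hvy⟩ := h3
      let B' : V → Set V := fun z => if z = y then insert l (B z) else B z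
      have hBB : ∀ z, B z ⊆ B' z := by
        intro z
        simp only [B']
        split_ifs <;> simp
      have hB'l : ∀ z, ∀ x ∈ B' z, x = l ∨ x ∈ B z := by
        intro z x hx
        simp only [B'] at hx
        split_ifs at hx
        · exact hx
        · exact Or.inr hx
      have hB' : B' ∈ good := by
        refine ⟨⟨fun z hz => ?_, fun z hz => hBB z (hB.root z hz), fun z hz x hx => ?_,
          fun z hz z' hz' hne => ?_⟩, fun z hz => ⟨fun h => ?_, (hBw z hz).2.mono le_rfl (hBB z)⟩⟩
        · simp only [B']
          split_ifs with h
          · subst h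
            exact (hB.conn z hz).insert ⟨v, hvy, hlv⟩
          · exact hB.conn z hz
        · rcases hB'l z x hx with rfl | hx
          · exact Or.inl hlS
          · exact hB.sub z hz x hx
        · have h3 := hB.disj z hz z' hz' hne
          simp only [B']
          split_ifs with h h' h'
          · exact absurd (h.trans h'.symm) hne
          · exact Set.disjoint_insert_left.mpr ⟨hlB z' hz', h3⟩
          · exact Set.disjoint_insert_right.mpr ⟨hlB z hz, h3⟩
          · exact h3
        · rcases hB'l z w h with rfl | h
          · exact hlw rfl
          · exact (hBw z hz).1 h
      refine hlB y hy (hmax hB' hBB y ?_)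
      simp [B']
    have := card_le_card h2
    rw [card_singleton] at this
    omega
  have hcross : ∀ y ∈ nb G S, ∀ d ∈ B y, d ∈ S → ∀ v, G.Adj d v → v ∉ B y →
      v = w ∨ ∃ z ∈ nb G S, z ≠ y ∧ v ∈ B z ∧ Touch G (B y) (B z) := by
    intro y hy d hd hdS v hdv hv
    have h1 : v = w ∨ ∃ z ∈ nb G S, v ∈ B z := by
      by_cases hvS : v ∈ S
      · exact hcover v hvS
      · have hvn := mem_nb.mpr ⟨hvS, d, hdS, hdv⟩
        exact Or.inr ⟨v, hvn, hB.root v hvn⟩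
    exact h1.imp_right fun ⟨z, hz, hvz⟩ => ⟨z, hz, fun h => hv (h ▸ hvz), hvz, d, hd, v, hvz, hdv⟩
  have hpath : ∃ y ∈ nb G S, ∃ y' ∈ nb G S, ∃ y'' ∈ nb G S, y' ≠ y ∧ y'' ≠ y ∧ y' ≠ y'' ∧
      Touch G (B y) (B y') ∧ Touch G (B y) (B y'') := by
    by_contra! hcon
    obtain ⟨s, hs, hsw⟩ := exists_mem_ne (by omega : 1 < #S) w
    obtain ⟨y₁, hy₁, hsy₁⟩ := (hcover s hs).resolve_left hsw
    have hfin : ∀ y₂ ∈ nb G S, (∀ z ∈ nb G S, z ≠ y₁ → z ≠ y₂ → ¬ Touch G (B y₁) (B z)) →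
        (∀ z ∈ nb G S, z ≠ y₁ → z ≠ y₂ → ¬ Touch G (B y₂) (B z)) → False := by
      intro y₂ hy₂ h1 h2
      have h3 := hT {s ∈ S | s ∈ B y₁ ∨ s ∈ B y₂} (filter_subset _ _)
        ⟨s, mem_filter.mpr ⟨hs, Or.inl hsy₁⟩⟩
      have h4 : nb G {s ∈ S | s ∈ B y₁ ∨ s ∈ B y₂} ⊆ {w, y₁, y₂} := by
        intro v hv
        obtain ⟨hvL, l, hl, hlv⟩ := mem_nb.mp hv
        obtain ⟨hlS, hlB⟩ := mem_filter.mp hl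
        simp only [mem_insert, mem_singleton]
        by_contra! hv3
        have hvB : v ∉ B y₁ ∧ v ∉ B y₂ := by
          refine ⟨fun h => ?_, fun h => ?_⟩
          · exact (hB.sub y₁ hy₁ v h).elim (fun h' => hvL (mem_filter.mpr ⟨h', Or.inl h⟩)) hv3.2.1
          · exact (hB.sub y₂ hy₂ v h).elim (fun h' => hvL (mem_filter.mpr ⟨h', Or.inr h⟩)) hv3.2.2
        rcases hlB with hl | hl
        · obtain ⟨z, hz, hzy, hvz, ht⟩ := (hcross y₁ hy₁ l hl hlS v hlv hvB.1).resolve_left hv3.1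
          exact h1 z hz hzy (fun h => hvB.2 (h ▸ hvz)) ht
        · obtain ⟨z, hz, hzy, hvz, ht⟩ := (hcross y₂ hy₂ l hl hlS v hlv hvB.2).resolve_left hv3.1
          exact h2 z hz (fun h => hvB.1 (h ▸ hvz)) hzy ht
      have := (card_le_card h4).trans card_le_three
      omega
    by_cases hy₂ : ∃ y₂ ∈ nb G S, y₂ ≠ y₁ ∧ Touch G (B y₁) (B y₂)
    · obtain ⟨y₂, hy₂, hne, ht⟩ := hy₂
      exact hfin y₂ hy₂ (fun z hz h h' => hcon y₁ hy₁ y₂ hy₂ z hz hne h h'.symm ht)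
        (fun z hz h h' => hcon y₂ hy₂ y₁ hy₁ z hz hne.symm h' h.symm ht.symm)
    · push Not at hy₂
      exact hfin y₁ hy₁ (fun z hz h _ => hy₂ z hz h) (fun z hz h _ => hy₂ z hz h)
  obtain ⟨y, hy, y', hy', y'', hy'', h1, h2, h3, ht, ht'⟩ := hpath
  have h5 : ({y, y', y''} : Finset V) ⊆ nb G S := by
    intro x hx
    simp only [mem_insert, mem_singleton] at hx
    rcases hx with rfl | rfl | rfl <;> assumption
  have h6 : #({y, y', y''} : Finset V) = 3 := card_eq_three.mpr ⟨y, y', y'', h1.symm, h2.symm, h3, rfl⟩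
  obtain ⟨x, hx⟩ := card_eq_one.mp (by rw [card_sdiff_of_subset h5]; omega : #(nb G S \ {y, y', y''}) = 1)
  have hall : ∀ z ∈ nb G S, z = x ∨ z = y ∨ z = y' ∨ z = y'' := by
    intro z hz
    by_cases h : z ∈ ({y, y', y''} : Finset V)
    · exact Or.inr (by simpa using h)
    · exact Or.inl (mem_singleton.mp (hx ▸ mem_sdiff.mpr ⟨hz, h⟩))
  have hxZ : x ∈ nb G S := (mem_sdiff.mp (hx ▸ mem_singleton_self x)).1
  let D : V → Set V := fun z => if z = x then insert w (B z) else B z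
  have hBD : ∀ z, B z ⊆ D z := by
    intro z
    simp only [D]
    split_ifs <;> simp
  have hxt : ∀ z ∈ nb G S, Touch G (D x) (D z) := fun z hz =>
    (hBw z hz).2.mono (by simp [D]) (hBD z)
  refine ⟨D, y', hy', y'', hy'', h3, ⟨fun z hz => ?_, fun z hz => hBD z (hB.root z hz),
    fun z hz v hv => ?_, fun z hz z' hz' hne => ?_⟩, fun p hp q hq hpq hn hn' => ?_⟩
  · simp only [D]
    split_ifs
    · obtain ⟨a, rfl, c, hc, hac⟩ := (hBw z hz).2
      exact (hB.conn z hz).insert ⟨c, hc, hac⟩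
    · exact hB.conn z hz
  · simp only [D] at hv
    split_ifs at hv
    · rcases hv with rfl | hv
      · exact Or.inl hw
      · exact hB.sub z hz v hv
    · exact hB.sub z hz v hv
  · have h7 := hB.disj z hz z' hz' hne
    simp only [D]
    split_ifs with h h' h'
    · exact absurd (h.trans h'.symm) hne
    · exact Set.disjoint_insert_left.mpr ⟨(hBw z' hz').1, h7⟩
    · exact Set.disjoint_insert_right.mpr ⟨(hBw z hz).1, h7⟩
    · exact h7
  · have m1 := ht.mono (hBD y) (hBD y')
    have m2 := ht'.mono (hBD y) (hBD y'')
    rcases hall p hp with rfl | rfl | rfl | rfl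
    · exact hxt q hq
    all_goals
      rcases hall q hq with rfl | rfl | rfl | rfl
      · exact (hxt _ hp).symm
      all_goals first
        | exact absurd rfl hpq
        | exact m1
        | exact m2
        | exact m1.symm
        | exact m2.symm
        | exact absurd ⟨rfl, rfl⟩ hn
        | exact absurd ⟨rfl, rfl⟩ hn'

end NearClique

section Replacement

open Finset
open scoped Classical

variable {V : Type} [Fintype V] {G : SimpleGraph V}

omit [Fintype V] in
theorem isMinor_iff {W : Type} {H : SimpleGraph W} : IsMinor H G ↔ ∃ bag : W → Set V,
    (∀ w, Conn G (bag w)) ∧ (∀ w w', w ≠ w' → Disjoint (bag w) (bag w')) ∧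
      ∀ w w', H.Adj w w' → Touch G (bag w) (bag w') := by
  simp only [IsMinor, induce_connected_iff_conn, Touch]

theorem IsKConnected.four_le_card_nb (h : IsKConnected 4 G) {U : Finset V} (hU : U.Nonempty)
    {v : V} (hvU : v ∉ U) (hv : v ∉ nb G U) : 4 ≤ #(nb G U) := by
  by_contra! hcon
  have h1 := h.2 (nb G U : Set V) (by simpa [Set.ncard_coe_finset] using hcon)
  rw [induce_connected_iff_conn] at h1
  obtain ⟨u, hu⟩ := hU
  obtain ⟨a, -, haU, b, hb, hbU, hab⟩ := h1.2 (U : Set V)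
    ⟨u, fun h => (mem_nb.mp (mem_coe.mp h)).1 hu, hu⟩ ⟨v, by simpa using hv, by simpa using hvU⟩
  exact hb (mem_coe.mpr (mem_nb.mpr ⟨by simpa using hbU, a, by simpa using haU, hab⟩))

/-- The vertex set is partitioned into `S`, `T` and their common neighbourhood `Z` of size four. -/
structure Cut4 (G : SimpleGraph V) (S T Z : Finset V) : Prop where
  disjST : Disjoint S T
  cover : ∀ v, v ∈ S ∨ v ∈ T ∨ v ∈ Z
  nbS : nb G S = Z
  nbT : nb G T = Z
  card : #Z = 4
  leS : 2 ≤ #S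
  leT : 2 ≤ #T

namespace Cut4

variable {S T Z : Finset V}

theorem symm (h : Cut4 G S T Z) : Cut4 G T S Z :=
  ⟨h.disjST.symm, fun v => by have := h.cover v; tauto, h.nbT, h.nbS, h.card, h.leT, h.leS⟩

theorem notMem_of_mem (h : Cut4 G S T Z) {v : V} (hv : v ∈ Z) : v ∉ S :=
  (mem_nb.mp (h.nbS ▸ hv)).1

theorem notMem_of_memS (h : Cut4 G S T Z) {v : V} (hv : v ∈ S) : v ∉ Z :=
  fun hz => h.notMem_of_mem hz hv

theorem mem_or (h : Cut4 G S T Z) {u v : V} (hu : u ∈ S) (huv : G.Adj u v) : v ∈ S ∨ v ∈ Z := by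
  by_cases hv : v ∈ S
  · exact Or.inl hv
  · exact Or.inr (h.nbS ▸ mem_nb.mpr ⟨hv, u, hu, huv⟩)

theorem notMem_nb (h : Cut4 G S T Z) {U : Finset V} (hU : U ⊆ S) {v : V} (hv : v ∈ T) :
    v ∉ U ∧ v ∉ nb G U := by
  have hvS : v ∉ S := fun hs => Finset.disjoint_left.mp h.disjST hs hv
  refine ⟨fun hvU => hvS (hU hvU), fun hn => ?_⟩
  obtain ⟨-, u, hu, huv⟩ := mem_nb.mp hn
  rcases h.mem_or (hU hu) huv with h1 | h1
  · exact hvS h1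
  · exact h.symm.notMem_of_mem h1 hv

theorem four_le (h : Cut4 G S T Z) (hG : IsKConnected 4 G) {U : Finset V} (hU : U ⊆ S)
    (hne : U.Nonempty) : 4 ≤ #(nb G U) := by
  obtain ⟨v, hv⟩ : T.Nonempty := card_pos.mp (by have := h.leT; omega)
  exact hG.four_le_card_nb hne (h.notMem_nb hU hv).1 (h.notMem_nb hU hv).2

theorem of_nb (hG : IsKConnected 4 G) {S : Finset V} (hS : 2 ≤ #S) (h4 : #(nb G S) ≤ 4)
    (hT : 2 ≤ #(S ∪ nb G S)ᶜ) : Cut4 G S (S ∪ nb G S)ᶜ (nb G S) := by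
  have hne : S.Nonempty := card_pos.mp (by omega)
  obtain ⟨t, ht⟩ : ((S ∪ nb G S)ᶜ).Nonempty := card_pos.mp (by omega)
  have hmem : ∀ v, v ∈ (S ∪ nb G S)ᶜ ↔ v ∉ S ∧ v ∉ nb G S := fun v => by simp
  have h1 := hG.four_le_card_nb hne ((hmem t).mp ht).1 ((hmem t).mp ht).2
  have hsub : nb G (S ∪ nb G S)ᶜ ⊆ nb G S := by
    intro v hv
    obtain ⟨hv, u, hu, huv⟩ := mem_nb.mp hv
    by_contra hcon
    have hvS : v ∈ S := by
      by_contra hvS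
      exact hv ((hmem v).mpr ⟨hvS, hcon⟩)
    exact ((hmem u).mp hu).2 (mem_nb.mpr ⟨((hmem u).mp hu).1, v, hvS, huv.symm⟩)
  obtain ⟨s, hs⟩ := hne
  have h2 := hG.four_le_card_nb ⟨t, ht⟩ (v := s) (fun h => ((hmem s).mp h).1 hs)
    (fun h => (mem_nb.mp (hsub h)).1 hs)
  refine ⟨?_, fun v => ?_, rfl, eq_of_subset_of_card_le hsub (by omega), by omega, hS, hT⟩
  · exact Finset.disjoint_left.mpr fun v hv hv' => ((hmem v).mp hv').1 hv
  · by_cases h : v ∈ S <;> by_cases h' : v ∈ nb G S <;> simp [h, h']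

theorem card_eq (h : Cut4 G S T Z) : Fintype.card V = #S + #T + 4 := by
  have h1 : (univ : Finset V) = S ∪ (T ∪ Z) := by
    ext v
    simpa using h.cover v
  rw [← card_univ, h1, card_union_of_disjoint, card_union_of_disjoint, h.card]
  · omega
  · exact Finset.disjoint_left.mpr fun v hv hz => h.symm.notMem_of_mem hz hv
  · refine Finset.disjoint_left.mpr fun v hv hz => ?_
    rcases mem_union.mp hz with h1 | h1
    · exact Finset.disjoint_left.mp h.disjST hv h1
    · exact h.notMem_of_mem h1 hv

end Cut4

/-- The graph consisting of the edges of `G` meeting `S`, the edges of `F` on `Z`, and further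
vertices, indexed by `ι`, adjacent to all of `Z`. -/
def repl (G : SimpleGraph V) (S Z : Finset V) (F : SimpleGraph V) (ι : Type) :
    SimpleGraph ({v // v ∈ S ∪ Z} ⊕ ι) where
  Adj
  | .inl a, .inl b =>
    (G.Adj a.1 b.1 ∧ (a.1 ∈ S ∨ b.1 ∈ S)) ∨ (F.Adj a.1 b.1 ∧ a.1 ∈ Z ∧ b.1 ∈ Z)
  | .inl a, .inr _ => a.1 ∈ Z
  | .inr _, .inl a => a.1 ∈ Z
  | .inr _, .inr _ => False
  symm := ⟨by
    rintro (a | i) (b | j) h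
    · exact h.imp (fun h => ⟨h.1.symm, h.2.symm⟩) fun h => ⟨h.1.symm, h.2.2, h.2.1⟩
    · exact h
    · exact h
    · exact h⟩
  loopless := ⟨by
    rintro (a | i) h
    · exact h.elim (fun h => G.loopless.irrefl _ h.1) fun h => F.loopless.irrefl _ h.1
    · exact h⟩

/-- The number of ordered pairs in `Z` that are adjacent in `F`. -/
noncomputable def pairs (F : SimpleGraph V) (Z : Finset V) : ℕ :=
  #{p ∈ Z ×ˢ Z | F.Adj p.1 p.2}

theorem le_card_edges_repl {S Z : Finset V} (hSZ : nb G S = Z) {F : SimpleGraph V} {ι : Type}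
    [Fintype ι] : #(darts G S) + pairs F Z + 2 * (#Z * Fintype.card ι) ≤
      2 * (repl G S Z F ι).edgeSet.ncard := by
  have hdart : ∀ p ∈ darts G S, p.1 ∈ S ∪ Z ∧ p.2 ∈ S ∪ Z := by
    intro p hp
    obtain ⟨hadj, h⟩ := mem_darts.mp hp
    simp only [mem_union, ← hSZ, mem_nb]
    rcases h with h | h
    · exact ⟨Or.inl h, or_iff_not_imp_left.mpr fun h' => ⟨h', _, h, hadj⟩⟩
    · exact ⟨or_iff_not_imp_left.mpr fun h' => ⟨h', _, h, hadj.symm⟩, Or.inl h⟩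
  have hZS : ∀ z ∈ Z, z ∉ S := fun z hz => (mem_nb.mp (hSZ ▸ hz)).1
  have hpair : ∀ p ∈ ({p ∈ Z ×ˢ Z | F.Adj p.1 p.2} : Finset (V × V)),
      p.1 ∈ Z ∧ p.2 ∈ Z ∧ F.Adj p.1 p.2 := by
    intro p hp
    simp only [mem_filter, mem_product] at hp
    exact ⟨hp.1.1, hp.1.2, hp.2⟩
  let f : (darts G S) ⊕ ({p ∈ Z ×ˢ Z | F.Adj p.1 p.2} : Finset (V × V)) ⊕ (Z × ι) ⊕ (Z × ι) →
      (repl G S Z F ι).Dart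
    | .inl p => ⟨(.inl ⟨p.1.1, (hdart _ p.2).1⟩, .inl ⟨p.1.2, (hdart _ p.2).2⟩),
        Or.inl (mem_darts.mp p.2)⟩
    | .inr (.inl p) => ⟨(.inl ⟨p.1.1, mem_union_right _ (hpair _ p.2).1⟩,
        .inl ⟨p.1.2, mem_union_right _ (hpair _ p.2).2.1⟩),
        Or.inr ⟨(hpair _ p.2).2.2, (hpair _ p.2).1, (hpair _ p.2).2.1⟩⟩
    | .inr (.inr (.inl p)) => ⟨(.inl ⟨p.1.1, mem_union_right _ p.1.2⟩, .inr p.2), p.1.2⟩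
    | .inr (.inr (.inr p)) => ⟨(.inr p.2, .inl ⟨p.1.1, mem_union_right _ p.1.2⟩), p.1.2⟩
  have hf : Function.Injective f := by
    have hno : ∀ p ∈ darts G S, ∀ q ∈ ({p ∈ Z ×ˢ Z | F.Adj p.1 p.2} : Finset (V × V)),
        p.1 = q.1 → p.2 ≠ q.2 := by
      intro p hp q hq h1 h2
      rcases (mem_darts.mp hp).2 with h | h
      · exact hZS _ (hpair q hq).1 (h1 ▸ h)
      · exact hZS _ (hpair q hq).2.1 (h2 ▸ h)
    rintro (⟨p, hp⟩ | ⟨p, hp⟩ | ⟨⟨p, hp⟩, i⟩ | ⟨⟨p, hp⟩, i⟩)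
      (⟨q, hq⟩ | ⟨q, hq⟩ | ⟨⟨q, hq⟩, j⟩ | ⟨⟨q, hq⟩, j⟩) heq <;>
      replace heq := congrArg SimpleGraph.Dart.toProd heq <;>
      simp only [f, Prod.mk.injEq, Sum.inl.injEq, Sum.inr.injEq,
        Subtype.mk.injEq, reduceCtorEq, and_false, false_and] at heq
    · simp only [Sum.inl.injEq, Subtype.mk.injEq]
      exact Prod.ext heq.1 heq.2
    · exact absurd heq.2 (hno p hp q hq heq.1)
    · exact absurd heq.2.symm (hno q hq p hp heq.1.symm)
    · simp only [Sum.inl.injEq, Sum.inr.injEq, Subtype.mk.injEq]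
      exact Prod.ext heq.1 heq.2
    · obtain ⟨rfl, rfl⟩ := heq
      rfl
    · obtain ⟨rfl, rfl⟩ := heq
      rfl
  have h1 := Fintype.card_le_of_injective f hf
  rw [SimpleGraph.dart_card_eq_twice_card_edges, ← SimpleGraph.coe_edgeFinset,
    Set.ncard_coe_finset] at *
  simp only [Fintype.card_sum, Fintype.card_coe, Fintype.card_prod] at h1
  rw [pairs]
  omega

namespace Cut4

variable {S T Z : Finset V}

theorem isMinor_repl (h : Cut4 G S T Z) {B : V → Set V} (hB : RootModel G T B)
    {F : SimpleGraph V} (hF : ∀ y ∈ Z, ∀ z ∈ Z, F.Adj y z → Touch G (B y) (B z))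
    {ι : Type} [Subsingleton ι] {X : ι → Set V} (hX : ∀ i, Conn G (X i))
    (hXT : ∀ i, ∀ v ∈ X i, v ∈ T) (hXB : ∀ i, ∀ z ∈ Z, Disjoint (X i) (B z))
    (hXt : ∀ i, ∀ z ∈ Z, Touch G (X i) (B z)) : IsMinor (repl G S Z F ι) G := by
  rw [isMinor_iff]
  have hsub : ∀ z ∈ Z, ∀ v ∈ B z, v ∈ T ∨ v = z := fun z hz => hB.sub z (h.nbT ▸ hz)
  have hroot : ∀ z ∈ Z, z ∈ B z := fun z hz => hB.root z (h.nbT ▸ hz)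
  have hST : ∀ v ∈ S, v ∉ T := fun v hv hv' => Finset.disjoint_left.mp h.disjST hv hv'
  let E : V → Set V := fun v => if v ∈ Z then B v else {v}
  have hEZ : ∀ v ∈ Z, E v = B v := fun v hv => if_pos hv
  have hEself : ∀ v, v ∈ E v := fun v => by
    by_cases hv : v ∈ Z
    · rw [hEZ v hv]; exact hroot v hv
    · simp [E, hv]
  have hES : ∀ v ∈ S, E v = {v} := fun v hv => if_neg (h.notMem_of_memS hv)
  have hmem : ∀ v ∈ S ∪ Z, v ∈ S ∨ v ∈ Z := fun v => mem_union.mp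
  have hBS : ∀ z ∈ Z, ∀ s ∈ S, s ∉ B z := by
    intro z hz s hs hsz
    rcases hsub z hz s hsz with h1 | rfl
    · exact hST s hs h1
    · exact h.notMem_of_mem hz hs
  have hEdisj : ∀ u ∈ S ∪ Z, ∀ v ∈ S ∪ Z, u ≠ v → Disjoint (E u) (E v) := by
    intro u hu v hv huv
    rcases hmem u hu with hu | hu <;> rcases hmem v hv with hv | hv
    · rw [hES u hu, hES v hv]; simpa using huv
    · rw [hES u hu, hEZ v hv]; simpa using hBS v hv u hu
    · rw [hES v hv, hEZ u hu]; simpa using hBS u hu v hv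
    · rw [hEZ u hu, hEZ v hv]; exact hB.disj u (h.nbT ▸ hu) v (h.nbT ▸ hv) huv
  have hXE : ∀ i, ∀ v ∈ S ∪ Z, Disjoint (X i) (E v) := by
    intro i v hv
    rcases hmem v hv with hv | hv
    · rw [hES v hv]
      simpa using fun hvX => hST v hv (hXT i v hvX)
    · rw [hEZ v hv]; exact hXB i v hv
  refine ⟨Sum.elim (fun v => E v.1) X, ?_, ?_, ?_⟩
  · rintro (⟨v, hv⟩ | i)
    · by_cases hvZ : v ∈ Z
      · simpa [hEZ v hvZ] using hB.conn v (h.nbT ▸ hvZ)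
      · simpa [E, hvZ] using conn_singleton G v
    · exact hX i
  · rintro (⟨u, hu⟩ | i) (⟨v, hv⟩ | j) hne
    · exact hEdisj u hu v hv fun h => hne (by subst h; rfl)
    · exact (hXE j u hu).symm
    · exact hXE i v hv
    · exact absurd (congrArg _ (Subsingleton.elim i j)) hne
  · rintro (⟨u, hu⟩ | i) (⟨v, hv⟩ | j) hadj
    · rcases hadj with ⟨hadj, -⟩ | ⟨hadj, hu', hv'⟩
      · exact ⟨u, hEself u, v, hEself v, hadj⟩
      · have := hF u hu' v hv' hadj
        simpa [hEZ u hu', hEZ v hv'] using this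
    · have hu' : u ∈ Z := hadj
      simpa [hEZ u hu'] using (hXt j u hu').symm
    · have hv' : v ∈ Z := hadj
      simpa [hEZ v hv'] using hXt i v hv'
    · exact hadj.elim

theorem replace (h : Cut4 G S T Z) (hG : MinorMinimalEnemy G) {B : V → Set V}
    (hB : RootModel G T B) {F : SimpleGraph V}
    (hF : ∀ y ∈ Z, ∀ z ∈ Z, F.Adj y z → Touch G (B y) (B z))
    {ι : Type} [Fintype ι] [Subsingleton ι] {X : ι → Set V} (hX : ∀ i, Conn G (X i))
    (hXT : ∀ i, ∀ v ∈ X i, v ∈ T) (hXB : ∀ i, ∀ z ∈ Z, Disjoint (X i) (B z))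
    (hXt : ∀ i, ∀ z ∈ Z, Touch G (X i) (B z)) (h4 : IsKConnected 4 (repl G S Z F ι)) :
    #(darts G S) + pairs F Z < 8 * #S + 16 ∨ Nonempty (repl G S Z F ι ≃g K2222) := by
  have hι : Fintype.card ι ≤ 1 := Fintype.card_le_one_iff_subsingleton.mpr inferInstance
  have hcard : Fintype.card ({v // v ∈ S ∪ Z} ⊕ ι) = #S + 4 + Fintype.card ι := by
    rw [Fintype.card_sum, Fintype.card_coe, card_union_of_disjoint, h.card]
    exact Finset.disjoint_left.mpr fun v hv hz => h.notMem_of_mem hz hv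
  have hminor := h.isMinor_repl hB hF hX hXT hXB hXt
  by_contra! hcon
  have he := le_card_edges_repl h.nbS (F := F) (ι := ι)
  have hen : Enemy (repl G S Z F ι) := by
    refine ⟨h4, ?_, fun hm => hG.1.2.2.1 (hm.trans hminor), hcon.2⟩
    have h1 := hcon.1
    rw [h.card] at he
    rw [hcard]
    push_cast
    omega
  obtain ⟨e⟩ := hG.2 _ _ hminor hen
  have h1 := Fintype.card_congr e.toEquiv
  rw [hcard, h.card_eq] at h1
  have := h.leT
  omega

theorem exists_mem_side (h : Cut4 G S T Z) (hG : IsKConnected 4 G) {F : SimpleGraph V}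
    {ι : Type} [Fintype ι] {P Q : Set ({v // v ∈ S ∪ Z} ⊕ ι)} (hP : P.ncard < 4)
    (hQ : ∀ a, a ∉ P → a ∈ Q → ∀ b, b ∉ P → b ∉ Q → ¬ (repl G S Z F ι).Adj a b)
    {a : {v // v ∈ S ∪ Z} ⊕ ι} (haP : a ∉ P) (haQ : a ∈ Q) :
    ∃ v, ∃ hv : v ∈ S ∪ Z, v ∈ Z ∧ .inl ⟨v, hv⟩ ∉ P ∧ .inl ⟨v, hv⟩ ∈ Q := by
  have hcard : ∀ R : Finset V, (∀ v ∈ R, ∃ hv : v ∈ S ∪ Z, .inl ⟨v, hv⟩ ∈ P) → #R ≤ P.ncard := by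
    intro R hR
    have hR1 : ∀ v ∈ R, v ∈ S ∪ Z := fun v hv => (hR v hv).1
    have hR2 : ∀ v (hv : v ∈ R), .inl ⟨v, hR1 v hv⟩ ∈ P := fun v hv => (hR v hv).2
    rw [← Set.ncard_coe_finset]
    refine Set.ncard_le_ncard_of_injOn
      (fun v => if hv : v ∈ S ∪ Z then .inl ⟨v, hv⟩ else a) ?_ ?_ P.toFinite
    · intro v hv
      have h1 := hR1 v hv
      simpa only [dif_pos h1] using hR2 v hv
    · intro u hu v hv huv
      simpa only [dif_pos (hR1 u hu), dif_pos (hR1 v hv), Sum.inl.injEq, Subtype.mk.injEq]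
        using huv
  by_contra! hcon
  obtain ⟨z, hz, hzP⟩ : ∃ z, ∃ hz : z ∈ Z, .inl ⟨z, mem_union_right S hz⟩ ∉ P := by
    by_contra! hall
    have := hcard Z fun v hv => ⟨mem_union_right S hv, hall v hv⟩
    rw [h.card] at this
    omega
  have hzQ := hcon z (mem_union_right S hz) hz hzP
  rcases a with ⟨v, hv⟩ | i
  · have hvS : v ∈ S := by
      rcases mem_union.mp hv with h1 | h1
      · exact h1
      · exact absurd haQ (hcon v hv h1 haP)
    let U : Finset V := {u ∈ S | ∃ hu : u ∈ S ∪ Z, .inl ⟨u, hu⟩ ∉ P ∧ .inl ⟨u, hu⟩ ∈ Q}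
    have h1 := h.four_le hG (U := U) (filter_subset _ _) ⟨v, mem_filter.mpr ⟨hvS, hv, haP, haQ⟩⟩
    have h2 := hcard (nb G U) (by
      intro w hw
      obtain ⟨hwU, u, hu, huw⟩ := mem_nb.mp hw
      obtain ⟨huS, hu, huP, huQ⟩ := mem_filter.mp hu
      have hw := mem_union.mpr (h.mem_or huS huw)
      refine ⟨hw, ?_⟩
      by_contra hwP
      have hwQ : (.inl ⟨w, hw⟩ : {v // v ∈ S ∪ Z} ⊕ ι) ∈ Q := by
        by_contra hwQ
        exact hQ _ huP huQ _ hwP hwQ (Or.inl ⟨huw, Or.inl huS⟩)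
      rcases mem_union.mp hw with hwS | hwZ
      · exact hwU (mem_filter.mpr ⟨hwS, hw, hwP, hwQ⟩)
      · exact hcon w hw hwZ hwP hwQ)
    omega
  · exact hQ _ haP haQ _ hzP hzQ hz

theorem exists_cut (h : Cut4 G S T Z) (hG : IsKConnected 4 G) {F : SimpleGraph V}
    {ι : Type} [Fintype ι] (hcon : ¬ IsKConnected 4 (repl G S Z F ι)) :
    ∃ U U' P : Finset V, (∀ v ∈ S ∪ Z, v ∈ U ∨ v ∈ U' ∨ v ∈ P) ∧
      Disjoint U U' ∧ Disjoint U P ∧ Disjoint U' P ∧ #P + Fintype.card ι ≤ 3 ∧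
      (∀ u ∈ U, ∀ v ∈ U', u ∈ S → ¬ G.Adj u v) ∧ (∀ u ∈ U', ∀ v ∈ U, u ∈ S → ¬ G.Adj u v) ∧
      (∀ u ∈ U, u ∈ Z → ∀ v ∈ U', v ∈ Z → ¬ F.Adj u v) ∧
      (∃ y ∈ U, y ∈ Z) ∧ ∃ z ∈ U', z ∈ Z := by
  let H := repl G S Z F ι
  have hcard : 4 < Fintype.card ({v // v ∈ S ∪ Z} ⊕ ι) := by
    rw [Fintype.card_sum, Fintype.card_coe, card_union_of_disjoint, h.card]
    · have := h.leS
      omega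
    · exact Finset.disjoint_left.mpr fun v hv hz => h.notMem_of_mem hz hv
  obtain ⟨P, hP, hPc⟩ : ∃ P : Set ({v // v ∈ S ∪ Z} ⊕ ι), P.ncard < 4 ∧ ¬ Conn H Pᶜ := by
    by_contra! hall
    exact hcon ⟨hcard, fun P hP => (induce_connected_iff_conn _).mpr (hall P hP)⟩
  have hne : (Pᶜ).Nonempty := by
    rw [Set.nonempty_compl]
    rintro rfl
    rw [Set.ncard_univ, Nat.card_eq_fintype_card] at hP
    omega
  obtain ⟨Q, ⟨a, haP, haQ⟩, ⟨b, hbP, hbQ⟩, hQ⟩ : ∃ Q : Set ({v // v ∈ S ∪ Z} ⊕ ι),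
      (∃ a ∈ Pᶜ, a ∈ Q) ∧ (∃ b ∈ Pᶜ, b ∉ Q) ∧
        ∀ a, a ∉ P → a ∈ Q → ∀ b, b ∉ P → b ∉ Q → ¬ H.Adj a b := by
    by_contra! hall
    refine hPc ⟨hne, fun Q h1 h2 => ?_⟩
    obtain ⟨a, h1, h2, b, h3, h4, h5⟩ := hall Q h1 h2
    exact ⟨a, h1, h2, b, h3, h4, h5⟩
  obtain ⟨y, hy, hyZ, hyP, hyQ⟩ := h.exists_mem_side hG hP hQ haP haQ
  obtain ⟨z, hz, hzZ, hzP, hzQ⟩ := h.exists_mem_side hG (Q := Qᶜ) hP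
    (fun a h1 h2 b h3 h4 h5 => hQ b h3 (not_not.mp h4) a h1 h2 h5.symm) hbP hbQ
  refine ⟨({v | ∃ hv : v ∈ S ∪ Z, .inl ⟨v, hv⟩ ∉ P ∧ .inl ⟨v, hv⟩ ∈ Q} : Finset V),
    ({v | ∃ hv : v ∈ S ∪ Z, .inl ⟨v, hv⟩ ∉ P ∧ .inl ⟨v, hv⟩ ∉ Q} : Finset V),
    ({v | ∃ hv : v ∈ S ∪ Z, .inl ⟨v, hv⟩ ∈ P} : Finset V), ?_, ?_, ?_, ?_, ?_, ?_, ?_, ?_, ?_, ?_⟩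
  · intro v hv
    simp only [mem_filter_univ]
    by_cases h1 : .inl ⟨v, hv⟩ ∈ P
    · exact Or.inr (Or.inr ⟨hv, h1⟩)
    · by_cases h2 : .inl ⟨v, hv⟩ ∈ Q
      · exact Or.inl ⟨hv, h1, h2⟩
      · exact Or.inr (Or.inl ⟨hv, h1, h2⟩)
  · simp only [Finset.disjoint_left, mem_filter_univ]
    rintro v ⟨_, _, h1⟩ ⟨_, _, h2⟩
    exact h2 h1
  · simp only [Finset.disjoint_left, mem_filter_univ]
    rintro v ⟨_, h1, _⟩ ⟨_, h2⟩
    exact h1 h2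
  · simp only [Finset.disjoint_left, mem_filter_univ]
    rintro v ⟨_, h1, _⟩ ⟨_, h2⟩
    exact h1 h2
  · have hιP : ∀ i, .inr i ∈ P := by
      intro i
      by_contra hi
      by_cases hiQ : .inr i ∈ Q
      · exact hQ _ hi hiQ _ hzP hzQ hzZ
      · exact hQ _ hyP hyQ _ hi hiQ hyZ
    let f : {v : V // ∃ hv : v ∈ S ∪ Z, .inl ⟨v, hv⟩ ∈ P} ⊕ ι → P :=
      Sum.elim (fun v => ⟨.inl ⟨v.1, v.2.1⟩, v.2.2⟩) fun i => ⟨.inr i, hιP i⟩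
    have hf : Function.Injective f := by
      rintro (⟨u, hu⟩ | i) (⟨v, hv⟩ | j) huv
      · simpa [f] using huv
      · simp [f] at huv
      · simp [f] at huv
      · simpa [f] using huv
    have h1 := Fintype.card_le_of_injective f hf
    rw [Fintype.card_sum, Fintype.card_subtype, ← Nat.card_eq_fintype_card (α := P),
      Nat.card_coe_set_eq] at h1
    omega
  · simp only [mem_filter_univ]
    rintro u ⟨_, h1, h2⟩ v ⟨_, h3, h4⟩ huS huv
    exact hQ _ h1 h2 _ h3 h4 (Or.inl ⟨huv, Or.inl huS⟩)
  · simp only [mem_filter_univ]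
    rintro u ⟨_, h1, h2⟩ v ⟨_, h3, h4⟩ huS huv
    exact hQ _ h3 h4 _ h1 h2 (Or.inl ⟨huv.symm, Or.inr huS⟩)
  · simp only [mem_filter_univ]
    rintro u ⟨_, h1, h2⟩ hu v ⟨_, h3, h4⟩ hv huv
    exact hQ _ h1 h2 _ h3 h4 (Or.inr ⟨huv, hu, hv⟩)
  · exact ⟨y, mem_filter_univ _ |>.mpr ⟨hy, hyP, hyQ⟩, hyZ⟩
  · exact ⟨z, mem_filter_univ _ |>.mpr ⟨hz, hzP, hzQ⟩, hzZ⟩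

end Cut4

end Replacement

section Bounds

open Finset

theorem card_filter_fst_ne (v : Fin 4 × Fin 2) :
    #{w : Fin 4 × Fin 2 | v.1 ≠ w.1} = 6 := by
  revert v
  decide

theorem K2222_adj {a b : Fin 4 × Fin 2} : K2222.Adj a b ↔ a.1 ≠ b.1 := by
  simp [K2222]

open scoped Classical

variable {V : Type} [Fintype V] {G : SimpleGraph V}

omit [Fintype V] in
theorem even_card_of_swap {D : Finset (V × V)} (h : ∀ p ∈ D, p.swap ∈ D ∧ p.1 ≠ p.2) :
    Even #D := by
  have h1 : ∑ p ∈ D, (1 : ZMod 2) = 0 :=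
    sum_involution (fun p _ => p.swap) (fun _ _ => by decide)
      (fun p hp _ heq => (h p hp).2 (congrArg Prod.snd heq)) (fun p hp => (h p hp).1)
      fun p _ => Prod.swap_swap p
  rw [sum_const, nsmul_one] at h1
  exact (ZMod.natCast_eq_zero_iff_even).mp h1

theorem even_card_darts (G : SimpleGraph V) (S : Finset V) : Even #(darts G S) :=
  even_card_of_swap fun p hp => by
    obtain ⟨h1, h2⟩ := mem_darts.mp hp
    exact ⟨mem_darts.mpr ⟨h1.symm, h2.symm⟩, h1.ne⟩

omit [Fintype V] in
theorem mem_pairs_iff {F : SimpleGraph V} {Z : Finset V} {p : V × V} :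
    p ∈ ({p ∈ Z ×ˢ Z | F.Adj p.1 p.2} : Finset (V × V)) ↔ p.1 ∈ Z ∧ p.2 ∈ Z ∧ F.Adj p.1 p.2 := by
  simp only [mem_filter, mem_product, and_assoc]

omit [Fintype V] in
theorem even_pairs (F : SimpleGraph V) (Z : Finset V) : Even (pairs F Z) :=
  even_card_of_swap fun p hp => by
    obtain ⟨h1, h2, h3⟩ := mem_pairs_iff.mp hp
    exact ⟨mem_pairs_iff.mpr ⟨h2, h1, h3.symm⟩, h3.ne⟩

/-- The ordered pairs of distinct elements of `Z` that are not adjacent. -/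
noncomputable def missing (F : SimpleGraph V) (Z : Finset V) : Finset (V × V) :=
  {p ∈ Z.offDiag | ¬ F.Adj p.1 p.2}

omit [Fintype V] in
theorem mem_missing {F : SimpleGraph V} {Z : Finset V} {p : V × V} :
    p ∈ missing F Z ↔ p.1 ∈ Z ∧ p.2 ∈ Z ∧ p.1 ≠ p.2 ∧ ¬ F.Adj p.1 p.2 := by
  simp only [missing, mem_filter, mem_offDiag, and_assoc]

omit [Fintype V] in
theorem pairs_add_missing (F : SimpleGraph V) {Z : Finset V} (hZ : #Z = 4) :
    pairs F Z + #(missing F Z) = 12 := by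
  have h1 := card_filter_add_card_filter_not (s := Z.offDiag) fun p => F.Adj p.1 p.2
  rw [offDiag_card, hZ] at h1
  have h2 : ({p ∈ Z ×ˢ Z | F.Adj p.1 p.2} : Finset (V × V)) = {p ∈ Z.offDiag | F.Adj p.1 p.2} := by
    ext p
    rw [mem_pairs_iff, mem_filter, mem_offDiag]
    exact ⟨fun h => ⟨⟨h.1, h.2.1, h.2.2.ne⟩, h.2.2⟩, fun h => ⟨h.1.1, h.1.2.1, h.2⟩⟩
  rw [pairs, h2]
  exact h1

/-- All pairs of distinct elements of `Z`, except perhaps `b, c`, are adjacent in `F`. -/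
def AdjExcept (F : SimpleGraph V) (Z : Finset V) (b c : V) : Prop :=
  ∀ p ∈ Z, ∀ q ∈ Z, p ≠ q → ¬ (p = b ∧ q = c) → ¬ (p = c ∧ q = b) → F.Adj p q

omit [Fintype V] in
theorem ten_le_pairs {F : SimpleGraph V} {Z : Finset V} (hZ : #Z = 4) {b c : V}
    (h : AdjExcept F Z b c) : 10 ≤ pairs F Z := by
  have h1 : missing F Z ⊆ {(b, c), (c, b)} := by
    intro p hp
    obtain ⟨h1, h2, h3, h4⟩ := mem_missing.mp hp
    by_contra hcon
    simp only [mem_insert, mem_singleton, Prod.ext_iff, not_or] at hcon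
    exact h4 (h _ h1 _ h2 h3 hcon.1 hcon.2)
  have h2 := (card_le_card h1).trans card_le_two
  have := pairs_add_missing F hZ
  omega

omit [Fintype V] in
theorem exists_adjExcept {F : SimpleGraph V} {Z : Finset V} (hZ : #Z = 4) (h : 10 ≤ pairs F Z) :
    ∃ b ∈ Z, ∃ c ∈ Z, b ≠ c ∧ AdjExcept F Z b c := by
  have h1 := pairs_add_missing F hZ
  rcases (missing F Z).eq_empty_or_nonempty with h0 | ⟨⟨b, c⟩, hp⟩
  · obtain ⟨b, hb, c, hc, hbc⟩ := one_lt_card.mp (by omega : 1 < #Z)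
    refine ⟨b, hb, c, hc, hbc, fun p hp q hq hpq _ _ => ?_⟩
    by_contra hcon
    exact notMem_empty _ (h0 ▸ mem_missing.mpr ⟨hp, hq, hpq, hcon⟩ : (p, q) ∈ (∅ : Finset (V × V)))
  · obtain ⟨hb, hc, hbc, hadj⟩ := mem_missing.mp hp
    refine ⟨b, hb, c, hc, hbc, fun p hp' q hq hpq h2 h3 => ?_⟩
    by_contra hcon
    have h4 : ({(b, c), (c, b), (p, q)} : Finset (V × V)) ⊆ missing F Z := by
      simp only [insert_subset_iff, singleton_subset_iff]
      exact ⟨hp, mem_missing.mpr ⟨hc, hb, hbc.symm, fun h => hadj h.symm⟩,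
        mem_missing.mpr ⟨hp', hq, hpq, hcon⟩⟩
    have h5 : #({(b, c), (c, b), (p, q)} : Finset (V × V)) = 3 := by
      rw [card_eq_three]
      refine ⟨_, _, _, ?_, ?_, ?_, rfl⟩
      · exact fun h => hbc (congrArg Prod.fst h)
      · exact fun h => h2 ⟨(congrArg Prod.fst h).symm, (congrArg Prod.snd h).symm⟩
      · exact fun h => h3 ⟨(congrArg Prod.fst h).symm, (congrArg Prod.snd h).symm⟩
    have := card_le_card h4
    omega

theorem K2222_eq_of_not_adj {a b c : Fin 4 × Fin 2} (hb : ¬ K2222.Adj a b) (hc : ¬ K2222.Adj a c)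
    (hab : b ≠ a) (hac : c ≠ a) : b = c := by
  rw [K2222_adj, not_not] at hb hc
  have h1 : b.2 ≠ a.2 := fun h => hab (Prod.ext hb.symm h)
  have h2 : c.2 ≠ a.2 := fun h => hac (Prod.ext hc.symm h)
  exact Prod.ext (hb.symm.trans hc) (by omega)

theorem K2222_exists (a : Fin 4 × Fin 2) : ∃ b, b ≠ a ∧ ¬ K2222.Adj a b := by
  refine ⟨(a.1, a.2 + 1), fun h => ?_, fun h => K2222_adj.mp h rfl⟩
  have := congrArg Prod.snd h
  simp only at this
  omega

namespace Cut4

variable {S T Z : Finset V}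

theorem card_of_iso (h : Cut4 G S T Z) {F : SimpleGraph V} {ι : Type} [Fintype ι]
    (e : repl G S Z F ι ≃g K2222) : #S + Fintype.card ι = 4 ∧
      #(darts G S) + pairs F Z + 8 * Fintype.card ι ≤ 48 := by
  have h1 := Fintype.card_congr e.toEquiv
  rw [Fintype.card_sum, Fintype.card_coe, card_union_of_disjoint, h.card, Fintype.card_prod,
    Fintype.card_fin, Fintype.card_fin] at h1
  · have h2 := le_card_edges_repl h.nbS (F := F) (ι := ι)
    have h3 : (repl G S Z F ι).edgeSet.ncard = 24 := by
      rw [← Nat.card_coe_set_eq, Nat.card_congr e.mapEdgeSet]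
      have h4 : K2222.edgeFinset.card = 24 := by
        have h5 := K2222.sum_degrees_eq_twice_card_edges
        have h6 : ∀ v, K2222.degree v = 6 := by
          intro v
          rw [← K2222.card_neighborFinset_eq_degree, ← card_filter_fst_ne v]
          congr 1
          ext w
          simp [K2222_adj]
        simp only [h6, sum_const, card_univ, Fintype.card_prod, Fintype.card_fin] at h5
        simp only [smul_eq_mul] at h5
        omega
      rw [Nat.card_eq_fintype_card, ← SimpleGraph.edgeFinset_card, h4]
    rw [h3, h.card] at h2
    omega
  · exact Finset.disjoint_left.mpr fun v hv hz => h.notMem_of_mem hz hv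

theorem isEmpty_of_iso (h : Cut4 G S T Z) {F : SimpleGraph V} {ι : Type}
    (e : repl G S Z F ι ≃g K2222) : IsEmpty ι := by
  refine ⟨fun i => ?_⟩
  obtain ⟨u, hu, v, hv, huv⟩ := one_lt_card.mp h.leS
  have hn : ∀ x (hx : x ∈ S),
      ¬ K2222.Adj (e (.inr i)) (e (.inl ⟨x, mem_union_left Z hx⟩)) := by
    intro x hx hadj
    rw [e.map_adj_iff] at hadj
    exact h.notMem_of_memS hx hadj
  have := K2222_eq_of_not_adj (hn u hu) (hn v hv) (e.injective.ne (by simp))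
    (e.injective.ne (by simp))
  simpa [huv] using e.injective this

theorem exists_split_aux (h : Cut4 G S T Z) (hG : IsKConnected 4 G) {F : SimpleGraph V} {b c : V}
    (hb : b ∈ Z) (hc : c ∈ Z) (hbc : b ≠ c) (hF : AdjExcept F Z b c) {n : ℕ}
    {U U' P : Finset V} (hcov : ∀ v ∈ S ∪ Z, v ∈ U ∨ v ∈ U' ∨ v ∈ P)
    (hUU : Disjoint U U') (hUP : Disjoint U P) (hUP' : Disjoint U' P) (hP : #P + n ≤ 3)
    (h1 : ∀ u ∈ U, ∀ v ∈ U', u ∈ S → ¬ G.Adj u v) (h2 : ∀ u ∈ U', ∀ v ∈ U, u ∈ S → ¬ G.Adj u v)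
    (h3 : ∀ u ∈ U, u ∈ Z → ∀ v ∈ U', v ∈ Z → ¬ F.Adj u v) (hbU : b ∈ U) (hcU : c ∈ U') :
    n = 0 ∧ ∃ w ∈ S, ∃ R R' : Finset V, Disjoint R R' ∧ w ∉ R ∧ w ∉ R' ∧
      S = insert w (R ∪ R') ∧ nb G R ⊆ insert w (Z.erase c) ∧ nb G R' ⊆ insert w (Z.erase b) := by
  have hbU' : ∀ y ∈ U, y ∈ Z → y = b := by
    intro y hy hyZ
    by_contra hyb
    have hyc : y ≠ c := fun h => Finset.disjoint_left.mp hUU hy (h ▸ hcU)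
    exact h3 y hy hyZ c hcU hc (hF y hyZ c hc hyc (fun h => hyb h.1) fun h => hyc h.1)
  have hcU' : ∀ y ∈ U', y ∈ Z → y = c := by
    intro y hy hyZ
    by_contra hyc
    have hyb : b ≠ y := fun h => Finset.disjoint_left.mp hUU hbU (h ▸ hy)
    exact h3 b hbU hb y hy hyZ (hF b hb y hyZ hyb (fun h => hyc h.2) fun h => hbc h.1)
  have hZP : (Z.erase b).erase c ⊆ P := by
    intro z hz
    simp only [mem_erase] at hz
    rcases hcov z (mem_union_right S hz.2.2) with h | h | h
    · exact absurd (hbU' z h hz.2.2) hz.2.1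
    · exact absurd (hcU' z h hz.2.2) hz.1
    · exact h
  have hZc : #((Z.erase b).erase c) = 2 := by
    rw [card_erase_of_mem (mem_erase.mpr ⟨hbc.symm, hc⟩), card_erase_of_mem hb, h.card]
  have hnb : nb G {v ∈ S | v ∈ U} ⊆ insert b P := by
    intro v hv
    obtain ⟨hvU, u, hu, huv⟩ := mem_nb.mp hv
    obtain ⟨huS, huU⟩ := mem_filter.mp hu
    have hvSZ := h.mem_or huS huv
    rw [mem_insert]
    rcases hcov v (mem_union.mpr hvSZ) with h4 | h4 | h4
    · rcases hvSZ with h5 | h5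
      · exact absurd (mem_filter.mpr ⟨h5, h4⟩) hvU
      · exact Or.inl (hbU' v h4 h5)
    · exact absurd huv (h1 u huU v h4 huS)
    · exact Or.inr h4
  have hnb' : nb G {v ∈ S | v ∈ U'} ⊆ insert c P := by
    intro v hv
    obtain ⟨hvU, u, hu, huv⟩ := mem_nb.mp hv
    obtain ⟨huS, huU⟩ := mem_filter.mp hu
    have hvSZ := h.mem_or huS huv
    rw [mem_insert]
    rcases hcov v (mem_union.mpr hvSZ) with h4 | h4 | h4
    · exact absurd huv (h2 u huU v h4 huS)
    · rcases hvSZ with h5 | h5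
      · exact absurd (mem_filter.mpr ⟨h5, h4⟩) hvU
      · exact Or.inl (hcU' v h4 h5)
    · exact Or.inr h4
  have hex : ∃ w ∈ S, w ∈ P := by
    by_contra! hcon
    have hP2 : P ⊆ (Z.erase b).erase c ∪ P.filter (· ∉ S ∪ Z) := by
      intro v hv
      by_cases hvZ : v ∈ Z
      · refine mem_union_left _ (mem_erase.mpr ⟨?_, mem_erase.mpr ⟨?_, hvZ⟩⟩)
        · rintro rfl; exact Finset.disjoint_left.mp hUP' hcU hv
        · rintro rfl; exact Finset.disjoint_left.mp hUP hbU hv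
      · exact mem_union_right _ (mem_filter.mpr ⟨hv, fun h =>
          (mem_union.mp h).elim (fun h => hcon v h hv) hvZ⟩)
    have key : ∀ (R : Finset V) (x : V), R ⊆ S → nb G R ⊆ insert x P → R = ∅ := by
      intro R x hR hRP
      rw [← not_nonempty_iff_eq_empty]
      intro hne
      have h4 := h.four_le hG hR hne
      have h5 : nb G R ⊆ insert x ((Z.erase b).erase c) := by
        intro v hv
        rcases mem_insert.mp (hRP hv) with rfl | h6
        · exact mem_insert_self _ _
        · rcases mem_union.mp (hP2 h6) with h7 | h7
          · exact mem_insert_of_mem h7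
          · obtain ⟨-, u, hu, huv⟩ := mem_nb.mp hv
            exact absurd (mem_union.mpr (h.mem_or (hR hu) huv)) (mem_filter.mp h7).2
      have h6 := (card_le_card h5).trans (card_insert_le _ _)
      omega
    have e1 := key _ _ (filter_subset _ _) hnb
    have e2 := key _ _ (filter_subset _ _) hnb'
    obtain ⟨s, hs⟩ : S.Nonempty := card_pos.mp (by have := h.leS; omega)
    rcases hcov s (mem_union_left Z hs) with h4 | h4 | h4
    · exact notMem_empty s (e1 ▸ mem_filter.mpr ⟨hs, h4⟩)
    · exact notMem_empty s (e2 ▸ mem_filter.mpr ⟨hs, h4⟩)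
    · exact hcon s hs h4
  obtain ⟨w, hwS, hwP⟩ := hex
  have hwZ : w ∉ (Z.erase b).erase c := fun hw =>
    h.notMem_of_memS hwS (mem_of_mem_erase (mem_of_mem_erase hw))
  have hsub : insert w ((Z.erase b).erase c) ⊆ P := insert_subset hwP hZP
  have hc3 := card_insert_of_notMem hwZ
  have hPeq := eq_of_subset_of_card_le hsub (by omega)
  have hle := card_le_card hsub
  refine ⟨by omega, w, hwS, {v ∈ S | v ∈ U}, {v ∈ S | v ∈ U'}, ?_, ?_, ?_, ?_, ?_, ?_⟩
  · exact Finset.disjoint_left.mpr fun v h4 h5 =>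
      Finset.disjoint_left.mp hUU (mem_filter.mp h4).2 (mem_filter.mp h5).2
  · exact fun hw => Finset.disjoint_left.mp hUP (mem_filter.mp hw).2 hwP
  · exact fun hw => Finset.disjoint_left.mp hUP' (mem_filter.mp hw).2 hwP
  · ext v
    simp only [mem_insert, mem_union, mem_filter]
    constructor
    · intro hv
      rcases hcov v (mem_union_left Z hv) with h4 | h4 | h4
      · exact Or.inr (Or.inl ⟨hv, h4⟩)
      · exact Or.inr (Or.inr ⟨hv, h4⟩)
      · rw [← hPeq, mem_insert] at h4
        rcases h4 with h4 | h4
        · exact Or.inl h4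
        · exact absurd (mem_of_mem_erase (mem_of_mem_erase h4)) (h.notMem_of_memS hv)
    · rintro (rfl | h4 | h4)
      · exact hwS
      · exact h4.1
      · exact h4.1
  · intro v hv
    have h4 := hnb hv
    rw [← hPeq] at h4
    simp only [mem_insert, mem_erase] at h4 ⊢
    rcases h4 with rfl | rfl | h4
    · exact Or.inr ⟨hbc, hb⟩
    · exact Or.inl rfl
    · exact Or.inr ⟨h4.1, h4.2.2⟩
  · intro v hv
    have h4 := hnb' hv
    rw [← hPeq] at h4
    simp only [mem_insert, mem_erase] at h4 ⊢
    rcases h4 with rfl | rfl | h4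
    · exact Or.inr ⟨hbc.symm, hc⟩
    · exact Or.inl rfl
    · exact Or.inr h4.2

theorem exists_split (h : Cut4 G S T Z) (hG : IsKConnected 4 G) {F : SimpleGraph V} {b c : V}
    (hb : b ∈ Z) (hc : c ∈ Z) (hbc : b ≠ c) (hF : AdjExcept F Z b c) {ι : Type} [Fintype ι]
    (hcon : ¬ IsKConnected 4 (repl G S Z F ι)) :
    Fintype.card ι = 0 ∧ ∃ w ∈ S, ∃ R R' : Finset V, Disjoint R R' ∧ w ∉ R ∧ w ∉ R' ∧
      S = insert w (R ∪ R') ∧ nb G R ⊆ insert w (Z.erase c) ∧ nb G R' ⊆ insert w (Z.erase b) := by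
  obtain ⟨U, U', P, hcov, hUU, hUP, hUP', hP, h1, h2, h3, ⟨y, hy, hyZ⟩, z, hz, hzZ⟩ :=
    h.exists_cut hG hcon
  have hyz : y ≠ z := fun h => Finset.disjoint_left.mp hUU hy (h ▸ hz)
  by_cases h4 : y = b ∧ z = c
  · obtain ⟨rfl, rfl⟩ := h4
    exact h.exists_split_aux hG hb hc hbc hF hcov hUU hUP hUP' hP h1 h2 h3 hy hz
  by_cases h5 : y = c ∧ z = b
  · obtain ⟨rfl, rfl⟩ := h5
    exact h.exists_split_aux hG hb hc hbc hF (fun v hv => by have := hcov v hv; tauto) hUU.symm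
      hUP' hUP hP h2 h1 (fun u hu huZ v hv hvZ huv => h3 v hv hvZ u hu huZ huv.symm) hz hy
  exact absurd (hF y hyZ z hzZ hyz h4 h5) (h3 y hy hyZ z hz hzZ)

end Cut4

end Bounds

section RootedCliques

open Finset
open scoped Classical

variable {V : Type} [Fintype V] {G : SimpleGraph V}

/-- Pairwise touching bags rooted at the neighbours of `S`. -/
structure CliqueModel (G : SimpleGraph V) (S : Finset V) (B : V → Set V) : Prop
    extends RootModel G S B where
  touch : ∀ y ∈ nb G S, ∀ z ∈ nb G S, y ≠ z → Touch G (B y) (B z)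

/-- Pairwise touching bags rooted at the neighbours of `S`, and a further bag inside `S` touching
all of them. -/
structure ConeModel (G : SimpleGraph V) (S : Finset V) (B : V → Set V) (X : Set V) : Prop
    extends CliqueModel G S B where
  connX : Conn G X
  subX : ∀ v ∈ X, v ∈ S
  disjX : ∀ y ∈ nb G S, Disjoint X (B y)
  touchX : ∀ y ∈ nb G S, Touch G X (B y)

theorem KModel.absorb {S : Finset V} {B : V → Set V} {C₀ C₁ : Set V} (h : KModel G S B C₀ C₁)
    {v : V} (hv : v ∈ nb G S) : ∃ D, RootModel G S D ∧ (∀ y ∈ nb G S, Disjoint C₁ (D y)) ∧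
      (∀ y ∈ nb G S, Touch G C₁ (D y)) ∧ ∀ y ∈ nb G S, y ≠ v → Touch G (D v) (D y) := by
  let D : V → Set V := fun y => if y = v then B v ∪ C₀ else B y
  have hDv : D v = B v ∪ C₀ := if_pos rfl
  have hD : ∀ y, y ≠ v → D y = B y := fun y hy => if_neg hy
  have hC₀ : ∀ y ∈ nb G S, y ≠ v → Disjoint (B v ∪ C₀) (B y) := fun y hy hne =>
    Set.disjoint_union_left.mpr ⟨h.disj v hv y hy hne.symm, h.disj₀ y hy⟩
  refine ⟨D, ⟨fun y hy => ?_, fun y hy => ?_, fun y hy => ?_, fun y hy z hz hne => ?_⟩,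
    fun y hy => ?_, fun y hy => ?_, fun y hy hne => ?_⟩
  · by_cases hyv : y = v
    · rw [hyv, hDv]; exact (h.conn v hv).union h.conn₀ (h.touch₀ v hv).symm
    · rw [hD y hyv]; exact h.conn y hy
  · by_cases hyv : y = v
    · rw [hyv, hDv]; exact Or.inl (h.root v hv)
    · rw [hD y hyv]; exact h.root y hy
  · by_cases hyv : y = v
    · rw [hyv, hDv]
      rintro x (hx | hx)
      · exact h.sub v hv x hx
      · exact Or.inl (h.sub₀ x hx)
    · rw [hD y hyv]; exact h.sub y hy
  · by_cases hyv : y = v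
    · rw [hyv, hDv, hD z fun hz => hne (hyv.trans hz.symm)]
      exact hC₀ z hz fun hz => hne (hyv.trans hz.symm)
    · by_cases hzv : z = v
      · rw [hzv, hDv, hD y hyv]; exact (hC₀ y hy hyv).symm
      · rw [hD y hyv, hD z hzv]; exact h.disj y hy z hz hne
  · by_cases hyv : y = v
    · rw [hyv, hDv]; exact Set.disjoint_union_right.mpr ⟨h.disj₁ v hv, h.disj₀₁.symm⟩
    · rw [hD y hyv]; exact h.disj₁ y hy
  · by_cases hyv : y = v
    · rw [hyv, hDv]; exact (h.touch₁ v hv).mono le_rfl Set.subset_union_left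
    · rw [hD y hyv]; exact h.touch₁ y hy
  · rw [hDv, hD y hne]; exact (h.touch₀ y hy).mono Set.subset_union_right le_rfl

theorem RootModel.touch_of_adj {S : Finset V} {B : V → Set V} (h : RootModel G S B) {y z : V}
    (hy : y ∈ nb G S) (hz : z ∈ nb G S) (hyz : G.Adj y z) : Touch G (B y) (B z) :=
  ⟨y, h.root y hy, z, h.root z hz, hyz⟩

theorem HasK.exists_cone {S : Finset V} (h : HasK G S) {v : V} (hv : v ∈ nb G S)
    (hadj : ∀ y ∈ nb G S, ∀ z ∈ nb G S, y ≠ z → y ≠ v → z ≠ v → G.Adj y z) :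
    ∃ B X, ConeModel G S B X := by
  obtain ⟨B, C₀, C₁, hB⟩ := h
  obtain ⟨D, hD, h1, h2, h3⟩ := hB.absorb hv
  refine ⟨D, C₁, ⟨⟨hD, fun y hy z hz hne => ?_⟩, hB.conn₁, hB.sub₁, h1, h2⟩⟩
  by_cases hyv : y = v
  · rw [hyv]; exact h3 z hz fun hz => hne (hyv.trans hz.symm)
  · by_cases hzv : z = v
    · rw [hzv]; exact (h3 y hy hyv).symm
    · exact hD.touch_of_adj hy hz (hadj y hy z hz hne hyv hzv)

theorem HasK.exists_cliqueModel {S : Finset V} (h : HasK G S) (h4 : #(nb G S) = 4) {p q : V}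
    (hp : p ∈ nb G S) (hq : q ∈ nb G S) (hpq : G.Adj p q) : ∃ B, CliqueModel G S B := by
  obtain ⟨B, C₀, C₁, hB⟩ := h
  have hc : #(((nb G S).erase p).erase q) = 2 := by
    rw [card_erase_of_mem (mem_erase.mpr ⟨hpq.ne', hq⟩), card_erase_of_mem hp, h4]
  obtain ⟨a, b, hab, heq⟩ := card_eq_two.mp hc
  have hmem : ∀ y ∈ nb G S, y = p ∨ y = q ∨ y = a ∨ y = b := by
    intro y hy
    by_contra! hcon
    have : y ∈ ((nb G S).erase p).erase q := mem_erase.mpr ⟨hcon.2.1, mem_erase.mpr ⟨hcon.1, hy⟩⟩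
    rw [heq, mem_insert, mem_singleton] at this
    exact this.elim hcon.2.2.1 hcon.2.2.2
  have ha : a ∈ nb G S := mem_of_mem_erase (mem_of_mem_erase (heq ▸ mem_insert_self a {b}))
  have hb : b ∈ nb G S := mem_of_mem_erase (mem_of_mem_erase (by
    rw [heq]; exact mem_insert_of_mem (mem_singleton_self b)))
  obtain ⟨D, hD, ht⟩ := hB.exists_two_star ha hb hab
  refine ⟨D, hD, fun y hy z hz hne => ?_⟩
  by_cases h1 : y = a ∨ y = b ∨ z = a ∨ z = b
  · exact ht y hy z hz hne h1
  · simp only [not_or] at h1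
    have hadj : G.Adj y z := by
      rcases hmem y hy with rfl | rfl | h2 | h2
      · rcases hmem z hz with rfl | rfl | h3 | h3
        · exact absurd rfl hne
        · exact hpq
        · exact absurd h3 h1.2.2.1
        · exact absurd h3 h1.2.2.2
      · rcases hmem z hz with rfl | rfl | h3 | h3
        · exact hpq.symm
        · exact absurd rfl hne
        · exact absurd h3 h1.2.2.1
        · exact absurd h3 h1.2.2.2
      · exact absurd h2 h1.1
      · exact absurd h2 h1.2.1
    exact hD.touch_of_adj hy hz hadj

namespace Cut4

variable {S T Z : Finset V}

theorem hasK (h : Cut4 G S T Z) (hG : IsKConnected 4 G) (hS : 8 * #S < #(darts G S)) :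
    HasK G S := by
  refine Massed.hasK ⟨hS, fun R hR hlt => ?_⟩ (by rw [h.nbS, h.card])
  rcases R.eq_empty_or_nonempty with rfl | hne
  · simp [darts]
  · have := h.four_le hG hR hne
    rw [h.nbS, h.card] at hlt
    omega

theorem exists_conn (h : Cut4 G S T Z) (hG : IsKConnected 4 G) :
    ∃ X : Set V, Conn G X ∧ (∀ v ∈ X, v ∈ T) ∧ ∀ z ∈ Z, ∃ x ∈ X, G.Adj x z := by
  let 𝒞 : Finset (Finset V) :=
    {C ∈ T.powerset | C.Nonempty ∧ ∀ u ∈ C, ∀ v ∈ T, G.Adj u v → v ∈ C}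
  have hT : T ∈ 𝒞 := mem_filter.mpr
    ⟨mem_powerset_self T, card_pos.mp (by have := h.leT; omega), fun _ _ v hv _ => hv⟩
  obtain ⟨C, hC, hmin⟩ := exists_min_image 𝒞 Finset.card ⟨T, hT⟩
  obtain ⟨hCT, hne, hcl⟩ := mem_filter.mp hC
  rw [mem_powerset] at hCT
  refine ⟨C, ⟨hne, fun Q ⟨a, ha, haQ⟩ ⟨b, hb, hbQ⟩ => ?_⟩, fun v hv => hCT hv, ?_⟩
  · by_contra! hcon
    have hlt : #(C.filter (· ∈ Q)) < #C :=
      card_lt_card ((filter_ssubset).mpr ⟨b, hb, hbQ⟩)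
    refine absurd (hmin (C.filter (· ∈ Q)) ?_) (not_le.mpr hlt)
    refine mem_filter.mpr ⟨mem_powerset.mpr ((filter_subset _ _).trans hCT),
      ⟨a, mem_filter.mpr ⟨ha, haQ⟩⟩, fun u hu v hv huv => ?_⟩
    obtain ⟨huC, huQ⟩ := mem_filter.mp hu
    have hvC := hcl u huC v hv huv
    refine mem_filter.mpr ⟨hvC, ?_⟩
    by_contra hvQ
    exact hcon u huC huQ v hvC hvQ huv
  · have hsub : nb G C ⊆ Z := by
      intro v hv
      obtain ⟨hvC, u, hu, huv⟩ := mem_nb.mp hv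
      exact (h.symm.mem_or (hCT hu) huv).resolve_left fun hvT => hvC (hcl u hu v hvT huv)
    have heq := eq_of_subset_of_card_le hsub (h.card ▸ h.symm.four_le hG hCT hne)
    intro z hz
    exact (mem_nb.mp (heq ▸ hz)).2

omit [Fintype V] in
theorem _root_.pairs_top {Z : Finset V} (hZ : #Z = 4) : pairs (⊤ : SimpleGraph V) Z = 12 := by
  have h1 := pairs_add_missing (⊤ : SimpleGraph V) hZ
  have h2 : missing (⊤ : SimpleGraph V) Z = ∅ := by
    rw [eq_empty_iff_forall_notMem]
    intro p hp
    obtain ⟨-, -, h3, h4⟩ := mem_missing.mp hp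
    exact h4 h3
  rw [h2, card_empty] at h1
  exact h1

theorem isKConnected_repl_top (h : Cut4 G S T Z) (hG : IsKConnected 4 G) {ι : Type} [Fintype ι] :
    IsKConnected 4 (repl G S Z ⊤ ι) := by
  by_contra hcon
  obtain ⟨U, U', P, -, hUU, -, -, -, -, -, h3, ⟨y, hy, hyZ⟩, z, hz, hzZ⟩ := h.exists_cut hG hcon
  exact h3 y hy hyZ z hz hzZ fun heq => Finset.disjoint_left.mp hUU hy (heq ▸ hz)

theorem card_darts_le_of_clique (h : Cut4 G S T Z) (hG : MinorMinimalEnemy G)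
    (hT : ∃ B, CliqueModel G T B) :
    #(darts G S) ≤ 8 * #S + 2 ∨ Nonempty (repl G S Z ⊤ Empty ≃g K2222) := by
  obtain ⟨B, hB⟩ := hT
  have h1 := h.replace hG hB.toRootModel (F := ⊤) (ι := Empty) (X := fun i => i.elim)
    (fun y hy z hz hyz => hB.touch y (h.nbT ▸ hy) z (h.nbT ▸ hz) hyz)
    (fun i => i.elim) (fun i => i.elim) (fun i => i.elim) (fun i => i.elim)
    (h.isKConnected_repl_top hG.1.1)
  refine h1.imp_left fun h2 => ?_
  rw [pairs_top h.card] at h2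
  obtain ⟨k, hk⟩ := even_card_darts G S
  omega

theorem card_darts_le_four (h : Cut4 G S T Z) (hG : MinorMinimalEnemy G)
    (hT : ∃ B, CliqueModel G T B) : #(darts G S) ≤ 8 * #S + 4 := by
  rcases h.card_darts_le_of_clique hG hT with h1 | ⟨⟨e⟩⟩
  · omega
  · have h2 := h.card_of_iso e
    rw [pairs_top h.card, Fintype.card_empty] at h2
    omega

theorem card_darts_le_two (h : Cut4 G S T Z) (hG : MinorMinimalEnemy G)
    (hT : ∃ B X, ConeModel G T B X) : #(darts G S) ≤ 8 * #S + 2 := by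
  obtain ⟨B, X, hB⟩ := hT
  rcases h.replace hG hB.toRootModel (F := ⊤) (ι := Unit) (X := fun _ => X)
    (fun y hy z hz hyz => hB.touch y (h.nbT ▸ hy) z (h.nbT ▸ hz) hyz)
    (fun _ => hB.connX) (fun _ => hB.subX) (fun _ z hz => hB.disjX z (h.nbT ▸ hz))
    (fun _ z hz => hB.touchX z (h.nbT ▸ hz)) (h.isKConnected_repl_top hG.1.1) with h2 | ⟨⟨e⟩⟩
  · rw [pairs_top h.card] at h2
    obtain ⟨k, hk⟩ := even_card_darts G S
    omega
  · exact ((h.isEmpty_of_iso e).false ()).elim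

theorem card_darts_add_pairs_le (h : Cut4 G S T Z) (hG : MinorMinimalEnemy G)
    (hp : 10 ≤ pairs G Z) : #(darts G S) + pairs G Z ≤ 8 * #S + 14 := by
  obtain ⟨X, hX, hXT, hXZ⟩ := h.exists_conn hG.1.1
  obtain ⟨b, hb, c, hc, hbc, hF⟩ := exists_adjExcept h.card hp
  have hconn : IsKConnected 4 (repl G S Z G Unit) := by
    by_contra hcon
    have := (h.exists_split hG.1.1 hb hc hbc hF hcon).1
    simp at this
  have hB : RootModel G T fun z => {z} := by
    refine ⟨fun y _ => conn_singleton G y, fun y _ => rfl, fun y _ v hv => Or.inr hv,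
      fun y _ z _ hne => ?_⟩
    simpa using hne
  rcases h.replace hG hB (F := G) (ι := Unit) (X := fun _ => X)
    (fun y _ z _ hyz => ⟨y, rfl, z, rfl, hyz⟩)
    (fun _ => hX) (fun _ => hXT)
    (fun _ z hz => by simpa using fun hzX => h.symm.notMem_of_mem hz (hXT z hzX))
    (fun _ z hz => by
      obtain ⟨x, hx, hxz⟩ := hXZ z hz
      exact ⟨x, hx, z, rfl, hxz⟩) hconn with h2 | ⟨⟨e⟩⟩
  · obtain ⟨k, hk⟩ := even_card_darts G S
    obtain ⟨l, hl⟩ := even_pairs G Z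
    omega
  · exact ((h.isEmpty_of_iso e).false ()).elim

end Cut4

end RootedCliques

section Forks

open Finset
open scoped Classical

variable {V : Type} [Fintype V] {G : SimpleGraph V}

/-- Two four-cuts nested in the side `S` of a four-cut: both contain `w ∈ S`, one misses `c ∈ Z`
and the other misses `b ∈ Z`. -/
structure Fork (G : SimpleGraph V) (S T Z R R' Q Q' : Finset V) (w b c : V) : Prop where
  cut : Cut4 G S T Z
  memw : w ∈ S
  subR : R ⊆ S
  subR' : R' ⊆ S
  disj : Disjoint R R'
  memb : b ∈ Z
  memc : c ∈ Z
  ne : b ≠ c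
  cutR : Cut4 G R Q (insert w (Z.erase c))
  cutR' : Cut4 G R' Q' (insert w (Z.erase b))

namespace Fork

variable {S T Z R R' Q Q' : Finset V} {w b c : V}

theorem symm (h : Fork G S T Z R R' Q Q' w b c) : Fork G S T Z R' R Q' Q w c b :=
  ⟨h.cut, h.memw, h.subR', h.subR, h.disj.symm, h.memc, h.memb, h.ne.symm, h.cutR', h.cutR⟩

theorem mem_far (h : Fork G S T Z R R' Q Q' w b c) {v : V} (hv : v ∈ R' ∨ v ∈ T ∨ v = c) :
    v ∈ Q := by
  have hwZ : w ∉ Z := h.cut.notMem_of_memS h.memw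
  rcases h.cutR.cover v with h1 | h1 | h1
  · rcases hv with h2 | h2 | rfl
    · exact absurd h2 (Finset.disjoint_left.mp h.disj h1)
    · exact absurd h2 (Finset.disjoint_left.mp h.cut.disjST (h.subR h1))
    · exact absurd (h.subR h1) (h.cut.notMem_of_mem h.memc)
  · exact h1
  · rw [mem_insert, mem_erase] at h1
    rcases hv with h2 | h2 | rfl
    · rcases h1 with rfl | h1
      · exact absurd h2 (h.cutR'.notMem_of_mem (mem_insert_self _ _))
      · exact absurd (h.subR' h2) (h.cut.notMem_of_mem h1.2)
    · rcases h1 with rfl | h1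
      · exact absurd h2 (Finset.disjoint_left.mp h.cut.disjST h.memw)
      · exact absurd h2 (h.cut.symm.notMem_of_mem h1.2)
    · rcases h1 with rfl | h1
      · exact absurd h.memc hwZ
      · exact absurd rfl h1.1

theorem exists_cliqueModel_far (h : Fork G S T Z R R' Q Q' w b c) (hG : IsKConnected 4 G)
    {D : V → Set V} (hD : RootModel G R' D) (h1 : Touch G (D w) (D c) ∨ G.Adj w b)
    (h2 : ∀ y ∈ nb G R', ∀ z ∈ nb G R', y ≠ c → z ≠ c → y ≠ z → Touch G (D y) (D z)) :
    ∃ E, CliqueModel G Q E ∧ (∀ y, y ≠ b → E y = D y) ∧ D c ⊆ E b ∧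
      ∀ v ∈ E b, v = b ∨ v ∈ T ∨ v ∈ D c := by
  obtain ⟨X, hX, hXT, hXZ⟩ := h.cut.exists_conn hG
  have hwZ : w ∉ Z := h.cut.notMem_of_memS h.memw
  have hmem : ∀ {y}, y ∈ nb G Q ↔ y = w ∨ y ≠ c ∧ y ∈ Z := by
    simp [h.cutR.nbT]
  have hmem' : ∀ {y}, y ∈ nb G R' ↔ y = w ∨ y ≠ b ∧ y ∈ Z := by
    simp [h.cutR'.nbS]
  have hc' : c ∈ nb G R' := hmem'.mpr (Or.inr ⟨h.ne.symm, h.memc⟩)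
  have hwb : w ≠ b := fun heq => hwZ (heq ▸ h.memb)
  have hwc : w ≠ c := fun heq => hwZ (heq ▸ h.memc)
  have htrans : ∀ {y}, y ∈ nb G Q → y ≠ b → y ∈ nb G R' ∧ y ≠ c := fun hy hyb => by
    rcases hmem.mp hy with rfl | hy
    · exact ⟨hmem'.mpr (Or.inl rfl), hwc⟩
    · exact ⟨hmem'.mpr (Or.inr ⟨hyb, hy.2⟩), hy.1⟩
  let E : V → Set V := fun y => if y = b then insert b (X ∪ D c) else D y
  have hEb : E b = insert b (X ∪ D c) := if_pos rfl
  have hE : ∀ y, y ≠ b → E y = D y := fun y hy => if_neg hy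
  have hsubX : X ⊆ E b := hEb ▸ fun x hx => Or.inr (Or.inl hx)
  have hsubD : D c ⊆ E b := hEb ▸ fun x hx => Or.inr (Or.inr hx)
  have hbE : b ∈ E b := hEb ▸ Or.inl rfl
  have hmemE : ∀ v ∈ E b, v = b ∨ v ∈ T ∨ v ∈ D c := by
    rw [hEb]
    rintro v (hv | hv | hv)
    · exact Or.inl hv
    · exact Or.inr (Or.inl (hXT v hv))
    · exact Or.inr (Or.inr hv)
  have hdisj : ∀ y ∈ nb G Q, y ≠ b → Disjoint (E b) (D y) := by
    intro y hy hyb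
    obtain ⟨hy', hyc⟩ := htrans hy hyb
    rw [Set.disjoint_left]
    intro v hv hvy
    have hvy' := hD.sub y hy' v hvy
    rcases hmemE v hv with rfl | hv | hv
    · rcases hvy' with h3 | rfl
      · exact h.cut.notMem_of_mem h.memb (h.subR' h3)
      · exact hyb rfl
    · rcases hvy' with h3 | rfl
      · exact Finset.disjoint_left.mp h.cut.disjST (h.subR' h3) hv
      · rcases hmem.mp hy with rfl | hy
        · exact Finset.disjoint_left.mp h.cut.disjST h.memw hv
        · exact h.cut.symm.notMem_of_mem hy.2 hv
    · exact Set.disjoint_left.mp (hD.disj c hc' y hy' hyc.symm) hv hvy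
  have htouch : ∀ y ∈ nb G Q, y ≠ b → Touch G (E b) (D y) := by
    intro y hy hyb
    obtain ⟨hy', hyc⟩ := htrans hy hyb
    rcases hmem.mp hy with rfl | hyZ
    · rcases h1 with h1 | h1
      · exact h1.symm.mono hsubD le_rfl
      · exact ⟨b, hbE, y, hD.root y hy', h1.symm⟩
    · obtain ⟨x, hx, hxy⟩ := hXZ y hyZ.2
      exact ⟨x, hsubX hx, y, hD.root y hy', hxy⟩
  refine ⟨E, ⟨⟨fun y hy => ?_, fun y hy => ?_, fun y hy v hv => ?_, fun y hy z hz hne => ?_⟩,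
    fun y hy z hz hne => ?_⟩, hE, hsubD, hmemE⟩
  · by_cases hyb : y = b
    · rw [hyb, hEb]
      obtain ⟨x, hx, hxb⟩ := hXZ b h.memb
      obtain ⟨x', hx', hxc⟩ := hXZ c h.memc
      exact (hX.union (hD.conn c hc') ⟨x', hx', c, hD.root c hc', hxc⟩).insert
        ⟨x, Or.inl hx, hxb.symm⟩
    · rw [hE y hyb]; exact hD.conn y (htrans hy hyb).1
  · by_cases hyb : y = b
    · rw [hyb]; exact hbE
    · rw [hE y hyb]; exact hD.root y (htrans hy hyb).1
  · by_cases hyb : y = b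
    · subst hyb
      rcases hmemE v hv with h3 | h3 | h3
      · exact Or.inr h3
      · exact Or.inl (h.mem_far (Or.inr (Or.inl h3)))
      · exact Or.inl (h.mem_far ((hD.sub c hc' v h3).imp_right Or.inr))
    · rw [hE y hyb] at hv
      exact (hD.sub y (htrans hy hyb).1 v hv).imp_left fun h3 => h.mem_far (Or.inl h3)
  · by_cases hyb : y = b
    · rw [hyb, hE z fun hz' => hne (hyb.trans hz'.symm)]
      exact hdisj z hz fun hz' => hne (hyb.trans hz'.symm)
    · by_cases hzb : z = b
      · rw [hzb, hE y hyb]; exact (hdisj y hy hyb).symm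
      · rw [hE y hyb, hE z hzb]
        exact hD.disj y (htrans hy hyb).1 z (htrans hz hzb).1 hne
  · by_cases hyb : y = b
    · rw [hyb, hE z fun hz' => hne (hyb.trans hz'.symm)]
      exact htouch z hz fun hz' => hne (hyb.trans hz'.symm)
    · by_cases hzb : z = b
      · rw [hzb, hE y hyb]; exact (htouch y hy hyb).symm
      · rw [hE y hyb, hE z hzb]
        exact h2 y (htrans hy hyb).1 z (htrans hz hzb).1 (htrans hy hyb).2 (htrans hz hzb).2 hne

theorem exists_pair (h : Fork G S T Z R R' Q Q' w b c) : ∃ a a' : V, a ∈ Z ∧ a ≠ b ∧ a ≠ c ∧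
    ∀ y ∈ nb G R', y = w ∨ y = c ∨ y = a ∨ y = a' := by
  have h1 : #((Z.erase b).erase c) = 2 := by
    rw [card_erase_of_mem (mem_erase.mpr ⟨h.ne.symm, h.memc⟩), card_erase_of_mem h.memb, h.cut.card]
  obtain ⟨a, a', -, heq⟩ := card_eq_two.mp h1
  have h2 : a ∈ (Z.erase b).erase c := heq ▸ mem_insert_self a {a'}
  refine ⟨a, a', mem_of_mem_erase (mem_of_mem_erase h2),
    ne_of_mem_erase (mem_of_mem_erase h2), ne_of_mem_erase h2, fun y hy => ?_⟩
  rw [h.cutR'.nbS, mem_insert] at hy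
  refine hy.imp_right fun hy => or_iff_not_imp_left.mpr fun hyc => ?_
  have h3 : y ∈ (Z.erase b).erase c := mem_erase.mpr ⟨hyc, hy⟩
  simpa [heq] using h3

theorem card_darts_le_four (h : Fork G S T Z R R' Q Q' w b c) (hG : MinorMinimalEnemy G)
    (hR' : 8 * #R' < #(darts G R')) : #(darts G R) ≤ 8 * #R + 4 := by
  obtain ⟨B, C₀, C₁, hB⟩ := h.cutR'.hasK hG.1.1 hR'
  obtain ⟨a, a', haZ, hab, hac, hall⟩ := h.exists_pair
  have hwa : w ≠ a := fun heq => h.cut.notMem_of_memS h.memw (heq ▸ haZ)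
  have hwn : w ∈ nb G R' := h.cutR'.nbS ▸ mem_insert_self _ _
  have hcn : c ∈ nb G R' :=
    h.cutR'.nbS ▸ mem_insert_of_mem (mem_erase.mpr ⟨h.ne.symm, h.memc⟩)
  obtain ⟨D, hD, ht⟩ := hB.exists_two_star hwn
    (h.cutR'.nbS ▸ mem_insert_of_mem (mem_erase.mpr ⟨hab, haZ⟩)) hwa
  have hwc : w ≠ c := fun heq => h.cut.notMem_of_memS h.memw (heq ▸ h.memc)
  obtain ⟨E, hE, -⟩ := h.exists_cliqueModel_far hG.1.1 hD
    (Or.inl (ht w hwn c hcn hwc (Or.inl rfl))) fun y hy z hz hyc hzc hne => by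
      refine ht y hy z hz hne ?_
      rcases hall y hy with h1 | h1 | h1 | h1 <;> rcases hall z hz with h2 | h2 | h2 | h2
      all_goals first | exact absurd h1 hyc | exact absurd h2 hzc | skip
      all_goals first | exact absurd (h1.trans h2.symm) hne | simp [h1, h2]
  exact h.cutR.card_darts_le_four hG ⟨E, hE⟩

theorem card_darts_le_two (h : Fork G S T Z R R' Q Q' w b c) (hG : MinorMinimalEnemy G)
    (hR' : 8 * #R' < #(darts G R')) (hw : ∀ z ∈ Z, G.Adj w z) :
    #(darts G R) ≤ 8 * #R + 2 := by
  obtain ⟨B, C₀, C₁, hB⟩ := h.cutR'.hasK hG.1.1 hR'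
  obtain ⟨a, a', haZ, hab, hac, hall⟩ := h.exists_pair
  have hwn : w ∈ nb G R' := h.cutR'.nbS ▸ mem_insert_self _ _
  have hcn : c ∈ nb G R' :=
    h.cutR'.nbS ▸ mem_insert_of_mem (mem_erase.mpr ⟨h.ne.symm, h.memc⟩)
  have han : a ∈ nb G R' := h.cutR'.nbS ▸ mem_insert_of_mem (mem_erase.mpr ⟨hab, haZ⟩)
  obtain ⟨D, hD, h1, h2, h3⟩ := hB.absorb han
  have hwD : ∀ z ∈ nb G R', z ≠ w → Touch G (D w) (D z) := by
    intro z hz hzw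
    refine hD.touch_of_adj hwn hz (hw z ?_)
    rw [h.cutR'.nbS, mem_insert, mem_erase] at hz
    exact (hz.resolve_left hzw).2
  obtain ⟨E, hE, hED, hcE, hEb⟩ := h.exists_cliqueModel_far hG.1.1 hD
    (Or.inr (hw b h.memb)) fun y hy z hz hyc hzc hne => by
      by_cases hyw : y = w
      · rw [hyw]; exact hwD z hz fun hz' => hne (hyw.trans hz'.symm)
      by_cases hzw : z = w
      · rw [hzw]; exact (hwD y hy hyw).symm
      by_cases hya : y = a
      · rw [hya]; exact h3 z hz fun hz' => hne (hya.trans hz'.symm)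
      by_cases hza : z = a
      · rw [hza]; exact (h3 y hy hya).symm
      have := hall y hy
      have := hall z hz
      have hya' : y = a' := by tauto
      have hza' : z = a' := by tauto
      exact absurd (hya'.trans hza'.symm) hne
  have hmem : ∀ y ∈ nb G Q, y ≠ b → y ∈ nb G R' := fun y hy hyb => by
    rw [h.cutR.nbT, mem_insert, mem_erase] at hy
    rw [h.cutR'.nbS, mem_insert, mem_erase]
    exact hy.imp_right fun hy => ⟨hyb, hy.2⟩
  refine h.cutR.card_darts_le_two hG ⟨E, C₁, hE, hB.conn₁,
    fun v hv => h.mem_far (Or.inl (hB.sub₁ v hv)), fun y hy => ?_, fun y hy => ?_⟩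
  · by_cases hyb : y = b
    · rw [hyb, Set.disjoint_left]
      intro v hv hvE
      have hvS := h.subR' (hB.sub₁ v hv)
      rcases hEb v hvE with rfl | h4 | h4
      · exact h.cut.notMem_of_mem h.memb hvS
      · exact Finset.disjoint_left.mp h.cut.disjST hvS h4
      · exact Set.disjoint_left.mp (h1 c hcn) hv h4
    · rw [hED y hyb]; exact h1 y (hmem y hy hyb)
  · by_cases hyb : y = b
    · rw [hyb]; exact (h2 c hcn).mono le_rfl hcE
    · rw [hED y hyb]; exact h2 y (hmem y hy hyb)

end Fork

end Forks

section Excess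

open Finset
open scoped Classical

variable {V : Type} [Fintype V] {G : SimpleGraph V}

theorem card_darts_le_of_card_le_one {R : Finset V} (hR : #R ≤ 1) (h4 : #(nb G R) ≤ 4) :
    #(darts G R) ≤ 8 * #R := by
  have h1 : darts G R ⊆ (R ×ˢ nb G R) ∪ (nb G R ×ˢ R) := by
    intro p hp
    obtain ⟨hadj, hp⟩ := mem_darts.mp hp
    have hne : ∀ {x y}, x ∈ R → G.Adj x y → y ∈ nb G R := fun {x y} hx hxy =>
      mem_nb.mpr ⟨fun hy => hxy.ne (card_le_one.mp hR x hx y hy), x, hx, hxy⟩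
    rw [mem_union, mem_product, mem_product]
    exact hp.imp (fun hp => ⟨hp, hne hp hadj⟩) fun hp => ⟨hne hp hadj.symm, hp⟩
  have h2 := (card_le_card h1).trans (card_union_le _ _)
  rw [card_product, card_product] at h2
  nlinarith

namespace Cut4

variable {S T Z : Finset V}

theorem card_darts_le_split (h : Cut4 G S T Z) {R R' : Finset V} {w : V}
    (hS : S = insert w (R ∪ R')) :
    #(darts G S) ≤ #(darts G R) + #(darts G R') + 2 * #{z ∈ Z | G.Adj w z} := by
  have h1 : darts G S ⊆ (darts G R ∪ darts G R') ∪
      (({w} ×ˢ {z ∈ Z | G.Adj w z}) ∪ ({z ∈ Z | G.Adj w z} ×ˢ {w})) := by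
    intro p hp
    obtain ⟨hadj, hp⟩ := mem_darts.mp hp
    have hmem : ∀ {x}, x ∈ S ↔ x = w ∨ x ∈ R ∨ x ∈ R' := by
      intro x; rw [hS, mem_insert, mem_union]
    have hor : ∀ {x y}, x ∈ S → G.Adj x y → x ∉ R → x ∉ R' → y ∉ R → y ∉ R' →
        x = w ∧ y ∈ Z ∧ G.Adj w y := by
      intro x y hx hxy h1 h2 h3 h4
      have hxw : x = w := by have := hmem.mp hx; tauto
      subst hxw
      refine ⟨rfl, (h.mem_or hx hxy).resolve_left fun hy => ?_, hxy⟩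
      have := hmem.mp hy
      exact hxy.ne' (by tauto)
    by_contra hcon
    simp only [mem_union, mem_darts, mem_product, mem_singleton, mem_filter, not_or, not_and]
      at hcon
    obtain ⟨⟨h1, h2⟩, h3, h4⟩ := hcon
    obtain ⟨h1, h1'⟩ := h1 hadj
    obtain ⟨h2, h2'⟩ := h2 hadj
    rcases hp with hp | hp
    · obtain ⟨h5, h6, h7⟩ := hor hp hadj h1 h2 h1' h2'
      exact h3 h5 h6 h7
    · obtain ⟨h5, h6, h7⟩ := hor hp hadj.symm h1' h2' h1 h2
      exact h4 ⟨h6, h7⟩ h5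
  have h2 := card_le_card h1
  have h3 := card_union_le (darts G R ∪ darts G R')
    (({w} ×ˢ {z ∈ Z | G.Adj w z}) ∪ ({z ∈ Z | G.Adj w z} ×ˢ {w}))
  have h4 := card_union_le (darts G R) (darts G R')
  have h5 := card_union_le (({w} : Finset V) ×ˢ {z ∈ Z | G.Adj w z})
    ({z ∈ Z | G.Adj w z} ×ˢ {w})
  rw [card_product, card_product, card_singleton] at h5
  omega

theorem exists_cut4 (h : Cut4 G S T Z) (hG : IsKConnected 4 G) {R : Finset V} (hRS : R ⊆ S)
    (hR : 2 ≤ #R) {w c : V} (hc : c ∈ Z) (hnb : nb G R ⊆ insert w (Z.erase c)) :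
    ∃ Q, Cut4 G R Q (insert w (Z.erase c)) := by
  have h1 := card_insert_le w (Z.erase c)
  rw [card_erase_of_mem hc, h.card] at h1
  have h2 := h.four_le hG hRS (card_pos.mp (by omega))
  have h3 := eq_of_subset_of_card_le hnb (by omega)
  refine ⟨(R ∪ nb G R)ᶜ, h3 ▸ of_nb hG hR (by rw [h3]; omega) (h.leT.trans (card_le_card ?_))⟩
  intro v hv
  have := h.notMem_nb hRS hv
  simpa using this

theorem card_darts_le_six (hG : MinorMinimalEnemy G) : ∀ (n : ℕ) (S T Z : Finset V), #S = n →
    Cut4 G S T Z → #(darts G S) ≤ 8 * #S + 6 := by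
  intro n
  induction n using Nat.strong_induction_on with
  | _ n ih =>
  intro S T Z hn h
  by_contra! hlt
  have h8 : 8 * #S + 8 ≤ #(darts G S) := by
    obtain ⟨k, hk⟩ := even_card_darts G S
    omega
  obtain ⟨B, b, hb, c, hc, hbc, hB, ht⟩ := exists_near_clique h.leT (h.nbT ▸ h.card)
    fun U hU hne => h.symm.four_le hG.1.1 hU hne
  rw [h.nbT] at hb hc ht
  let F : SimpleGraph V :=
    { Adj := fun p q => p ≠ q ∧ ¬ (p = b ∧ q = c) ∧ ¬ (p = c ∧ q = b)
      symm := ⟨fun p q hpq => ⟨hpq.1.symm, fun h => hpq.2.2 h.symm, fun h => hpq.2.1 h.symm⟩⟩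
      loopless := ⟨fun p hp => hp.1 rfl⟩ }
  have hF : AdjExcept F Z b c := fun p _ q _ h1 h2 h3 => ⟨h1, h2, h3⟩
  have h10 := ten_le_pairs h.card hF
  by_cases hcon : IsKConnected 4 (repl G S Z F Empty)
  · rcases h.replace hG hB (F := F) (ι := Empty) (X := fun i => i.elim)
      (fun y hy z hz hyz => ht y hy z hz hyz.1 hyz.2.1 hyz.2.2)
      (fun i => i.elim) (fun i => i.elim) (fun i => i.elim) (fun i => i.elim) hcon with h1 | ⟨⟨e⟩⟩
    · omega
    · have := h.card_of_iso e
      rw [Fintype.card_empty] at this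
      omega
  obtain ⟨-, w, hw, R, R', hRR, hwR, hwR', hS, hnb, hnb'⟩ :=
    h.exists_split hG.1.1 hb hc hbc hF hcon
  have hcard : #S = #R + #R' + 1 := by
    rw [hS, card_insert_of_notMem (by simp [hwR, hwR']), card_union_of_disjoint hRR]
  have hsplit := h.card_darts_le_split hS
  have hdeg : #{z ∈ Z | G.Adj w z} ≤ 4 := h.card ▸ card_filter_le _ _
  have hRS : R ⊆ S := fun v hv => by rw [hS]; simp [hv]
  have hRS' : R' ⊆ S := fun v hv => by rw [hS]; simp [hv]
  have hle : ∀ (U : Finset V) (d : V), #U < #S → d ∈ Z → U ⊆ S →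
      nb G U ⊆ insert w (Z.erase d) → #(darts G U) ≤ 8 * #U + 6 ∧
        (8 * #U < #(darts G U) → ∃ Q, Cut4 G U Q (insert w (Z.erase d))) := by
    intro U d hlt hd hUS hU
    have h1 := (card_le_card hU).trans (card_insert_le w (Z.erase d))
    rw [card_erase_of_mem hd, h.card] at h1
    by_cases h2 : #U ≤ 1
    · have := card_darts_le_of_card_le_one h2 h1
      exact ⟨by omega, fun h => by omega⟩
    · obtain ⟨Q, hQ⟩ := h.exists_cut4 hG.1.1 hUS (by omega) hd hU
      exact ⟨ih #U (by omega) U Q _ rfl hQ, fun _ => ⟨Q, hQ⟩⟩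
  obtain ⟨h1, h2⟩ := hle R c (by omega) hc hRS hnb
  obtain ⟨h1', h2'⟩ := hle R' b (by omega) hb hRS' hnb'
  obtain ⟨Q, hQ⟩ := h2 (by omega)
  obtain ⟨Q', hQ'⟩ := h2' (by omega)
  have hfork : Fork G S T Z R R' Q Q' w b c := ⟨h, hw, hRS, hRS', hRR, hb, hc, hbc, hQ, hQ'⟩
  have h3 := hfork.card_darts_le_four hG (by omega)
  have h3' := hfork.symm.card_darts_le_four hG (by omega)
  have hall : ∀ z ∈ Z, G.Adj w z := by
    have := eq_of_subset_of_card_le (filter_subset (fun z => G.Adj w z) Z) (by rw [h.card]; omega)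
    exact fun z hz => (mem_filter.mp (this ▸ hz)).2
  have := hfork.card_darts_le_two hG (by omega) hall
  omega

end Cut4

end Excess

section Global

open Finset
open scoped Classical

variable {V : Type} [Fintype V] {G : SimpleGraph V}

namespace Cut4

variable {S T Z : Finset V}

theorem two_mul_edges_le (h : Cut4 G S T Z) :
    2 * G.edgeSet.ncard ≤ #(darts G S) + #(darts G T) + pairs G Z := by
  have h1 : 2 * G.edgeSet.ncard = #({p : V × V | G.Adj p.1 p.2} : Finset (V × V)) := by
    have h2 := G.dart_card_eq_twice_card_edges
    have h3 : G.edgeSet.ncard = #G.edgeFinset := by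
      rw [← SimpleGraph.coe_edgeFinset, Set.ncard_coe_finset]
    rw [h3, ← h2, ← Fintype.card_coe]
    exact Fintype.card_congr ⟨fun d => ⟨d.toProd, by simp⟩,
      fun p => ⟨p.1, (mem_filter.mp p.2).2⟩, fun _ => rfl, fun _ => rfl⟩
  rw [h1, pairs]
  refine (card_le_card (t := (darts G S ∪ darts G T) ∪ {p ∈ Z ×ˢ Z | G.Adj p.1 p.2})
    fun p hp => ?_).trans ((card_union_le _ _).trans (Nat.add_le_add_right (card_union_le _ _) _))
  have hadj : G.Adj p.1 p.2 := by simpa using hp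
  simp only [mem_union, mem_darts, mem_filter, mem_product]
  have h2 := h.cover p.1
  have h3 := h.cover p.2
  tauto

theorem le_sum (h : Cut4 G S T Z) (hG : Enemy G) :
    8 * (#S + #T) + 16 ≤ #(darts G S) + #(darts G T) + pairs G Z := by
  have h1 := h.two_mul_edges_le
  have h2 := h.card_eq
  have h3 := hG.2.1
  omega

theorem lt_card_darts (h : Cut4 G S T Z) (hG : MinorMinimalEnemy G) : 8 * #S < #(darts G S) := by
  by_contra! hlt
  have h1 := h.le_sum hG.1
  have h2 := h.symm.card_darts_le_six hG _ _ _ _ rfl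
  have h3 := h.symm.card_darts_add_pairs_le hG (by omega)
  omega

omit [Fintype V] in
theorem exists_antipode {z : V} (e : repl G S Z ⊤ Empty ≃g K2222) (hz : z ∈ Z) :
    ∃ v ∈ S, ¬ G.Adj v z ∧ ∀ u, u ∈ S ∨ u ∈ Z → u ≠ v → u ≠ z → G.Adj v u := by
  have hzm : z ∈ S ∪ Z := mem_union_right _ hz
  obtain ⟨b, hb, hbz⟩ := K2222_exists (e (.inl ⟨z, hzm⟩))
  obtain ⟨x, rfl⟩ := e.surjective b
  obtain ⟨⟨v, hv⟩⟩ | x := x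
  swap
  · exact x.elim
  have hvz : v ≠ z := by
    rintro rfl
    exact hb rfl
  rw [e.map_adj_iff] at hbz
  have hvZ : v ∉ Z := fun hvZ => hbz (Or.inr ⟨hvz.symm, hz, hvZ⟩)
  have hvS : v ∈ S := (mem_union.mp hv).resolve_right hvZ
  refine ⟨v, hvS, fun hadj => hbz (Or.inl ⟨hadj.symm, Or.inr hvS⟩), fun u hu huv huz => ?_⟩
  by_contra hcon
  have hum : u ∈ S ∪ Z := mem_union.mpr hu
  have h1 := K2222_eq_of_not_adj (a := e (.inl ⟨v, hv⟩)) (b := e (.inl ⟨z, hzm⟩))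
    (c := e (.inl ⟨u, hum⟩))
    (by rw [e.map_adj_iff]; exact fun hadj => hbz hadj.symm)
    (by
      rw [e.map_adj_iff]
      rintro (hadj | hadj)
      · exact hcon hadj.1
      · exact hvZ hadj.2.1)
    (fun heq => hvz (by simpa using (e.injective heq).symm))
    fun heq => huv (by simpa using e.injective heq)
  exact huz (by simpa using (e.injective h1).symm)

theorem exists_coneModel_of_iso (h : Cut4 G S T Z) (e : repl G S Z ⊤ Empty ≃g K2222)
    {a b c d : V} (hZ : ∀ y, y ∈ Z ↔ y = a ∨ y = b ∨ y = c ∨ y = d) (hab : a ≠ b) (hac : a ≠ c)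
    (had : a ≠ d) (hbc : b ≠ c) (hcd : c ≠ d) (hbd : G.Adj b d) :
    ∃ B X, ConeModel G S B X := by
  have ha : a ∈ Z := by simp [hZ]
  have hb : b ∈ Z := by simp [hZ]
  have hc : c ∈ Z := by simp [hZ]
  have hd : d ∈ Z := by simp [hZ]
  have hne : ∀ {y z}, y ∈ Z → z ∈ S → y ≠ z := fun hy hz heq => h.notMem_of_mem hy (heq ▸ hz)
  obtain ⟨a', haS, haa, ha'⟩ := exists_antipode e ha
  obtain ⟨b', hbS, hbb, hb'⟩ := exists_antipode e hb
  obtain ⟨c', hcS, hcc, hc'⟩ := exists_antipode e hc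
  obtain ⟨d', hdS, hdd, hd'⟩ := exists_antipode e hd
  have hZadj : ∀ {y z v}, y ∈ Z → z ∈ Z → z ≠ y → v ∈ S →
      (∀ u, u ∈ S ∨ u ∈ Z → u ≠ v → u ≠ y → G.Adj v u) → G.Adj v z :=
    fun hy hz hyz hv h1 => h1 _ (Or.inr hz) (hne hz hv) hyz
  have hneq : ∀ {y z v w}, y ∈ Z → z ∈ Z → z ≠ y → v ∈ S → ¬ G.Adj w z →
      (∀ u, u ∈ S ∨ u ∈ Z → u ≠ v → u ≠ y → G.Adj v u) → v ≠ w :=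
    fun hy hz hyz hv h1 h2 heq => h1 (heq ▸ hZadj hy hz hyz hv h2)
  have hac' : a' ≠ c' := hneq ha hc hac.symm haS hcc ha'
  have hab' : a' ≠ b' := hneq ha hb hab.symm haS hbb ha'
  have had' : a' ≠ d' := hneq ha hd had.symm haS hdd ha'
  have hcb' : c' ≠ b' := hneq hc hb hbc hcS hbb hc'
  have hcd' : c' ≠ d' := hneq hc hd hcd.symm hcS hdd hc'
  have hbd' : b' ≠ d' := hneq hb hd hbd.ne' hbS hdd hb'
  have hadj_ac : G.Adj a' c' := ha' c' (Or.inl hcS) hac'.symm (hne ha hcS).symm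
  have hadj_bd : G.Adj b' d' := hb' d' (Or.inl hdS) hbd'.symm (hne hb hdS).symm
  let B : V → Set V := fun y => {x | x = y ∨ (y = a ∧ x = c') ∨ (y = c ∧ x = a')}
  have hroot : ∀ y, y ∈ B y := fun y => Or.inl rfl
  have hBa : c' ∈ B a := Or.inr (Or.inl ⟨rfl, rfl⟩)
  have hBc : a' ∈ B c := Or.inr (Or.inr ⟨rfl, rfl⟩)
  have htouch : ∀ y ∈ Z, ∀ z ∈ Z, y ≠ z → Touch G (B y) (B z) := by
    have h_ab : Touch G (B a) (B b) := ⟨c', hBa, b, hroot b, hZadj hc hb hbc hcS hc'⟩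
    have h_ac : Touch G (B a) (B c) := ⟨c', hBa, a', hBc, hadj_ac.symm⟩
    have h_ad : Touch G (B a) (B d) := ⟨c', hBa, d, hroot d, hZadj hc hd hcd.symm hcS hc'⟩
    have h_cb : Touch G (B c) (B b) := ⟨a', hBc, b, hroot b, hZadj ha hb hab.symm haS ha'⟩
    have h_cd : Touch G (B c) (B d) := ⟨a', hBc, d, hroot d, hZadj ha hd had.symm haS ha'⟩
    have h_bd : Touch G (B b) (B d) := ⟨b, hroot b, d, hroot d, hbd⟩
    intro y hy z hz hyz
    rcases (hZ y).mp hy with rfl | rfl | rfl | rfl <;>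
      rcases (hZ z).mp hz with rfl | rfl | rfl | rfl <;>
      first | exact absurd rfl hyz | assumption | (apply Touch.symm; assumption)
  refine ⟨B, {b', d'}, ⟨⟨⟨fun y hy => ?_, fun y _ => hroot y, fun y hy v hv => ?_,
    fun y hy z hz hyz => ?_⟩, ?_⟩, ?_, ?_, fun y hy => ?_, fun y hy => ?_⟩⟩
  · have hBeq : ∀ y, y ≠ a → y ≠ c → B y = {y} := fun y h1 h2 => by ext x; simp [B, h1, h2]
    by_cases hya : y = a
    · subst hya
      have : B y = insert y {c'} := by ext x; simp [B, hac]
      rw [this]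
      exact (conn_singleton G c').insert ⟨c', rfl, (hZadj hc ha hac hcS hc').symm⟩
    by_cases hyc : y = c
    · subst hyc
      have : B y = insert y {a'} := by ext x; simp [B, hac.symm]
      rw [this]
      exact (conn_singleton G a').insert ⟨a', rfl, (hZadj ha hc hac.symm haS ha').symm⟩
    rw [hBeq y hya hyc]
    exact conn_singleton G y
  · rcases hv with rfl | ⟨-, rfl⟩ | ⟨-, rfl⟩
    · exact Or.inr rfl
    · exact Or.inl hcS
    · exact Or.inl haS
  · rw [h.nbS] at hy hz
    rw [Set.disjoint_left]
    rintro v (rfl | ⟨rfl, rfl⟩ | ⟨rfl, rfl⟩) (h1 | ⟨h1, h2⟩ | ⟨h1, h2⟩)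
    · exact hyz h1
    · exact hne hy hcS h2
    · exact hne hy haS h2
    · exact hne hz hcS h1.symm
    · exact hyz h1.symm
    · exact hac' h2.symm
    · exact hne hz haS h1.symm
    · exact hac' h2
    · exact hyz h1.symm
  · rw [h.nbS]
    exact htouch
  · exact (conn_singleton G d').insert ⟨d', rfl, hadj_bd⟩
  · rintro v (rfl | rfl)
    · exact hbS
    · exact hdS
  · rw [h.nbS] at hy
    rw [Set.disjoint_left]
    rintro v (rfl | rfl) (h1 | ⟨-, h1⟩ | ⟨-, h1⟩)
    · exact hne hy hbS h1.symm
    · exact hcb' h1.symm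
    · exact hab' h1.symm
    · exact hne hy hdS h1.symm
    · exact hcd' h1.symm
    · exact had' h1.symm
  · rw [h.nbS] at hy
    by_cases hyb : y = b
    · subst hyb
      exact ⟨d', Or.inr rfl, y, hroot y, hZadj hd hy hbd.ne hdS hd'⟩
    · exact ⟨b', Or.inl rfl, y, hroot y, hZadj hb hy hyb hbS hb'⟩

theorem false_of_clique (h : Cut4 G S T Z) (hG : MinorMinimalEnemy G)
    (hZ : ∀ y ∈ Z, ∀ z ∈ Z, y ≠ z → G.Adj y z) : False := by
  obtain ⟨B, C₀, C₁, hB⟩ := h.hasK hG.1.1 (h.lt_card_darts hG)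
  obtain ⟨X, hX, hXT, hXZ⟩ := h.exists_conn hG.1.1
  have hXC : ∀ {C : Set V}, (∀ v ∈ C, v ∈ S) → Disjoint X C := fun hC =>
    Set.disjoint_left.mpr fun v hv hvC => Finset.disjoint_left.mp h.disjST (hC v hvC) (hXT v hv)
  let f : Fin 4 → V := fun i => ((Fintype.equivFinOfCardEq
    (by rw [Fintype.card_coe, h.card]) : {v // v ∈ Z} ≃ Fin 4).symm i).1
  have hfZ : ∀ i, f i ∈ Z := fun i => Subtype.prop _
  have hfinj : ∀ i j, i ≠ j → f i ≠ f j := fun i j hij heq =>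
    hij ((Equiv.injective _) (Subtype.ext heq))
  have hfn : ∀ i, f i ∈ nb G S := fun i => h.nbS ▸ hfZ i
  have hXd : ∀ i, Disjoint X (B (f i)) := fun i => Set.disjoint_left.mpr fun v hv hvB => by
    rcases hB.sub _ (hfn i) v hvB with h1 | rfl
    · exact Finset.disjoint_left.mp h.disjST h1 (hXT v hv)
    · exact h.symm.notMem_of_mem (hfZ i) (hXT _ hv)
  have hXt : ∀ i, Touch G X (B (f i)) := fun i => by
    obtain ⟨x, hx, hxz⟩ := hXZ _ (hfZ i)
    exact ⟨x, hx, f i, hB.root _ (hfn i), hxz⟩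
  let bag : Fin 7 → Set V := ![X, C₀, C₁, B (f 0), B (f 1), B (f 2), B (f 3)]
  have hd : ∀ i j, i < j → Disjoint (bag i) (bag j) := by
    intro i j hij
    fin_cases i <;> fin_cases j <;> first
      | exact absurd hij (by decide)
      | exact hXC hB.sub₀
      | exact hXC hB.sub₁
      | exact hXd _
      | exact hB.disj₀₁
      | exact hB.disj₀ _ (hfn _)
      | exact hB.disj₁ _ (hfn _)
      | exact hB.disj _ (hfn _) _ (hfn _) (hfinj _ _ (by decide))
  have ht : ∀ i j, i < j → K7vee.Adj i j → Touch G (bag i) (bag j) := by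
    intro i j hij hadj
    fin_cases i <;> fin_cases j <;> first
      | exact absurd hij (by decide)
      | exact hXt _
      | exact hB.touch₀₁
      | exact hB.touch₀ _ (hfn _)
      | exact hB.touch₁ _ (hfn _)
      | exact hB.touch_of_adj (hfn _) (hfn _) (hZ _ (hfZ _) _ (hfZ _) (hfinj _ _ (by decide)))
      | exact absurd hadj (by simp [K7vee])
  refine hG.1.2.2.1 (isMinor_iff.mpr ⟨bag, fun i => ?_, fun i j hij => ?_, fun i j hij => ?_⟩)
  · fin_cases i
    exacts [hX, hB.conn₀, hB.conn₁, hB.conn _ (hfn 0), hB.conn _ (hfn 1), hB.conn _ (hfn 2),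
      hB.conn _ (hfn 3)]
  · rcases lt_or_gt_of_ne hij with h1 | h1
    · exact hd i j h1
    · exact (hd j i h1).symm
  · rcases lt_or_gt_of_ne hij.ne with h1 | h1
    · exact ht i j h1 hij
    · exact (ht j i h1 hij.symm).symm

end Cut4

omit [Fintype V] in
/-- At most two missing edges on `Z` either share a vertex or form a perfect matching. -/
theorem exists_cover_or_matching {Z : Finset V} (hZ : #Z = 4) (h4 : #(missing G Z) ≤ 4) :
    (∃ v ∈ Z, ∀ y ∈ Z, ∀ z ∈ Z, y ≠ z → y ≠ v → z ≠ v → G.Adj y z) ∨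
    ∃ a b c d, (∀ y, y ∈ Z ↔ y = a ∨ y = b ∨ y = c ∨ y = d) ∧ a ≠ b ∧ a ≠ c ∧ a ≠ d ∧ b ≠ c ∧
      c ≠ d ∧ G.Adj b d ∧ 4 ≤ #(missing G Z) := by
  by_contra! hcon
  obtain ⟨h1, h2⟩ := hcon
  have hsymm : ∀ {p q}, (p, q) ∈ missing G Z → (q, p) ∈ missing G Z := fun h => by
    obtain ⟨h1, h2, h3, h4⟩ := mem_missing.mp h
    exact mem_missing.mpr ⟨h2, h1, h3.symm, fun h => h4 h.symm⟩
  have havoid : ∀ v ∈ Z, ∃ p q, (p, q) ∈ missing G Z ∧ p ≠ v ∧ q ≠ v := fun v hv => by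
    obtain ⟨y, hy, z, hz, hyz, hyv, hzv, hadj⟩ := h1 v hv
    exact ⟨y, z, mem_missing.mpr ⟨hy, hz, hyz, hadj⟩, hyv, hzv⟩
  obtain ⟨v, hv⟩ : Z.Nonempty := card_pos.mp (by omega)
  obtain ⟨a, b, hab, -⟩ := havoid v hv
  obtain ⟨haZ, hbZ, habne, -⟩ := mem_missing.mp hab
  obtain ⟨c, d, hcd, hca, hda⟩ := havoid a haZ
  obtain ⟨r, s, hrs, hrb, hsb⟩ := havoid b hbZ
  obtain ⟨hcZ, hdZ, hcdne, -⟩ := mem_missing.mp hcd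
  dsimp only at haZ hbZ habne hcZ hdZ hcdne
  have hfour : #({(a, b), (b, a), (c, d), (d, c)} : Finset (V × V)) = 4 := by
    rw [card_insert_of_notMem, card_insert_of_notMem, card_insert_of_notMem, card_singleton]
    all_goals simp only [mem_insert, mem_singleton, Prod.mk.injEq]; tauto
  have hsub : ({(a, b), (b, a), (c, d), (d, c)} : Finset (V × V)) ⊆ missing G Z := by
    intro p hp
    simp only [mem_insert, mem_singleton] at hp
    rcases hp with rfl | rfl | rfl | rfl
    exacts [hab, hsymm hab, hcd, hsymm hcd]
  have heq := eq_of_subset_of_card_le hsub (by omega)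
  rw [← heq] at hrs
  simp only [mem_insert, mem_singleton, Prod.mk.injEq] at hrs
  have hbc : b ≠ c ∧ b ≠ d := by
    constructor <;> rintro rfl <;> tauto
  have hbd : G.Adj b d := by
    by_contra hadj
    have h3 : (b, d) ∈ missing G Z := mem_missing.mpr ⟨hbZ, hdZ, hbc.2, hadj⟩
    rw [← heq] at h3
    simp only [mem_insert, mem_singleton, Prod.mk.injEq] at h3
    tauto
  have hZeq : ({a, b, c, d} : Finset V) = Z := by
    refine eq_of_subset_of_card_le (fun y hy => ?_) ?_
    · simp only [mem_insert, mem_singleton] at hy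
      rcases hy with rfl | rfl | rfl | rfl <;> assumption
    · rw [card_insert_of_notMem, card_insert_of_notMem, card_insert_of_notMem, card_singleton, hZ]
      all_goals simp only [mem_insert, mem_singleton]; tauto
  refine absurd (h2 a b c d (fun y => ?_) habne hca.symm hda.symm hbc.1 hcdne hbd) ?_
  · simp [← hZeq]
  · rw [← heq, hfour]; omega

theorem Cut4.false_of_minimal {S T Z : Finset V} (h : Cut4 G S T Z) (hG : MinorMinimalEnemy G) :
    False := by
  have hsum := h.le_sum hG.1
  have hS := h.hasK hG.1.1 (h.lt_card_darts hG)
  have hT := h.symm.hasK hG.1.1 (h.symm.lt_card_darts hG)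
  have h6 := h.card_darts_le_six hG _ _ _ _ rfl
  have h6' := h.symm.card_darts_le_six hG _ _ _ _ rfl
  have hpm := pairs_add_missing G h.card
  obtain ⟨⟨p, q⟩, hpq⟩ : ({p ∈ Z ×ˢ Z | G.Adj p.1 p.2} : Finset (V × V)).Nonempty :=
    card_pos.mp (by change 0 < pairs G Z; omega)
  obtain ⟨hp, hq, hadj⟩ := mem_pairs_iff.mp hpq
  have hcS := hS.exists_cliqueModel (h.nbS ▸ h.card) (h.nbS ▸ hp) (h.nbS ▸ hq) hadj
  have hcT := hT.exists_cliqueModel (h.nbT ▸ h.card) (h.nbT ▸ hp) (h.nbT ▸ hq) hadj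
  have h4 := h.card_darts_le_four hG hcT
  have h4' := h.symm.card_darts_le_four hG hcS
  rcases exists_cover_or_matching h.card (G := G) (by omega) with
    ⟨v, hv, hcov⟩ | ⟨a, b, c, d, hZ, hab, hac, had, hbc, hcd, hbd, hm⟩
  · have h2 := h.card_darts_le_two hG
      (hT.exists_cone (h.nbT ▸ hv) (by rw [h.nbT]; exact hcov))
    have h2' := h.symm.card_darts_le_two hG
      (hS.exists_cone (h.nbS ▸ hv) (by rw [h.nbS]; exact hcov))
    have hm : missing G Z = ∅ := card_eq_zero.mp (by omega)
    refine h.false_of_clique hG fun y hy z hz hyz => ?_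
    by_contra hadj
    have h5 : (y, z) ∈ missing G Z := mem_missing.mpr ⟨hy, hz, hyz, hadj⟩
    simp [hm] at h5
  · rcases h.card_darts_le_of_clique hG hcT with h2 | ⟨⟨e⟩⟩
    · omega
    · have h2 := h.symm.card_darts_le_two hG
        (h.exists_coneModel_of_iso e hZ hab hac had hbc hcd hbd)
      omega

end Global

/-- a minor-minimal enemy has no 4-separation `(A,B)` with
`|A - B| ≥ 2` and `|B - A| ≥ 2`. -/
theorem statement_8 (V : Type) [Fintype V] (G : SimpleGraph V)
    (h : MinorMinimalEnemy G) :
    ¬ ∃ A B : Set V, IsSeparation G A B ∧ (A ∩ B).ncard = 4 ∧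
        2 ≤ (A \ B).ncard ∧ 2 ≤ (B \ A).ncard := by
  rintro ⟨A, B, hsep, h4, hA, hB⟩
  classical
  have hS : ((A \ B).toFinset : Set V) = A \ B := Set.coe_toFinset _
  have hmem : ∀ v, v ∈ (A \ B).toFinset ↔ v ∈ A ∧ v ∉ B := fun v => by simp
  have hnb : ∀ v ∈ nb G (A \ B).toFinset, v ∈ A ∩ B := by
    intro v hv
    obtain ⟨hv, s, hs, hsv⟩ := mem_nb.mp hv
    rw [hmem] at hv hs
    have hAB : v ∈ A ∪ B := hsep.1 ▸ Set.mem_univ v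
    by_contra hcon
    by_cases hvA : v ∈ A
    · exact hcon ⟨hvA, by_contra fun hvB => hv ⟨hvA, hvB⟩⟩
    · exact hsep.2 hsv ⟨hs, hAB.resolve_left hvA, hvA⟩
  have h2 : 2 ≤ ((A \ B).toFinset).card := by rwa [← Set.ncard_coe_finset, hS]
  have h3 : (nb G (A \ B).toFinset).card ≤ 4 := by
    rw [← h4, ← Set.ncard_coe_finset]
    exact Set.ncard_le_ncard hnb (Set.toFinite _)
  refine (Cut4.of_nb h.1.1 h2 h3 ?_).false_of_minimal h
  refine hB.trans ?_
  rw [← Set.ncard_coe_finset]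
  refine Set.ncard_le_ncard (fun v hv => ?_) (Set.toFinite _)
  rw [Finset.mem_coe, Finset.mem_compl, Finset.mem_union, hmem]
  rintro (h5 | h5)
  · exact hv.2 h5.1
  · exact hv.2 (hnb v h5).1
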